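/- arXiv:1005.4959 — 2 statements merged into one kernel-verified Lean document; each statement's English description precedes it below -/
import Mathlib

section
/- A(19,8) ≤ 135. That is, every binary code of length 19 in which any two distinct codewords have Hamming distance at least 8 has at most 135 codewords. -/
namespace CodeBound

set_option maxRecDepth 100000

/-! ### Kernel-friendly arithmetic -/

/-- Evaluate `n` to a numeral before passing it on. -/
noncomputable def forceNat {α : Type} (n : ℕ) (f : ℕ → α) : α :=
  Nat.rec (f 0) (fun k _ => f (Nat.succ k)) n

/-- Evaluate `z` to a numeral before passing it on. -/
noncomputable def forceInt {α : Type} (z : ℤ) (f : ℤ → α) : α :=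
  Int.rec (fun n => forceNat n fun m => f (Int.ofNat m))
    (fun n => forceNat n fun m => f (Int.negSucc m)) z

/-- Evaluate all entries of `u` before passing it on. -/
noncomputable def forceList {α : Type} (u : List ℤ) (f : List ℤ → α) : α :=
  List.rec (motive := fun _ => (List ℤ → α) → α) (fun f => f [])
    (fun a _ ih f => forceInt a fun a => ih fun l => f (a :: l)) u f

/-- Integer multiplication by direct recursion. -/
noncomputable def imul (a b : ℤ) : ℤ :=
  Int.rec
    (fun m => Int.rec (fun n => Int.ofNat (Nat.mul m n))
      (fun n => Nat.rec (Int.ofNat 0) (fun k _ => Int.negSucc k) (Nat.mul m (Nat.succ n))) b)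
    (fun m => Int.rec
      (fun n => Nat.rec (Int.ofNat 0) (fun k _ => Int.negSucc k) (Nat.mul (Nat.succ m) n))
      (fun n => Int.ofNat (Nat.mul (Nat.succ m) (Nat.succ n))) b) a

/-- Difference of natural numbers as an integer. -/
noncomputable def isub (m n : ℕ) : ℤ :=
  Bool.rec (Int.negSucc (Nat.sub (Nat.sub n m) 1)) (Int.ofNat (Nat.sub m n)) (Nat.ble n m)

/-- Integer addition by direct recursion. -/
noncomputable def iadd (a b : ℤ) : ℤ :=
  Int.rec (fun m => Int.rec (fun n => Int.ofNat (Nat.add m n)) (fun n => isub m (Nat.succ n)) b)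
    (fun m => Int.rec (fun n => isub n (Nat.succ m))
      (fun n => Int.negSucc (Nat.succ (Nat.add m n))) b) a

/-- Integer multiplication that does not look at `b` when `a = 0`. -/
noncomputable def zmul (a b : ℤ) : ℤ :=
  Int.rec (fun m => Nat.rec (Int.ofNat 0) (fun _ _ => imul a b) m) (fun _ => imul a b) a

/-- Dot product, truncated to the shorter list. -/
noncomputable def dot (u : List ℤ) : List ℤ → ℤ :=
  List.rec (fun _ => 0) (fun a _ ih v => List.rec 0 (fun b v' _ => iadd (imul a b) (ih v')) v) u

/-- List lookup with default value. -/
noncomputable def nth {α : Type} (d : α) (l : List α) : ℕ → α :=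
  List.rec (fun _ => d) (fun a _ ih n => Nat.rec a (fun k _ => ih k) n) l

/-- The tail of the list of the numbers `s! * x.choose s * y.choose s`. -/
noncomputable def pairGo (x y len : ℕ) : ℕ → ℕ → List ℤ :=
  Nat.rec (fun _ _ => []) (fun _ ih s acc => Int.ofNat acc ::
    forceNat (Nat.div (Nat.mul acc (Nat.mul (Nat.sub x s) (Nat.sub y s))) (Nat.succ s))
      (ih (Nat.succ s))) len

/-- The numbers `s! * x.choose s * y.choose s` for `s < len`. -/
noncomputable def pairList (len x y : ℕ) : List ℤ := forceList (pairGo x y len 0 1) fun l => l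

/-- Alternate signs, starting with a minus sign iff `b`. -/
noncomputable def altList (l : List ℤ) : Bool → List ℤ :=
  List.rec (fun _ => [])
    (fun a _ ih b => Bool.rec a (imul (Int.negSucc 0) a) b :: ih (Bool.rec true false b)) l

/-- Convolution of the list `A` (preceded by the reversal of `R`) with `B`. -/
noncomputable def conv (A B : List ℤ) : List ℤ → List ℤ :=
  List.rec (fun _ => []) (fun a _ ih R => dot (a :: R) B :: ih (a :: R)) A

/-- The values of the first `len` elementary kernels. -/
noncomputable def kernelList (len n11 n10 n01 n00 : ℕ) : List ℤ :=
  forceList (conv (pairList len n11 n00) (altList (pairList len n10 n01) false) []) fun l => l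

/-- Multiply a coefficient list by `1 ± z`, keeping its length. -/
noncomputable def mulLinear (σ : ℤ) (l : List ℤ) : ℤ → List ℤ :=
  List.rec (fun _ => []) (fun a _ ih p => iadd a (imul σ p) :: ih a) l

/-- The first five coefficients of `(1 + z) ^ p * (1 - z) ^ q`. -/
noncomputable def krawtchoukList (p q : ℕ) : List ℤ :=
  forceList (Nat.rec (Nat.rec [1, 0, 0, 0, 0] (fun _ l => forceList (mulLinear 1 l 0) fun l => l) p)
    (fun _ l => forceList (mulLinear (-1) l 0) fun l => l) q) fun l => l

/-- A weight exponent together with the rows of a Gram factor. -/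
abbrev Block := ℕ × List (List (List ℤ))

/-- The row with indices `h`, `j`. -/
noncomputable def Block.row (B : Block) (h j : ℕ) : List ℤ := nth [] (nth [] B.2 h) j

/-- An entry of the positive semidefinite matrix of a block. -/
noncomputable def Block.entry (B : Block) (h j k l : ℕ) : ℤ :=
  imul (Int.ofNat (Nat.pow 4 B.1)) (dot (B.row h j) (B.row k l))

/-- Gram factors of the blocks attached to a pair of words at distance `2 * (n + 3)`. -/
noncomputable def pairBlocks : List (List (List (Block × Block))) :=
  [[],
  [[((18, [[[13350509], [-2858658, 4734363], [-9670590, 11230734, 9126008]], [[], [-61390, 1584479,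
     101812, 502830], [-2217011, 4747470, 805643, 453805, 2865252], [-11144052, 13869761, 2058775,
     2409983, 2374385, 8723699]], [[], [108681, 13616, -51258, 87953, -83218, -58116, 127693],
     [234718, 1283618, 200672, 321234, 267750, 132357, -212783, 368753], [-2195942, 5471497,
     979236, 866513, 1116151, 731557, -1461818, 616611, 1162065]], [[], [-67451, -828487, -129499,
     -154896, -156265, -83210, 162043, -87960, -620, 58423], [442787, 8784, 30452, 28553, 130495,
     34706, -20858, 289930, -1595, -88003, 81242], [-21096, 2075201, 408461, 407736, 535092,
     329873, -582524, 563288, 61148, -52413, 27279, 194502], [-4975949, 2271782, 342894, 610935,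
     50077, 302934, -600544, -101712, 176909, 643006, -464839, 656314, 3261314]], [[], [-738797,
     -391658, -29136, -188218, -31923, -14162, -11361, -187293, -15087, -3668, -24298, -54929,
     -880, 19277], [85631, -458839, -101526, 33936, -177655, -37334, 59944, 11382, -184, 6665,
     52959, 80861, -4026, -125962, 133427], [408772, 453601, 127633, 144231, 209890, 132640,
     -200947, 409910, 30047, 15731, 59292, 116615, 2548, -56651, 1132, 8229], [-168657, 2435826,
     584317, 363808, 772016, 500739, -862817, 758559, 157602, 173114, -56180, 386231, 8139, 67375,
     -140171, -65573, 218556]]]),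
     (18, [[[], [11211487], [5310144, 13559309]], [[], [2437261, 792349, 1831828], [-320669,
      2025552, 595567, 3483983], [3758526, 4305631, -2186705, 4462306, 10405640]], [[], [124634,
      322551, 1195003, -77423, -307156, 509508], [320854, 934232, 1702332, 328268, -74432, 481312,
      458731], [-1299574, 1654719, 504480, 1627222, 623088, 120946, 1135602, 2150909]], [[],
      [-452486, 129262, 732126, -85700, -276441, 475079, 36202, -23495, 101688], [-9537, 532650,
      1139322, 122981, -101150, 376701, 270745, -32159, 199007, 102117], [-297844, 630446,
      1005649, 298116, -42858, 376627, 357386, 20535, -18558, 103448, 57478], [3442511, 710287,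
      -146765, 842082, 846086, -1423308, 533976, -267724, 1190923, 285922, -340769, 3530756]]])),
    ((16, [[[], [1196867], [629571, 10478780]], [[], [172985, 31638, 294614], [246957, 32424,
     472152, 2055371]], [[], [105303, 24243, 203909, -8716, 107156], [170619, 44276, 262907,
     37007, 8389, 252025], [252956, 78037, 404471, 67246, 55263, 445450, 1425802]], [[], [53686,
     18401, 139990, -15800, 179226, -5425, -1240, 45647], [121292, 31387, 220059, -203, 106867,
     83814, 16527, -26886, 101668], [179437, 48085, 276772, 52207, 4124, 255613, 45673, -37754,
     121535, 159113]], [[], [-1165, 11888, 73859, -11306, 229762, -28801, -1013, 42910, -14715,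
     9972, 83637], [107967, 12236, 232920, -51086, 137498, -128477, 26120, -55440, 78214, 56537,
     -32881, 189402], [154461, 38798, 253590, 21165, 49644, 155654, 29692, -25170, 83613, 81130,
     -32050, 10975, 38075], [157451, 60464, 235907, 105989, -6228, 459767, 83626, 467, 215097,
     255017, 66410, -38444, 110234, 267170]]]),
     (16, [[[], [2431618], [86767, 13461720]], [[], [-28515, 100729, 565701], [128127, 277689,
      1060752, 2252605]], [[], [-23449, 60481, 337086, -5546, 57674], [111, 65417, 344784, 32604,
      -37413, 207668], [-29583, 157856, 887245, 14262, 35621, -70921, 2485162]], [[], [-10532,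
      29061, 167398, -5291, 43847, 8243, -1411, 54036], [4325, 26032, 131906, 14397, 3809, 44193,
      1841, 32901, 90337], [-718, 40188, 220140, 10170, -6585, 29754, 3368, 15934, 38690,
      76498]]])),
    ((12, [[[], [6313149]], [[], [104614, 844025], [-390959, 265993, 16679104]], [[], [46506,
     737391, 23570, 357613], [153353, 832057, -1839, -42025, 727144]], [[], [6308, 647324, 31998,
     473308, -47565, 248918], [98916, 764763, -1446, 119690, 81595, -8981, 373963], [172266,
     897236, -19477, -177342, 156079, -177198, 151210, 460088]], [[], [-34028, 628026, 46762,
     642800, -111004, 111704, -66857, -54749, 167352], [34646, 754243, 36790, 458144, 40926,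
     24797, 70176, 43415, 75802, 791968], [127330, 844700, 360, 56066, 109300, -63342, 49882,
     75425, -107179, -13078, 172353]]]),
     (12, [[[], [14426385]], [[], [122534, 927760], [433108, 459728, 16628094]], [[], [64150,
      448319, 2399, 134865], [89176, 635685, -11123, 98442, 755418]], [[], [45898, 214275, 4792,
      84637, -8039, 298404], [35249, 278913, 4804, 19495, 59109, -87108, 351894], [52020, 416257,
      -1326, 132232, -24413, -97674, -101306, 424933]]]))],
   [((16, [[], [[], [774214], [1391880, 3936146], [1255592, 1216531, 12868837]], [[], [437973,
     -125324, 24593, 365048], [777131, -353492, 33007, 915734, 555411], [-430568, 821830, 393121,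
     -329320, -272754, 2745989]], [[], [263222, -224752, 28670, 576642, -9723, -20077, 94187],
     [370493, 59335, 75937, 230015, 41512, 144842, -108309, 240952], [139533, 750561, 231336,
     -530430, -77412, 611162, -342303, 813949, 403387], [298586, 2222748, 874915, -557299, 592170,
     2309563, -1277324, 2496520, 1344584, 3867233]], [[], [156916, -454959, 16699, 994012, 93118,
     -107458, 105768, -158218, -62262, 19612, 122373], [392966, -466157, 37166, 1152673, 298382,
     -35846, 22160, -43254, -84530, 2440, 90307, 274838], [258271, 324594, 141780, -36708, -2925,
     336027, -190390, 468075, 202280, -5562, -34996, 20047, 57194], [173787, 474762, 276533,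
     267647, 412148, 655876, -351822, 841655, 435692, 20514, 148732, 136210, 43483, 340851]]]),
     (16, [[], [[], [619794], [368357, 3359243], [438600, 50336, 11926131]], [[], [369200, -6748,
      -2654, 115604], [373340, 21128, 3618, 44238, 243609], [392068, 7141, -8305, 42152, 90435,
      1266585]], [[], [174089, -11030, -4484, 86037, -16306, -1176, 61807], [205392, 617, 1721,
      -28919, -3511, 293, 22983, 92386], [229682, 8093, 1381, -11656, 30259, 689, -18093, 21410,
      59559], [1159793, 19883, 20327, -114008, 240654, -90302, -340283, 116908, 110253,
      3387808]]])),
    ((12, [[], [[], [815484], [618940, 12691686]], [[], [555210, -1461, 402701], [679793, 18404,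
     172457, 669050], [867667, 177249, -1532776, 853030, 11585926]], [[], [387738, 2395, 541591,
     -50512, -16526, 278704], [549218, 18913, 333046, 93008, 10702, 41781, 327712], [854554,
     16390, -55763, 231705, 35868, -208486, 108578, 352511]], [[], [370863, -12816, 638492,
     -113337, -19512, 130087, -50508, -73020, 136078], [583713, 24761, 394917, 56082, 7065, 76526,
     38833, 55367, 7434, 674321], [714293, 9434, 169396, 95571, 15211, -69059, 83637, 129182,
     -9419, 11504, 136227], [796505, 27737, -29039, 420743, 32345, -214654, 311917, 114470,
     -133126, -125480, 57911, 1636367]]]),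
     (12, [[], [[], [602519], [67996, 12474943]], [[], [287241, 1050, 151229], [393207, 138,
      179323, 472250], [1106566, -45998, 619807, -35141, 6391871]], [[], [176225, 6247, 60121,
      -24270, 198, 161314], [209451, -7111, 8539, -5500, -538, -39208, 273004], [231706, -2365,
      78885, -17789, -1895, -20811, -11674, 202682]]])),
    ((11, [[], [[], [236532], [338899, 12749570]], [[], [45709, 2811, 126260], [105194, 8248,
     96080, 479805]], [[], [80351, 6349, 128732, 9468, 111006], [98307, 5954, 123281, 17650,
     15591, 168699], [-183, 4110, 146518, -12204, 15887, -12918, 243534]], [[], [66925, 2852,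
     103812, 6034, 17695, 9442, -18235, 51443], [92469, 15807, 109553, 18163, 62327, 5328, 11996,
     22970, 390547], [84522, 2026, 88505, 3982, 3039, 13041, -18789, 8171, -2665, 85210]]]),
     (11, [[], [[], [172147], [46122, 12373214]], [[], [2471, -80, 40036], [-9796, -1736, 10584,
      350056]], [[], [9370, 1732, -3415, 323, 90148], [-19570, -2926, 11843, -1556, -5585,
      163914], [-24426, 1215, 3469, 1396, 43470, -110, 222963]]]))],
   [((13, [[], [], [[], [900462], [733596, 886767], [723303, 974807, 6561055]], [[], [855929,
     -61144, -22179, 307083], [858759, 162064, 36474, -13528, 359755], [822801, 381984, 105728,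
     -216504, 214116, 473905], [-901614, -139442, -226609, -240757, 414548, -561134, 13535981]],
     [[], [908896, -198240, -59699, 162568, -91017, -148923, -428, 185769], [766078, 166213,
     -70290, 107573, -85363, -158833, 12629, 110998, 879642], [857492, 220502, 65537, -63388,
     137996, 221547, -727, -24921, -34901, 161360], [731764, 588866, 183294, -266112, 401229,
     549541, -4589, -245083, -98045, 263757, 780504]]]),
     (13, [[], [], [[], [762703], [540448, 1035825], [1756816, 119782, 11491688]], [[], [299696,
      105785, 1032, 383296], [426328, 58151, 4224, -89922, 373231], [622321, -32884, 2941, -90067,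
      -56420, 256998], [-213977, -174708, 160252, 365717, -757036, -403967, 15234362]]])),
    ((10, [[], [], [[], [388633], [411623, 1234861], [-1649000, -12734, 16146563]], [[], [415616,
     22957, 358, 356068], [380281, -705, -1619, 89531, 524031], [292947, 19172, -2088, 145141,
     58642, 419934]], [[], [361744, 14525, -2239, 41300, 20539, -6638, 121649], [481822, 108430,
     2140, -27320, 16472, 8375, 96328, 1164411], [372174, 16544, -2315, 6820, 3545, 6082, 15260,
     2677, 179458], [396767, -71532, 5372, -45432, -28160, -20136, -128628, 188517, -100324,
     2001257]]]),
     (11, [[], [], [[], [103838], [59768, 761103], [-53101, -51518, 14512658]], [[], [11011, 1821,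
      2529, 170620], [29184, 11350, -2753, -18985, 263686], [32513, -16880, 3717, 64450, -17968,
      228880]]]))]],
  [[((20, [[[11169286], [-3097561, 4645289]], [[], [-831666, 1176271, 1480799], [-3810597, 4108173,
     -372561, 5232146]], [[], [-354498, 579654, 633177, -41916, 317688], [-1331254, 1346634,
     -531665, 998160, -755429, 2165527]], [[], [-244328, -24289, 44532, -57419, 140558, -67040,
     257228], [-277265, 267726, -24828, 197748, 2629, 307039, 71884, 422143], [-1198556, -251200,
     -2837585, 1380814, -2051441, 1433789, -977610, 688001, 2172191]], [[], [-205881, -93078,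
     -85605, -43139, 6921, -89401, 45446, -70270, -1172, 57602], [-121886, -127261, 163692,
     -18438, 33845, 87311, -63845, 122523, -25769, -167158, 116346], [161755, -436, -841334,
     684940, -736593, 949682, -200807, 671539, 105371, -419325, -202463, 391239]], [[], [-130016,
     -83428, -155290, -1671, -145062, -60268, -143500, -100961, -5740, 68017, -47194, -37971,
     40004], [-214273, -142983, 220910, -89776, 36972, -36180, -124237, 1062, -40322, -108145,
     92235, -17607, 43777, 56898], [76807, -102206, -69150, 178943, -159132, 358940, -176570,
     316197, 10236, -237470, 107926, 85062, -78194, 12923, 20250], [694232, 614703, -2606494,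
     1298186, -824854, 1269322, -220964, 738874, 433740, 553279, -62501, 698572, -1077206,
     -469097, -209819, 139510]]]),
     (20, [[[], [8951407]], [[], [2912236, 1173745], [6752898, 2003595, 5870667]], [[], [714986,
      157504, -27782, 263490], [2592797, 920609, 793271, -614290, 2059557]], [[], [24537, 50612,
      50508, 46157, 63474, 189739], [342473, 184740, 231084, 30698, 220859, 427625, 372428],
      [3048429, 759596, 185984, -399699, 136045, -774051, 141747, 2377002]], [[], [-109393, 2190,
      28319, 4580, 34035, 117008, 5082, -1647, 33890], [-46319, 86542, 120467, -98002, 116371,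
      280027, 9367, 19246, -13328, 92343], [64048, 182796, 287849, -368980, 250971, 480291,
      -127218, 92376, -208095, 338971, 312943]]])),
    ((17, [[[], [10473498]], [[], [5292422, 5020200]], [[], [2140649, 1806837, 550569], [3545667,
     2768857, -277179, 4700923]], [[], [343782, -334260, 468022, -15906, 846319], [1955488,
     1458448, 735333, 296259, 343232, 1826702]], [[], [124688, -577786, 152471, 164468, 885705,
     -26157, 397470], [-102278, -734221, 417525, 14153, 708790, 369013, -248855, 509432],
     [2719060, 2070313, 41228, 612901, -280251, 1132352, 513835, 1286768, 1200578]], [[], [559605,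
     -214600, -133182, 369857, 716371, -16267, 700428, 106152, 31030, 232329], [-386840, -1179137,
     362640, -51437, 1007919, 38553, -97859, 166496, 9329, -468, 305875], [554269, -174608,
     578174, -178152, 433382, 302366, -563606, 617364, 56320, 57525, 650448, 255043]]]),
     (17, [[[], [10414136]], [[], [2479839, 2936053]], [[], [1220183, 1127598, 611172], [4709513,
      4705954, 1809729, 4762415]], [[], [323981, 413979, 127087, 138849, 345198], [2111685,
      2135377, 621824, 180913, 162215, 1306353]], [[], [-83689, 46672, -86855, 132985, 319505,
      3553, 83556], [517613, 448406, 253205, -38436, -92936, -6861, 25437, 102491], [1764627,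
      1579221, 782986, -70702, -447240, 362492, -60582, -142233, 1226115]]])),
    ((13, [[], [[], [11863127]], [[], [2247503, 7131891]], [[], [-360526, 4482207, 5573561],
     [1125224, 4945891, 1005782, 8033270]], [[], [-1274478, 943042, 4790258, 8535, 1022724],
     [-1067069, 1277656, 5017992, 145428, 574835, 1324093]], [[], [-2287119, 520001, 7330494,
     -30615, 824204, -151530, 465255], [-1442300, 1975071, 6567592, 79289, 374374, 277117, 26324,
     753883], [1797862, 5320064, -364275, 73170, 440940, 487289, 268557, 353771, 761713]]]),
     (13, [[], [[], [14241110]], [[], [812052, 2546782]], [[], [610304, 741889, 673447], [1553409,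
      1377934, 1222737, 8982133]], [[], [581719, 507457, 426847, 59571, 541662], [-32137, 2071150,
      -864342, -9611, -272537, 1326207]]]))],
   [((17, [[], [[], [5845810], [6379666, 14071524]], [[], [2112886, 55255, 705205], [6777289,
     728931, 827936, 4127980]], [[], [541347, 191659, 207004, -5263, 707935], [2459518, 206609,
     142165, 699104, -107472, 1083819], [5263875, 501133, -9010, 1788014, 1393223, 1677954,
     5113355]], [[], [252530, 134431, 102368, -11018, 709161, -2082, 176158, 266216], [359690,
     409657, 275061, 33018, 1070059, 1943, -367916, -500110, 362058], [2769864, 127510, -672878,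
     1507552, -442213, 1348574, 898305, 609774, -389449, 1454222]], [[], [115458, -20322, 11588,
     -59927, 494692, -38508, 468089, 638971, -136192, -26354, 152783], [-211020, 425915, -41792,
     105487, 1335435, 82969, -207837, -292208, 162127, 77686, -104723, 146431], [797467, 468712,
     165819, 316514, 810510, 246281, -490072, -728204, 418419, 184166, -142831, 133885, 202309],
     [2991132, 382527, 490788, 808864, -560900, 634193, -635995, -1064697, 879252, 457791,
     -103636, 214633, 610515, 229400]]]),
     (17, [[], [[], [5752662], [-866373, 11929667]], [[], [1812009, 152505, 1110683], [3345492,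
      178357, 1991888, 2852872]], [[], [378543, 143265, 869330, 5546, 310238], [2284714, 173287,
      1377254, 102621, 156611, 856517], [5292141, 280009, 2609005, -102186, -331686, 101607,
      3538861]], [[], [-296595, 101678, 541894, 6137, 347106, -1609, -2143, 43630], [458764,
      49546, 334144, 8520, 47112, 26662, 1478, 14284, 116689], [1569502, 89076, 778634, 65637,
      130653, 192374, 15699, -628, 361499, 910683]]])),
    ((14, [[], [[], [5264130]], [[], [70313, 3216757], [4003600, 2083681, 9396432]], [[], [1056481,
     2139913, 379191, 1119373], [2642188, 2250026, 779114, 1635402, 2180442]], [[], [1138511,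
     1754529, 391507, 1137286, 26825, 300386], [797016, 2816720, 225025, 504073, 133051, 55169,
     290007], [1732243, 1602437, 352229, 233312, 749266, 198231, 786719, 2357078]], [[], [33883,
     2664328, 102547, 582303, -252534, 76670, -303755, -101106, 361632], [1474183, 1827768,
     521816, 1462857, 61388, -49096, 92572, -2565, -43585, 285358], [1414018, 1850295, 375066,
     828390, 271955, 197245, 324684, 106265, -313377, -34258, 219418]]]),
     (13, [[], [[], [7162785]], [[], [2715217, 6759409], [3108775, 6742280, 16468816]], [[],
      [1534232, 3770422, -5227, 152212], [2069268, 5285539, -18349, -622849, 3313647]], [[],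
      [804205, 1854948, 104187, -496855, 339675, 894285], [764018, 1683480, 7128, 52421, 6373,
      100975, 476493], [296015, 656129, -75198, -63862, 44823, 338234, -283278, 4243001]]])),
    ((12, [[], [[], [9188824]], [[], [670718, 980439]], [[], [1190763, 1490532, 605771], [737349,
     824730, 51333, 3849938]], [[], [-113346, -44314, -442234, 52432, 592319], [608660, 904090,
     -78929, 4504, 70612, 401654]], [[], [792699, 983597, 361709, 11291, 126963, 9363, 171895],
     [1161588, 1524519, 429438, 6678, 42835, -2097, 24922, 220137], [1404225, 1782576, 699006,
     -3934, -47850, -20225, -133710, 26637, 258220]]]),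
     (11, [[], [[], [14365684]], [[], [6894, 472429]], [[], [-12928, 44168, 228626], [-148179,
      -193265, 19545, 7266753]], [[], [14551, 68476, -47455, -3466, 379360], [-42330, -350035,
      85553, 3938, -90343, 738188]]]))],
   [((14, [[], [], [[], [4466078], [-5290663, 12499574]], [[], [2307278, 155278, 1526195],
     [2018618, 56638, 1363426, 2687544], [-3664964, -357053, -2050837, -583347, 11675058]], [[],
     [857390, 281965, 2701675, -7467, -5969, 327242], [1662339, 149366, 1226155, 84506, 11224,
     -75479, 471699], [4419834, -164219, -1169707, 280866, -64918, -390083, 218186, 2002035]],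
     [[], [383884, 315519, 3127761, -30762, -12010, 312147, -74031, -13147, 153239], [1184148,
     206571, 1757331, 52722, 6600, 58786, 147717, 22, -9344, 275305], [3693437, 59335, 426225,
     47998, 11236, -128410, 176524, 7402, -47059, 45066, 201116], [6134293, -214913, -2238289,
     91076, 16346, -538856, 338139, -3876, -22402, 109246, 183774, 569842]]]),
     (14, [[], [], [[], [2328322], [6885665, 13362899]], [[], [1369013, 18432, 348896], [3241307,
      133133, 190314, 3312337], [4788974, 270483, 1032013, 295603, 12780902]], [[], [1191293,
      27375, 142925, 32591, 4873, 230073], [884286, 8842, 231, 9774, -1142, 8257, 285540],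
      [880420, -41976, -20949, 266346, -9640, -137725, -96063, 2078253]]])),
    ((13, [[], [], [[], [1283743], [1271242, 8804604]], [[], [1058748, 680, 144044], [1358646,
     -3115, 146176, 1259912]], [[], [1487494, 2365, 149074, 3171, 94197], [1380601, 1027, 161257,
     4182, 18683, 142009], [2024924, -6863, 202290, -40667, 128817, -44235, 1379830]], [[],
     [1233288, 1501, 127136, 2406, 22708, 14150, 2063, 54285], [1506200, 2568, 110840, 3477,
     30745, 21268, 7564, 48939, 125950], [975788, -26, 85504, -10, 284, 2763, -2087, 2952, -6648,
     80107]]]),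
     (13, [[], [], [[], [166923], [-4954, 9310938]], [[], [9781, -356, 79889], [-30041, 16156,
      -11112, 1291820]], [[], [15348, 539, -22615, -1367, 81627], [36633, -799, 25601, -1886,
      6326, 151732], [-41920, 21753, 847, -33981, 38985, 21755, 1417266]]]))]],
  [[((19, [[[11257984]], [[], [-9066566, 7989288]], [[], [-2272997, 2050757, 1449036]], [[],
     [-966706, 506626, 500136, 473228], [-559030, 2158942, 455506, -1384502, 4277673]], [[],
     [-491995, -138563, 34819, 235318, -43422, 120899], [71365, 1109158, 146604, -509047, 305313,
     -594968, 990463]], [[], [-110552, -285021, -216459, -137726, -41542, 90126, -36858, 69709],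
     [252800, -247955, -22586, 368071, 60615, -10954, 252094, -261319, 144590], [2541289, 1718314,
     -442600, -1957514, 674491, -1057016, 1401560, -88086, 652621, 744151]], [[], [70801, 31458,
     -79183, -327215, -13196, -76145, -189510, 69623, -102355, -64020, 7978], [54629, -549778,
     -253178, 168582, -28517, 131183, 112513, -118490, 77787, 34768, -32418, 97139], [1122889,
     376496, -134496, -293359, 281517, -382003, 672897, -266685, 364609, 217807, -33195, -635,
     9426]]]),
     (19, [[], [[], [10252573]], [[], [2844243, 1685956]], [[], [484988, 321396, 650633],
      [2775676, 795179, -464795, 4832092]], [[], [-137563, 47151, 367963, -14919, 128188],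
      [193359, 88879, 266986, 9307, 41878, 838869]], [[], [-405379, -98487, 151637, -17593,
      158438, 5941, 52964], [46026, 67815, 224382, -3466, 38674, 8046, 75981, 27852], [661108,
      284884, 273616, 17251, -136190, 9588, 28397, 29856, 111903]]])),
    ((15, [[], [], [[], [11645728]], [[], [4120677, 1672975]], [[], [-121808, 712424, 1283710],
     [10561106, 3751174, -482480, 5251025]], [[], [-2444586, 28677, 1877190, 3600, 379095],
     [2666286, 1400946, 549933, 63770, -181464, 465247]], [[], [-3054062, -624990, 1756195,
     125038, 838065, 16731, 715590], [403322, 821501, 1206318, 161282, -304978, 368828, 286208,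
     1070040], [8992096, 2511701, -1581377, 85968, 340655, 540227, 11568, -48352, 477862]]]),
     (14, [[], [], [[], [16649121]], [[], [3337652, 4467926]], [[], [1854804, 2537351, 355315],
      [9267689, 10590741, -296674, 13578978]], [[], [948667, 1409250, 276005, -15265, 406374],
      [831938, 1105003, -15065, -6733, 98533, 539706]]])),
    ((11, [[], [], [], [[], [11260545]], [[], [9981404, 4669045]], [[], [8523536, 8427230,
     2377927], [11183399, 1304672, 322136, 2782986]], [[], [7814659, 11063464, 2064107, -879477,
     2754250], [8250756, 6823109, 942380, -58609, -787291, 6882630]]]),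
     (10, [[], [], [], [[], [13091755]], [[], [6287943, 1519294]], [[], [3343214, 686953,
      4970477], [4326859, 1971073, -4845611, 6508041]]]))],
   [((16, [[], [[], [10564719]], [[], [384506, 2131846]], [[], [178917, 310529, 516228], [1039662,
     942096, 990971, 7705562]], [[], [120965, 161234, 309956, 17851, 252552], [372160, 531200,
     624809, 429131, -19348, 1646123]], [[], [79912, 45757, 135891, 51861, 410714, 17002, 102153],
     [169371, 231154, 376654, 91574, -12881, 77175, 82789, 223619], [221308, 333630, 482797,
     120024, -246470, 143506, 212167, 340280, 412985]], [[], [100839, -32639, -114538, 261907,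
     253367, 185053, 300266, 275993, -148384, 314828], [98900, 140560, 349012, -41752, 429613,
     -58157, -99781, -58688, 43480, -116756, 227247], [166619, 286282, 508446, -14694, 58640,
     5419, -16823, 80035, 247841, -122340, 10733, 67909]]]),
     (16, [[], [[], [9583351]], [[], [75628, 1213139]], [[], [43243, 236556, 320494], [140589,
      825126, 1196755, 6292633]], [[], [26863, 147548, 198393, 750, 48531], [91046, 484797,
      597662, 23414, 35922, 1351402]], [[], [7897, 54600, 80211, -57, 34708, -7062, 75557],
      [14009, 69498, 90418, -242, -27693, 1087, 20865, 66910], [21120, 108689, 142514, -253,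
      -28130, 4186, -43246, 11130, 101588]]])),
    ((12, [[], [], [[], [11595671]], [[], [42008, 1053055]], [[], [-32324, 796570, 538536],
     [199683, 1358625, -104515, 8616959]], [[], [-81911, 563848, 834235, -3420, 354050], [44334,
     885255, 158378, 19862, 26540, 482851]], [[], [-120390, 519257, 1051120, -14008, 117359,
     -149939, 260509], [13823, 1018468, 494503, 52730, 6780, -79030, 51284, 1399169], [53165,
     1082055, 5474, 9546, -66865, 121867, -77052, 9305, 275501]]]),
     (11, [[], [], [[], [13205072]], [[], [381020, 1557198]], [[], [214257, 777893, 238137],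
      [-3655, 649725, 302284, 15454296]], [[], [136023, 500913, 123680, 5772, 566974], [125232,
      529137, 119643, -11870, -23324, 769342]]])),
    ((8, [[], [], [], [[], [3818716]], [[], [2041744, 2023778]], [[], [3005442, 2150468, 2517019],
     [3108859, 2560847, 191918, 3944158]], [[], [1791993, 2145583, 477572, -70101, 1326675],
     [2445249, 1694592, 488286, 466457, 991983, 9957018]]]),
     (6, [[], [], [], [[], [9868143]], [[], [2760, 2672385]], [[], [2214476, -818670, 9178828],
      [-1010947, 846613, -425392, 14817724]]]))],
   [((14, [[], [], [[], [1907240]], [[], [47953, 238826], [-96623, -144339, 9050101]], [[], [30114,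
     200749, 332, 100322], [47721, 307251, -35562, 72747, 1498013]], [[], [18387, 169418, -94,
     133041, -339, 87946], [44024, 220145, 155, 55842, 2553, -2427, 94217], [69576, 267012, -142,
     -42416, 3614, -51675, 58606, 133135]], [[], [4101, 158146, 332, 185314, -2397, 33417, -26896,
     -20552, 49196], [28421, 184694, 489, 100387, 1174, 26997, 41432, 18924, -6214, 279066],
     [56465, 240581, 196, 9371, 2218, -18319, 23575, 24149, -35127, -1102, 50115]]]),
     (14, [[], [], [[], [3365290]], [[], [25393, 250095], [168520, 432572, 9660564]], [[], [12725,
      119785, 347, 35424], [29887, 236331, -4895, 15110, 1498718]], [[], [10156, 41305, 254,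
      15696, 1463, 91307], [7068, 82882, 59, 4871, -490, -37472, 86704], [12861, 147920, 472,
      44739, -980, -30289, -12892, 138092]]])),
    ((10, [[], [], [[], [12200010]], [[], [-35187, 400196]], [[], [-48041, 217147, 261600],
     [-42759, 287759, 220583, 9794098]], [[], [-44250, 280939, 216633, 5046, 299493], [-42173,
     290010, 182979, -520, 36445, 384347]], [[], [-46846, 216924, 232477, 1335, 31184, 17474,
     117447], [-40263, 345384, 185049, 16367, 35441, -18452, 9074, 1370212], [-50619, 224718,
     274094, -1293, -16228, -21698, -62843, -1137, 223608]]]),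
     (11, [[], [], [[], [10805402]], [[], [3477, 170311]], [[], [98, 9312, 50815], [4747, -59678,
      -12189, 4936470]], [[], [4765, 22317, -3106, 727, 147881], [-4440, -27450, 23754, -459,
      -15457, 195250]]]))]],
  [[((19, [[[8899958]], [], [], [[], [-4564851, 3267953]], [[], [-1400218, 541718, 824525]], [[],
     [-293384, -69957, 231170, 160367], [238727, 1286366, -339343, -671516, 1255967]], [[],
     [317289, -281064, -250527, 68807, -45672, 34690], [-41029, 253622, 14853, -76283, 446883,
     -83707, 274949]], [[], [117592, -113244, -422821, -214884, -265361, -14535, -5863, 32981],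
     [143080, -152732, 16960, 89027, 204730, -35112, -87739, -27633, 324764], [1244439, 1274366,
     -971120, -786226, 1639866, 36465, 41242, -228633, -355, 57053]]]),
     (18, [[], [], [], [[], [10430210]], [[], [1254305, 1268293]], [[], [-24293, 454769, 1055409],
      [4880153, 630951, 1383843, 2520119]], [[], [127953, -96249, 1543084, 479345, 57280],
      [-28096, 61592, 1337832, 172916, 24544, 681366]]])),
    ((15, [[], [], [], [], [[], [9971196]], [[], [6216437, 2256605]], [[], [84383, 5475906,
     1517634], [8157644, 4881151, 3151375, 8239658]], [[], [-9604246, 10341507, 4469942, -331070,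
     1484071], [8045224, 3951347, 448381, 505922, -1026952, 6431988]]]),
     (15, [[], [], [], [], [[], [11269647]], [[], [-475756, 4928932]], [[], [-3938228, 4264680,
      864615], [7953801, 2277344, -1402866, 7012265]]])),
    ((14, [[], [], [], [], [], [[], [7960941]], [[], [4099666, 1690718]], [[], [], [8719660, -7369,
     15175480]]]),
     (14, [[], [], [], [], [], [[], [11628179]], [[], [7859231, 1016655]]]))],
   [((16, [[], [], [], [[], [8439888]], [[], [2441092, 1443322]], [[], [411705, -81031, 1706450],
     [4480106, -2153585, 663224, 3174231]], [[], [96417, -524695, 1494764, 165661, 485687],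
     [1863544, -860158, 66140, 1167180, 414912, 1218211]], [[], [338873, -327313, 94071, 241118,
     948730, 81003, 309254], [1043489, -49971, 1388450, 342221, 417717, -78062, 98855, 1279747],
     [4165193, -1762630, 538670, 2795274, 218672, -13197, -123087, 14852, 267061]]]),
     (14, [[], [], [], [[], [10835392]], [[], [2706514, 4402561]], [[], [1480784, 2603787,
      599224], [2043180, 3155284, -556293, 1082308]], [[], [638833, 1282860, 632120, 54338,
      270184], [1389583, 2122074, 695919, 155644, 268443, 3881225]]])),
    ((13, [[], [], [], [], [[], [4955495]], [[], [6160678, 3779983]], [[], [3115198, -2584111,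
     1679794], [8550589, 7259177, -1125964, 6836320]], [[], [858311, -8721140, 2788417, -82324,
     891837], [9615039, 5504694, 300737, 1805563, 58548, 5747030]]]),
     (12, [[], [], [], [], [[], [3657715]], [[], [1667486, 364895]], [[], [626295, 268226,
      677688], [527167, 304285, 51188, 10107870]]])),
    ((13, [[], [], [], [], [], [[], [10667246]], [[], [4009969, 812164]], [[], [], [10942670,
     523486, 6355583]]]),
     (7, [[], [], [], [], [], [[], [8161009]], [[], [-1470315, 15689021]]]))],
   [((12, [[], [], [], [[], [12462441]], [[], [-903393, 2508851]], [[], [-964791, 2319163, 744987],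
     [-761611, 2306343, -92487, 1036979]], [[], [-951546, 2115841, 1027257, -126213, 397258],
     [-1050922, 3272863, 843708, 106865, 98187, 4729554]], [[], [-1015021, 2099564, 1303619,
     -271196, 251339, -16919, 330165], [-1181658, 3611574, 1391678, -103858, 156452, 739186,
     68496, 6314068], [-918067, 2601769, 54853, 214580, -131179, 2007, -175549, -3534, 517902]]]),
     (14, [[], [], [], [[], [13803706]], [[], [1151259, 340189]], [[], [1571312, 178163, 292072],
      [2503063, 238739, 552915, 229443]], [[], [1156563, 119120, 201689, -40757, 112500], [239982,
      174854, -136677, 16941, -33247, 1197641]]])),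
    ((10, [[], [], [], [], [[], [1174244]], [[], [602918, 565866]], [[], [795823, 611909, 465451],
     [537311, 576784, 75657, 7013590]], [[], [555683, 561318, 168789, 3110, 389073], [678934,
     453018, 126801, 271214, 163857, 9092990]]]),
     (9, [[], [], [], [], [[], [2841948]], [[], [-171757, 603982]], [[], [833857, -307302,
      1029076], [-327192, 79649, -76596, 14746061]]]))]]]

/-- Gram factors of the blocks attached to the empty configuration. -/
noncomputable def baseBlocks : List (List Block) :=
  [
   [(19, [[], [[480880]], [[-162812, 958063]], [[-426176, 529637, 328572]], [[-194574, -32481,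
     1172021, 391608]], [[2787120, -1701656, 4149532, 960194, 1079980]], [[8491102, -2896266,
     14468846, -713839, 385277, 10760737]]]),
    (17, [[], [[328610]], [[459764, 297274]], [[216424, 187127, 329501]], [[-121397, -21225,
     744744, 40083]], [[-19969, 374787, 842827, 10108, 619518]], [[-2965954, -1457359, -833099,
     -260427, -463470, 10439411]]]),
    (13, [[], [[960990]], [[966302, 1166916]], [[1023650, 2318775, 160197]], [[1016503, 3025846,
     169842, 134502]], [[897572, 8581943, 723473, -201648, 2607181]]]),
    (11, [[], [[421306]], [[350478, 103695]], [[453924, -4724, 39814]], [[292404, 32985, -16250,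
     127922]], [[-11554284, 347375, -213641, -439556, 3866858]]]),
    (4, [[], [[940014]], [[-1488458, 4009253]], [[653458, -341451, 1008503]], [[-4958197,
     -4108722, 7991757, 11754941]]]),
    (3, [[], [[392792]], [[473560, 4554457]], [[89188, 96392, 702232]], [[-5516525, -2772837,
     -3017812, 11950028]]]),
    (1, [[], [[2267267]], [[1855967, 10981356]], [[-6881147, -90711, 3305846]]]),
    (5, [[], [[7142100]], [[2888462, 590258]], [[-8597639, -41487, 137648]]]),
    (1, [[], [[1074125]], [[-2437888, 9440401]]]),
    (2, [[], [], [[9445644]]])],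
   [(20, [[], [[71109]], [[119308, 279616]], [[76474, 181159, 189085]], [[57911, -253106, 672296,
     83108]], [[2039055, -1034965, 3770704, 180688, 926507]], [[9363366, -5800068, 12953445,
     1330573, -295384, 7269778]]]),
    (15, [[], [[1102099]], [[117461, 1768931]], [[-194425, 1532969, 918086]], [[-1698249, -678282,
     2327852, 3740766]], [[-9566568, 2188155, 9265518, 9190752, 6077226]]]),
    (13, [[], [[1370676]], [[1379168, 838308]], [[1961819, 646065, 429922]], [[-1839220, 1479824,
     -1899897, 722783]], [[-561040, 10883502, -2013764, 1027893, 8675658]]]),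
    (8, [[], [[6924004]], [[11162350, 894891]], [[6702623, 70053, 295243]], [[16383865, 1607518,
     238015, 2952011]]]),
    (6, [[], [[214595]], [[1117725, 5776685]], [[176106, 253496, 288184]], [[-2474922, -15339763,
     -279025, 7499525]]]),
    (2, [[], [[1263404]], [[1206834, 12639084]], [[-3249322, 934504, 4735606]]]),
    (2, [[], [[2288958]], [[1761579, 9220597]], [[-6052676, -201941, 2963636]]]),
    (5, [[], [[9193752]], [[-3920236, 937472]]]),
    (2, [[], [[1035950]], [[-4119069, 14056736]]])],
   [(19, [[], [[199077], [186930, 465728]], [[272146, 126334, 355334], [14968, 373490, -110730,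
     197107]], [[226295, 154179, 327662, 176457, 210655], [-244238, 49385, -30854, 145050, 44019,
     111161]], [[-227745, -482094, -105619, 235293, 394944, -210831, 80872], [-362416, -223353,
     665297, -284465, 118471, 517744, -45065, 73422]], [[-1146898, -2733289, 155177, -2457916,
     102411, -693654, -75087, 130840, 1688423], [-757393, -132205, 2322428, 149838, 1263594,
     2727057, 96101, -37124, 252957, 1363213]], [[], [101176, -485629, 6283234, -1166058, 5475004,
     8858805, 385875, 672982, 481954, 1679644, 3953394]]]),
    (15, [[], [[1016021], [41712, 1091368]], [[1001793, -335364, 1163029], [11762, 562551, 836755,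
     700476]], [[943183, -594773, 1313663, 174904, 478389], [89843, 163566, 644527, 1421481,
     419784, 315083]], [[1238653, -1043849, -2631510, 1996185, 2696698, 1188054, 503210], [258883,
     -426742, -1164668, 3079005, 1543722, 1036779, 216351, 70462]], [[-4554575, 4990014, -5640570,
     6851418, 2252707, 2661253, 539630, -133283, 6751691], [-432419, -186424, -6441013, 5545097,
     5266763, 2379963, 886514, 295041, 166170, 1854635]], [[], [238902, 4710317, -6571794,
     15828611, 11910176, 5605080, 1143475, 33395, 186891, 955268, 14070629]]]),
    (12, [[], [[1285981], [481000, 1495938]], [[644923, -1481529, 451857], [-331795, 240758,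
     418002, 142908]], [[-11874, -2251369, 733790, 87915, 271950], [-749781, -342997, 648179,
     69221, 270953, 96378]], [[1803085, 5387316, -1040469, -308413, -2468, 144678, 503530],
     [-1643085, -678331, 937923, 86191, 498772, 197830, 76184, 84637]], [[], [-2755636, -8851364,
     517712, 460207, 130123, 414469, 818382, 76191, 3931761]]]),
    (11, [[], [[877241], [592229, 234254]], [[823505, -136062, 80864], [862342, 326219, -7141,
     61210]], [[669526, 232720, 697, -5926, 56110], [743277, 199736, -7236, 21891, 3759, 29141]],
     [[9705862, 1527377, -59893, 109854, 86081, 132370, 370458], [230848, 402915, 17771, -2807,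
     32785, -2367, 4598, 57032]], [[], [11148776, -228607, 224553, 413255, 312640, 17776, 185506,
     147635, 3905427]]]),
    (7, [[], [[423587], [-7898636, 2400632]], [[-1820663, 446646, 426453], [-135936, 185962,
     -6779, 302843]], [[-7371167, 2228742, 7711, 109559, 368707], [3722871, -1247798, 57837,
     -87481, -14388, 209676]], [[], [-12831782, 4256984, -103721, 80238, -118726, -355097,
     426118]]]),
    (6, [[], [[3760135], [-5052018, 713239]], [[-2192956, 210249, 411652], [552860, 4901, 20890,
     279961]], [[-8641162, 2321319, 53900, 223519, 719751], [-7049487, 945833, 42178, 2143,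
     139653, 187808]], [[], [-6973485, 2780256, 53670, 40389, 325372, 335669, 680548]]]),
    (6, [[], [[3305792], [12810497, 306351]], [[2790648, 57744, 333233], [1926853, 98619, 1510,
     198282]], [[], [3336090, 52375, -3277, -2424, 98903]]]),
    (1, [[], [[6116992]], [[8331933, 13668055], [4114462, 635683, 7439960]], [[], [15278430,
     1180364, 2538515, 5967698]]]),
    (6, [[], [[8769267]], [[], [8658690, 429465]]])],
   [(18, [[], [[346016], [-119085, 244307]], [[229214, 522087, 813710], [-266840, 209742, -50985,
     196282]], [[-23, 690439, 1005895, 255398, 336466], [-19607, 62093, 37733, 10802, -66274,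
     180311]], [[-798526, -2787287, 609536, 2343, 1086172, -1928724, 95299], [593512, 181935,
     135613, -351988, -157896, 746825, 20010, 23321]], [[-3148066, -11636706, 602499, -401051,
     3489015, -7659548, -36543, 41532, 2228007], [2041298, 621326, 99704, -1725405, -713357,
     2934626, 242147, -233446, 16009, 1330963]], [[], [8685031, -1124174, 416067, -7169043,
     -142355, 7181398, -50916, 150772, 120627, 821086, 6965548]]]),
    (13, [[], [[3610686], [-1277080, 1690229]], [[3924172, -4244137, 2770676], [-877416, -347664,
     1192165, 393263]], [[4045480, -7255219, 4908357, 124862, 616438], [-200502, -1741566,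
     1870268, 471126, 32437, 380652]], [[8304841, 15838977, -8511821, -2165377, 817190, 1255739,
     4356769], [983909, -2927654, 2579041, 469670, 232470, 799346, 367050, 207602]], [[],
     [4515030, -15029846, 12333161, 1380738, 1108570, 3292146, 504002, 501013, 6216820]]]),
    (11, [[], [[1841294], [-789993, 523024]], [[1841098, -32977, 246515], [-502055, 409727, 75893,
     154287]], [[1127934, 77500, 111322, -76765, 416884], [-676559, 372093, 87617, 122275, 114835,
     202593]], [[-833149, 1176511, 514117, 84545, 805896, 496307, 1662699], [-1159485, 369632,
     186006, 127714, 318542, 311680, 10826, 110855]], [[], [-15369589, 2400227, 979945, 1025883,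
     481017, 1672471, -150705, 2202, 9197749]]]),
    (4, [[], [[3668510], [3105214, 2235519]], [[4864379, 742903, 7455134], [3858518, 1314947,
     898810, 3580254]], [[2630924, 790186, -1338224, 316157, 9457130], [3240116, 489445, 262461,
     -128670, 209981, 1696881]], [[], [2621727, -1394605, 959483, 1578596, -1645976, 1164216,
     5542169]]]),
    (3, [[], [[1184217], [553449, 1061858]], [[-334069, 1484471, 6003158], [586250, 120485,
     181006, 2628796]], [[3827651, 2281367, 897803, 1711623, 13700986], [575213, 194338, 85296,
     49047, -93536, 1085693]], [[], [2830796, -1442287, -478988, -255578, 606649, -1567592,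
     7537606]]]),
    (1, [[], [[2452770], [-285935, 2337173]], [[-241906, 2128157, 16304864], [-387462, -394439,
     151514, 5873813]], [[], [-209283, 594448, -489473, -80863, 2383779]]]),
    (2, [[], [[1045854], [-345457, 1447961]], [[1017516, 883793, 8622158], [-192518, 24, -2756,
     2341817]], [[], [-578347, -45833, 113748, 18060, 1632928]]]),
    (0, [[], [[5335433]], [[], [212503, 12642089]]]),
    (2, [[], [[3391020]], [[], [1774696, 8907231]]])],
   [(16, [[], [[1476624], [-144709, 162745], [-735198, -848166, 2500031]], [[1701146, 132662,
     391808, 845438], [-202578, 41782, 35574, -134055, 276314], [-750404, -598260, -65953,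
     -367075, -510217, 953129]], [[1239749, -115637, 2706787, 1020308, 1055485, 132803, 852150],
     [117095, -10647, 571041, 352735, 226886, -478366, -27881, 227202], [-1171635, -531073,
     -2033729, -958294, -598410, 1322014, 33546, -604694, 27584]], [[11385625, 2823472, 3165575,
     14444781, -8311414, -8791986, -3605308, 3603966, 2668365, 2165229], [1060401, 93125, 1773764,
     1801672, -339447, -1493080, -52362, 849233, 52911, 98856, 131443], [-1888154, -631977,
     -3337699, -1838166, -311559, 1739616, 330473, -1168306, -139495, -107175, -113079, 44648]],
     [[], [4335635, 51756, 8724402, 7272560, -2463651, -6023675, -749043, 3908673, 489983, 444515,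
     299284, -383840, 3355715], [-2817979, -634707, -4272801, -2819319, -209282, 1829916, 924789,
     -1841211, -445135, -406986, -210277, -63973, -26582, 1095195]], [[], [], [-900845, 306758,
     -4168566, 813824, -4963815, -3023475, 856319, -1309709, -703214, -430582, -155980, 43737,
     -75206, -91252, 4970243]]]),
    (14, [[], [[572962], [-45309, 119290], [-1397183, 302750, 1048900]], [[336899, 13494, 306274,
     240114], [108301, 77464, -96760, 22950, 83820], [-961778, 214265, 676943, 10514, 91452,
     117908]], [[177294, 49501, 334790, 49460, 91380, -141037, 257594], [167182, 51981, -130309,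
     68976, 126327, -2613, 33392, 50300], [-872859, 174320, 688364, 47508, 155929, 93738, -42110,
     39805, 94127]], [[12374496, -1894699, -12865917, -690483, 471763, 1040451, -830989, 573242,
     -1102242, 2947471], [-17625, 69702, 9308, 105955, 179897, -67013, 133623, 88264, 1290, -4899,
     56513], [-674475, 116008, 553535, 124806, 223175, 134741, -61878, 102671, 138093, 1117,
     22744, 51843]], [[], [-3747298, 606209, 3435054, 512505, 100309, -1134, 255387, 291913,
     337242, -374299, 68297, 127873, 3511737], [-432058, 107541, 543717, 237323, 474718, 161843,
     13580, 274705, 244502, -37718, 74599, 51069, -2863, 734538]], [[], [], [-1133465, 1271416,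
     1728991, 585194, 1012185, 129264, 235200, 668651, 451864, -160663, 8435, 5620, -1456, -4722,
     5330087]]]),
    (8, [[], [[1278021], [942969, 778655], [709153, 1360980, 763907]], [[1111648, -654357,
     -131008, 1666437], [827175, 288648, -57803, 156339, 596341], [513404, 1217999, 109605,
     -15952, 353486, 1195523]], [[1176206, -666239, -110915, -52382, 584758, 72915, 2283440],
     [794472, 29527, -170895, 176443, 507369, 74188, 264928, 625591], [567778, 616449, 179683,
     146588, 495048, 139745, 195840, 527229, 395372]], [[], [487273, -518185, -64663, 427706,
     962759, -78764, 370258, 1279464, 15798, 772300], [336748, 172380, 13876, 207859, 868671,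
     255998, 303338, 1063867, 256285, 31283, 545844]], [[], [], [-1395627, -1672454, -278595,
     513539, 2095681, 563237, 805155, 1755829, 231839, -97889, -34276, 14186076]]]),
    (7, [[], [[307135], [262061, 138269], [214245, 359413, 594391]], [[286810, 153436, -60408,
     1078188], [308595, 93053, 11533, 15171, 252361], [298614, 180224, 25713, -8228, 1301,
     730122]], [[293865, 100662, 243213, 89778, 366124, -161321, 2279173], [268274, 38798, -53761,
     7164, 15272, -4529, -1272, 133866], [242555, 115368, -38679, -3633, 8161, -474, -13673,
     57894, 132206]], [[], [195888, -178608, 95636, -25217, 84337, 18425, 786, -97091, 297561,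
     880959], [229961, 106126, 7391, 34150, 120739, 7566, 28330, 95025, -34501, -10464, 359047]],
     [[], [], [-785693, -192012, 143184, 57939, 449104, 173051, -99475, -205512, -77742, 31092,
     74034, 15479947]]]),
    (3, [[], [[930724], [257472, 553568], [-1487164, -1886492, 5923024]], [[-87840, 837748,
     -149304, 9290382], [80064, 91136, 152449, -1506, 1626610], [26728, -101825, -163527, -136242,
     -180751, 5528007]], [[], [172566, 247565, -19483, -40933, 57049, 68514, 867038], [98310,
     380120, -131033, -45957, 83386, 25984, 101651, 910365]], [[], [], [233830, 759833, 261764,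
     16792, -272040, -322652, -863745, -259256, 3236615]]]),
    (3, [[], [[682608], [-105555, 310004]], [[261351, 387452, 8611316], [-75982, -99318, -5205,
     1049643], [48328, -194558, -49531, -70859, 3942028]], [[], [-389260, 166376, 22383, -60337,
     29264, 908547], [240137, -195864, -7830, -26122, 1882, -224572, 661116]], [[], [], [188787,
     513103, 13925, -232868, -93431, 185543, 269897, 2905663]]]),
    (2, [[], [[1326176], [-445450, 992280]], [[], [1618, -183141, 2108006], [-646423, 452578,
     -117353, 9398368]], [[], [], [277842, -647474, -74446, -25062, 1364724]]]),
    (0, [[], [[8154783]], [[], [1578993, 16062501]], [[], [], [-1738582, 882449, 8733190]]])]]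

/-- The row of the first block of `baseBlocks` attached to the constant function. -/
noncomputable def constRow : List ℤ :=
  [-2610825628, -3657837763, -2702795843, -239476726, 2999111, 4304796, 23094136]

/-- Entries of the `m`-th group of `baseBlocks`. -/
noncomputable def baseEntries (m h j h' j' : ℕ) : List ℤ :=
  forceList ((nth [] baseBlocks m).map fun B => B.entry h j h' j') fun l => l

noncomputable def baseTerm (m h j h' j' n11 n10 n01 n00 : ℕ) : ℤ :=
  forceInt (dot (baseEntries m h j h' j') (kernelList 10 n11 n10 n01 n00)) fun z => z

/-- Sizes of the intersections of an index set with the four classes, up to total size `4`. -/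
def classSizes : List (ℕ × ℕ × ℕ × ℕ) :=
  [(0, 0, 0, 0), (0, 0, 0, 1), (0, 0, 0, 2), (0, 0, 0, 3), (0, 0, 0, 4), (0, 0, 2, 0),
   (0, 0, 2, 1), (0, 0, 2, 2), (0, 0, 4, 0), (0, 2, 0, 0), (0, 2, 0, 1), (0, 2, 0, 2),
   (0, 2, 2, 0), (0, 4, 0, 0), (1, 1, 1, 0), (1, 1, 1, 1), (2, 0, 0, 0), (2, 0, 0, 1),
   (2, 0, 0, 2), (2, 0, 2, 0), (2, 2, 0, 0), (4, 0, 0, 0)]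

noncomputable def baseSummand (n0 n1 n2 n3 h h' : ℕ) (K0 K1 K2 K3 : List ℤ)
    (t : ℕ × ℕ × ℕ × ℕ) : ℤ :=
  zmul (nth 0 K0 t.1) (zmul (nth 0 K1 t.2.1) (zmul (nth 0 K2 t.2.2.1) (zmul (nth 0 K3 t.2.2.2)
    (forceNat (Nat.add (Nat.add (Nat.add t.1 t.2.1) t.2.2.1) t.2.2.2) fun m =>
     forceNat (Nat.div (Nat.add t.1 t.2.1) 2) fun j =>
     forceNat (Nat.div (Nat.add t.1 t.2.2.1) 2) fun j' =>
     forceNat (Nat.sub n0 t.1) fun m0 =>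
     forceNat (Nat.sub n1 t.2.1) fun m1 =>
     forceNat (Nat.sub n2 t.2.2.1) fun m2 =>
     forceNat (Nat.sub n3 t.2.2.2) fun m3 => baseTerm m h j h' j' m0 m1 m2 m3))))

noncomputable def sumList {α : Type} (f : α → ℤ) (l : List α) : ℤ :=
  List.rec 0 (fun a _ s => iadd (f a) s) l

/-- The base kernel as a function of the eight cell sizes. -/
noncomputable def baseKernel (c0 c1 c2 c3 c4 c5 c6 c7 : ℕ) : ℤ :=
  forceNat (Nat.add c5 c6) fun n0 => forceNat (Nat.add c4 c7) fun n1 =>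
  forceNat (Nat.add c1 c2) fun n2 => forceNat (Nat.add c0 c3) fun n3 =>
  forceNat (Nat.sub (Nat.div (Nat.add n0 n1) 2) 3) fun h =>
  forceNat (Nat.sub (Nat.div (Nat.add n0 n2) 2) 3) fun h' =>
  sumList (baseSummand n0 n1 n2 n3 h h' (krawtchoukList c5 c6) (krawtchoukList c4 c7)
    (krawtchoukList c1 c2) (krawtchoukList c0 c3)) classSizes

/-- The sign of `i - 2 * p`. -/
noncomputable def halfSign (i p : ℕ) : ℤ :=
  Bool.rec (Bool.rec (-1) 0 (Nat.ble (Nat.mul 2 p) i)) 1 (Nat.ble (Nat.succ (Nat.mul 2 p)) i)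

/-- The smaller one of `p` and `i - p`. -/
noncomputable def halfFold (i p : ℕ) : ℕ := Bool.rec (Nat.sub i p) p (Nat.ble (Nat.mul 2 p) i)

noncomputable def pairEntries (t k p a p' a' : ℕ) (s : ℤ) : List ℤ :=
  forceList ((nth [] (nth [] pairBlocks t) k).map fun B =>
    iadd (B.1.entry p a p' a') (imul s (B.2.entry p a p' a'))) fun l => l

/-- The pair kernel as a function of the eight cell sizes. -/
noncomputable def pairKernel (c0 c1 c2 c3 c4 c5 c6 c7 : ℕ) : ℤ :=
  forceNat (Nat.add (Nat.add c4 c5) (Nat.add c6 c7)) fun i =>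
  forceNat (Nat.sub (Nat.div i 2) 3) fun t =>
  forceInt (imul (halfSign i (Nat.add c6 c7)) (halfSign i (Nat.add c5 c7))) fun s =>
  forceNat (halfFold i (Nat.add c6 c7)) fun p => forceNat (halfFold i (Nat.add c5 c7)) fun p' =>
  forceNat (Nat.sub (Nat.div (Nat.add p (Nat.add c2 c3)) 2) 3) fun a =>
  forceNat (Nat.sub (Nat.div (Nat.add p' (Nat.add c1 c3)) 2) 3) fun a' =>
  sumList (fun k => zmul (nth 0 (kernelList 3 c7 c6 c5 c4) k)
    (dot (pairEntries t k p a p' a' s) (kernelList 3 c3 c2 c1 c0))) [0, 1, 2]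

/-- The symmetrized kernel as a function of the eight cell sizes. -/
noncomputable def totalKernel (c0 c1 c2 c3 c4 c5 c6 c7 : ℕ) : ℤ :=
  iadd (iadd (iadd (pairKernel c0 c1 c2 c3 c4 c5 c6 c7) (pairKernel c0 c1 c4 c5 c2 c3 c6 c7))
    (iadd (pairKernel c0 c2 c4 c6 c1 c3 c5 c7) (pairKernel c0 c1 c7 c6 c2 c3 c5 c4)))
  (iadd (iadd (pairKernel c0 c2 c7 c5 c1 c3 c6 c4) (pairKernel c0 c4 c7 c3 c1 c5 c6 c2))
   (iadd (baseKernel c0 c1 c2 c3 c4 c5 c6 c7)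
    (iadd (baseKernel c0 c1 c4 c5 c2 c3 c6 c7) (baseKernel c0 c2 c4 c6 c1 c3 c5 c7))))

noncomputable def allB {α : Type} (f : α → Bool) (l : List α) : Bool :=
  List.rec true (fun a _ s => Bool.rec false s (f a)) l

noncomputable def impB (c x : Bool) : Bool := Bool.rec true x c

noncomputable def nonposB (z : ℤ) : Bool := Int.rec (fun n => Nat.ble n 0) (fun _ => true) z

/-- The distances that occur. -/
def dists : List ℕ := [8, 10, 12, 14, 16, 18]

/-- The triangle inequalities and the bound on the perimeter for distances in the cube. -/
noncomputable def triB (a b c : ℕ) : Bool :=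
  Bool.rec false (Bool.rec false (Bool.rec false (Nat.ble (Nat.add a (Nat.add b c)) 38)
    (Nat.ble c (Nat.add a b))) (Nat.ble b (Nat.add a c))) (Nat.ble a (Nat.add b c))

/-- Nonpositivity of the total kernel, given the distances and the cell `c7`. -/
noncomputable def quadCheck (d01 d02 d12 d03 d13 d23 : ℕ) : Bool :=
  forceNat (Nat.div (Nat.sub (Nat.add d01 d02) d12) 2) fun u =>
  forceNat (Nat.div (Nat.sub (Nat.add d01 d03) d13) 2) fun v =>
  forceNat (Nat.div (Nat.sub (Nat.add d02 d03) d23) 2) fun w =>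
  allB (fun t => impB (Nat.ble t u) (impB (Nat.ble t v) (impB (Nat.ble t w)
    (impB (Nat.ble (Nat.add u v) (Nat.add d01 t)) (impB (Nat.ble (Nat.add u w) (Nat.add d02 t))
    (impB (Nat.ble (Nat.add v w) (Nat.add d03 t))
    (impB (Nat.ble (Nat.add (Nat.add d01 d02) (Nat.add d03 t))
      (Nat.add 19 (Nat.add u (Nat.add v w))))
    (forceNat (Nat.sub (Nat.add 19 (Nat.add u (Nat.add v w)))
      (Nat.add (Nat.add d01 d02) (Nat.add d03 t)))
      fun c0 => forceNat (Nat.sub (Nat.add d03 t) (Nat.add v w)) fun c1 =>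
      forceNat (Nat.sub (Nat.add d02 t) (Nat.add u w)) fun c2 =>
      forceNat (Nat.sub w t) fun c3 =>
      forceNat (Nat.sub (Nat.add d01 t) (Nat.add u v)) fun c4 =>
      forceNat (Nat.sub v t) fun c5 => forceNat (Nat.sub u t) fun c6 => forceNat t fun c7 =>
      nonposB (totalKernel c0 c1 c2 c3 c4 c5 c6 c7)))))))))
    [0, 1, 2, 3, 4, 5, 6, 7, 8, 9, 10, 11, 12, 13, 14, 15, 16, 17, 18, 19]

/-- `(a, c) ≤ (b, d)` lexicographically, except that nothing is required of `c, d` if `a < b`. -/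
noncomputable def lexB (a b c d : ℕ) : Bool :=
  Bool.rec (Bool.rec false (Nat.ble c d) (Nat.ble a b)) true (Nat.ble (Nat.succ a) b)

noncomputable def quadCheckAll : Bool :=
  allB (fun d01 => allB (fun d02 => impB (Nat.ble d01 d02)
  (allB (fun d12 => impB (Nat.ble d02 d12) (impB (triB d01 d02 d12)
  (allB (fun d03 => allB (fun d13 => impB (lexB d02 d12 d03 d13) (impB (lexB d02 d03 d12 d13)
    (impB (triB d01 d03 d13)
  (allB (fun d23 => impB (lexB d01 d02 d13 d23) (impB (triB d02 d03 d23) (impB (triB d12 d13 d23)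
    (quadCheck d01 d02 d12 d03 d13 d23)))) dists)))) dists) dists))) dists)) dists) dists

/-- The total kernel at `(x, x, y, z)` in terms of the distances of `x, y`, of `x, z` and
of `y, z`. -/
noncomputable def tripleKernel (a b c : ℕ) : ℤ :=
  forceNat (Nat.div (Nat.sub (Nat.add a b) c) 2) fun u =>
  forceNat (Nat.sub (Nat.add 19 u) (Nat.add a b)) fun c0 => forceNat (Nat.sub b u) fun c1 =>
  forceNat (Nat.sub a u) fun c2 => totalKernel c0 c1 c2 u 0 0 0 0

noncomputable def tripleCheckAll : Bool :=
  allB (fun a => allB (fun b => impB (Nat.ble a b) (allB (fun c => impB (Nat.ble b c)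
    (impB (triB a b c) (nonposB (iadd (tripleKernel a b c)
      (iadd (tripleKernel a c b) (tripleKernel b c a)))))) dists)) dists) dists

/-- The linear term attached to a pair of words at distance `d`. -/
noncomputable def linearTerm (d : ℕ) : ℤ :=
  imul (Int.ofNat (Nat.pow 4 19))
    (dot constRow (Block.row (nth (0, []) (nth [] baseBlocks 0) 0) (Nat.sub (Nat.div d 2) 3) 0))

noncomputable def pairCheck (d : ℕ) : Bool :=
  forceNat (Nat.sub 19 d) fun e =>
  nonposB (iadd (iadd (imul 4 (totalKernel e d 0 0 0 0 0 0)) (imul 3 (totalKernel e 0 0 d 0 0 0 0)))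
    (iadd (imul 6 (linearTerm d)) (Int.ofNat (Nat.pow 4 45))))

noncomputable def constCheck : Bool :=
  nonposB (iadd (Int.ofNat 1) (iadd
    (imul 3 (imul (Int.ofNat (Nat.pow 4 19)) (dot constRow constRow)))
    (imul (-18360) (Int.ofNat (Nat.pow 4 45)))))

/-! ### Meaning of the arithmetic -/

@[simp] theorem forceNat_eq {α : Type} (n : ℕ) (f : ℕ → α) : forceNat n f = f n := by
  cases n <;> rfl

@[simp] theorem forceInt_eq {α : Type} (z : ℤ) (f : ℤ → α) : forceInt z f = f z := by
  cases z <;> simp [forceInt]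

@[simp] theorem forceList_eq {α : Type} (u : List ℤ) (f : List ℤ → α) :
    forceList u f = f u := by
  induction u generalizing f with
  | nil => rfl
  | cons a u ih =>
    change forceInt a (fun a => forceList u fun l => f (a :: l)) = _
    simp [ih]

theorem negSucc_or_zero (n : ℕ) :
    (Nat.rec (Int.ofNat 0) (fun k _ => Int.negSucc k) n : ℤ) = -(n : ℤ) := by
  cases n with
  | zero => rfl
  | succ k => exact Int.negSucc_eq k

@[simp] theorem imul_eq (a b : ℤ) : imul a b = a * b := by
  rcases a with m | m <;> rcases b with n | n
  · rfl
  · change (Nat.rec (Int.ofNat 0) (fun k _ => Int.negSucc k) (m * (n + 1)) : ℤ) = _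
    rw [negSucc_or_zero, Int.negSucc_eq]
    push_cast
    simp only [Int.ofNat_eq_natCast]
    ring
  · change (Nat.rec (Int.ofNat 0) (fun k _ => Int.negSucc k) ((m + 1) * n) : ℤ) = _
    rw [negSucc_or_zero, Int.negSucc_eq]
    push_cast
    simp only [Int.ofNat_eq_natCast]
    ring
  · rfl

theorem isub_eq (m n : ℕ) : isub m n = (m : ℤ) - n := by
  unfold isub
  rcases h : Nat.ble n m with _ | _
  · have h' : ¬ n ≤ m := fun hh => by simp [Nat.ble_eq.mpr hh] at h
    change Int.negSucc (n - m - 1) = _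
    omega
  · have h' : n ≤ m := Nat.ble_eq.mp h
    change Int.ofNat (m - n) = _
    simp
    omega

@[simp] theorem iadd_eq (a b : ℤ) : iadd a b = a + b := by
  rcases a with m | m <;> rcases b with n | n
  · rfl
  · change isub m (n + 1) = _
    rw [isub_eq, Int.negSucc_eq]
    push_cast
    simp
    ring
  · change isub n (m + 1) = _
    rw [isub_eq, Int.negSucc_eq]
    push_cast
    simp
    ring
  · rfl

@[simp] theorem zmul_eq (a b : ℤ) : zmul a b = a * b := by
  rcases a with (_ | m) | m
  · change (0 : ℤ) = 0 * b
    simp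
  · exact imul_eq (Int.ofNat (m + 1)) b
  · exact imul_eq (Int.negSucc m) b

theorem nth_eq {α : Type} (d : α) (l : List α) (n : ℕ) : nth d l n = l.getD n d := by
  induction l generalizing n with
  | nil => rfl
  | cons a l ih =>
    cases n with
    | zero => rfl
    | succ n =>
      change nth d l n = _
      simp [ih]

theorem dot_eq (u v : List ℤ) {N : ℕ} (hN : u.length ≤ N) :
    dot u v = ∑ i ∈ Finset.range N, u.getD i 0 * v.getD i 0 := by
  induction u generalizing v N with
  | nil => simp [dot]
  | cons a u ih =>
    obtain ⟨N, rfl⟩ : ∃ M, N = M + 1 := ⟨N - 1, by simp at hN; omega⟩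
    cases v with
    | nil => simp [dot]
    | cons b v =>
      change iadd (imul a b) (dot u v) = _
      rw [Finset.sum_range_succ', ih v (N := N) (by simpa using hN)]
      simp [add_comm]

theorem dot_comm (u v : List ℤ) : dot u v = dot v u := by
  rw [dot_eq u v (le_max_left _ v.length), dot_eq v u (le_max_right u.length _)]
  exact Finset.sum_congr rfl fun _ _ => mul_comm _ _

@[simp] theorem sumList_eq {α : Type} (f : α → ℤ) (l : List α) :
    sumList f l = (l.map f).sum := by
  induction l with
  | nil => rfl
  | cons a l ih =>
    change iadd (f a) (sumList f l) = _
    simp [ih]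

theorem allB_eq {α : Type} (f : α → Bool) (l : List α) :
    allB f l = true ↔ ∀ a ∈ l, f a = true := by
  induction l with
  | nil => simp [allB]
  | cons a l ih =>
    change (Bool.rec false (allB f l) (f a) : Bool) = true ↔ _
    cases h : f a <;> simp [h, ih]

theorem impB_eq (c x : Bool) : impB c x = true ↔ (c = true → x = true) := by
  cases c <;> simp [impB]

theorem nonposB_eq (z : ℤ) : nonposB z = true ↔ z ≤ 0 := by
  rcases z with n | n
  · change Nat.ble n 0 = true ↔ (n : ℤ) ≤ 0
    rw [Nat.ble_eq]
    omega
  · simpa [nonposB] using (Int.negSucc_lt_zero n).le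

theorem halfSign_eq (i p : ℕ) : halfSign i p = ((i : ℤ) - 2 * p).sign := by
  unfold halfSign
  rcases h : Nat.ble (Nat.succ (Nat.mul 2 p)) i with _ | _
  · have h1 : ¬ 2 * p + 1 ≤ i := fun hh => by
      have := Nat.ble_eq.mpr hh
      simp_all
    rcases h' : Nat.ble (Nat.mul 2 p) i with _ | _
    · have h2 : ¬ 2 * p ≤ i := fun hh => by
        have := Nat.ble_eq.mpr hh
        simp_all
      exact (Int.sign_eq_neg_one_of_neg (by omega)).symm
    · have h2 : 2 * p ≤ i := Nat.ble_eq.mp h'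
      have : (i : ℤ) - 2 * p = 0 := by omega
      simp [this]
  · have h1 : 2 * p + 1 ≤ i := Nat.ble_eq.mp h
    exact (Int.sign_eq_one_of_pos (by omega)).symm

theorem halfFold_eq (i p : ℕ) (hp : p ≤ i) : halfFold i p = min p (i - p) := by
  unfold halfFold
  rcases h : Nat.ble (Nat.mul 2 p) i with _ | _
  · have h2 : ¬ 2 * p ≤ i := fun hh => by
      have := Nat.ble_eq.mpr hh
      simp_all
    change i - p = _
    omega
  · have h2 : 2 * p ≤ i := Nat.ble_eq.mp h
    change p = _
    omega

/-! ### Nonnegative combinations of rank one kernels -/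

/-- `K` is a nonnegative rational combination of rank one kernels. -/
def IsGram {α : Type} (K : α → α → ℤ) : Prop :=
  ∃ (ι : Type) (s : Finset ι) (a : ι → ℚ) (u : ι → α → ℚ), (∀ t, 0 ≤ a t) ∧
    ∀ x y, (K x y : ℚ) = ∑ t ∈ s, a t * (u t x * u t y)

namespace IsGram

variable {α β : Type} {K L : α → α → ℤ}

theorem congr (hK : IsGram K) (h : ∀ x y, L x y = K x y) : IsGram L := by
  obtain ⟨ι, s, a, u, ha, hu⟩ := hK
  exact ⟨ι, s, a, u, ha, fun x y => by rw [h, hu]⟩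

theorem rankOne (f : α → ℤ) : IsGram fun x y => f x * f y :=
  ⟨Unit, Finset.univ, fun _ => 1, fun _ x => f x, fun _ => zero_le_one, fun x y => by simp⟩

theorem one : IsGram fun (_ _ : α) => 1 := (rankOne fun _ => 1).congr fun _ _ => by simp

theorem zero : IsGram fun (_ _ : α) => 0 := (rankOne fun _ => 0).congr fun _ _ => by simp

theorem add (hK : IsGram K) (hL : IsGram L) : IsGram fun x y => K x y + L x y := by
  obtain ⟨ι, s, a, u, ha, hu⟩ := hK
  obtain ⟨κ, t, b, v, hb, hv⟩ := hL
  refine ⟨ι ⊕ κ, s.disjSum t, Sum.elim a b, Sum.elim u v, ?_, fun x y => ?_⟩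
  · rintro (i | i)
    · exact ha i
    · exact hb i
  · simp [hu, hv]

theorem mul (hK : IsGram K) (hL : IsGram L) : IsGram fun x y => K x y * L x y := by
  obtain ⟨ι, s, a, u, ha, hu⟩ := hK
  obtain ⟨κ, t, b, v, hb, hv⟩ := hL
  refine ⟨ι × κ, s ×ˢ t, fun p => a p.1 * b p.2, fun p x => u p.1 x * v p.2 x,
    fun p => mul_nonneg (ha _) (hb _), fun x y => ?_⟩
  push_cast
  rw [hu, hv, Finset.sum_mul_sum, Finset.sum_product]
  exact Finset.sum_congr rfl fun _ _ => Finset.sum_congr rfl fun _ _ => by ring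

theorem natCast_mul (hK : IsGram K) (c : ℕ) : IsGram fun x y => (c : ℤ) * K x y := by
  obtain ⟨ι, s, a, u, ha, hu⟩ := hK
  refine ⟨ι, s, fun t => c * a t, u, fun t => mul_nonneg c.cast_nonneg (ha t), fun x y => ?_⟩
  push_cast
  rw [hu, Finset.mul_sum]
  exact Finset.sum_congr rfl fun _ _ => by ring

theorem of_natCast_mul {c : ℕ} (hc : 0 < c) (hK : IsGram fun x y => (c : ℤ) * K x y) :
    IsGram K := by
  obtain ⟨ι, s, a, u, ha, hu⟩ := hK
  have hc' : (0 : ℚ) < c := by exact_mod_cast hc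
  refine ⟨ι, s, fun t => (c : ℚ)⁻¹ * a t, u, fun t => mul_nonneg (by positivity) (ha t),
    fun x y => ?_⟩
  have h := hu x y
  push_cast at h
  rw [← mul_right_inj' hc'.ne', h, Finset.mul_sum]
  refine Finset.sum_congr rfl fun _ _ => ?_
  field_simp

theorem sum {κ : Type} (t : Finset κ) {M : κ → α → α → ℤ} (h : ∀ k ∈ t, IsGram (M k)) :
    IsGram fun x y => ∑ k ∈ t, M k x y := by
  classical
  induction t using Finset.induction_on with
  | empty => simpa using zero
  | insert k t hk ih =>
    refine ((h k (by simp)).add (ih fun j hj => h j (by simp [hj]))).congr fun x y => ?_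
    rw [Finset.sum_insert hk]

theorem comp (hK : IsGram K) (f : β → α) : IsGram fun x y => K (f x) (f y) := by
  obtain ⟨ι, s, a, u, ha, hu⟩ := hK
  exact ⟨ι, s, a, fun t x => u t (f x), ha, fun x y => hu _ _⟩

theorem dot [Fintype α] (f : α → List ℤ) : IsGram fun x y => dot (f x) (f y) := by
  refine (sum (Finset.range (Finset.univ.sup fun x => (f x).length))
    (M := fun i x y => (f x).getD i 0 * (f y).getD i 0) fun i _ => rankOne _).congr fun x y => ?_
  exact dot_eq _ _ (Finset.le_sup (f := fun x => (f x).length) (Finset.mem_univ x))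

theorem sum_nonneg (hK : IsGram K) (C : Finset α) : 0 ≤ ∑ x ∈ C, ∑ y ∈ C, K x y := by
  obtain ⟨ι, s, a, u, ha, hu⟩ := hK
  have h : ((∑ x ∈ C, ∑ y ∈ C, K x y : ℤ) : ℚ) = ∑ t ∈ s, a t * (∑ x ∈ C, u t x) ^ 2 := by
    push_cast
    simp_rw [hu]
    rw [Finset.sum_congr rfl fun x _ => Finset.sum_comm, Finset.sum_comm]
    refine Finset.sum_congr rfl fun t _ => ?_
    rw [sq, Finset.sum_mul_sum, Finset.mul_sum]
    exact Finset.sum_congr rfl fun x _ => by rw [Finset.mul_sum]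
  have h' : (0 : ℚ) ≤ ∑ t ∈ s, a t * (∑ x ∈ C, u t x) ^ 2 :=
    Finset.sum_nonneg fun t _ => mul_nonneg (ha t) (sq_nonneg _)
  rw [← h] at h'
  exact_mod_cast h'

end IsGram

/-! ### Elementary kernels -/

/-- The sum over ordered `b`-tuples of disjoint pairs in `U` of the products of the differences
of `x` and of `y`. -/
def pairPhi {ι : Type} [DecidableEq ι] : ℕ → Finset ι → (ι → Bool) → (ι → Bool) → ℤ
  | 0, _, _, _ => 1
  | b + 1, U, x, y => ∑ p ∈ U, ∑ q ∈ U,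
    ((x p).toInt - (x q).toInt) * ((y p).toInt - (y q).toInt) *
      pairPhi b ((U.erase p).erase q) x y

theorem isGram_pairPhi {ι : Type} [DecidableEq ι] (b : ℕ) (U : Finset ι) :
    IsGram (pairPhi b U) := by
  induction b generalizing U with
  | zero => exact IsGram.one
  | succ b ih =>
    exact IsGram.sum U fun p _ => IsGram.sum U fun q _ =>
      (IsGram.rankOne fun x : ι → Bool => (x p).toInt - (x q).toInt).mul (ih _)

/-- The number `s! * x.choose s * y.choose s`. -/
def pairNum (s x y : ℕ) : ℕ := s.factorial * x.choose s * y.choose s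

/-- The value of the elementary kernel of order `b`. -/
def elemKernel (b n11 n10 n01 n00 : ℕ) : ℤ :=
  ∑ t ∈ Finset.HasAntidiagonal.antidiagonal b,
    (pairNum t.1 n11 n00 : ℤ) * ((-1) ^ t.2 * pairNum t.2 n10 n01)

theorem pairNum_comm (s x y : ℕ) : pairNum s x y = pairNum s y x := by
  unfold pairNum
  ring

theorem elemKernel_flip (b n11 n10 n01 n00 : ℕ) :
    elemKernel b n11 n10 n01 n00 = elemKernel b n00 n01 n10 n11 := by
  unfold elemKernel
  simp_rw [pairNum_comm _ n11, pairNum_comm _ n10]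

theorem elemKernel_swap (b n11 n10 n01 n00 : ℕ) :
    elemKernel b n11 n10 n01 n00 = elemKernel b n11 n01 n10 n00 := by
  unfold elemKernel
  simp_rw [pairNum_comm _ n10]

theorem succ_mul_pairNum (s x y : ℕ) :
    (s + 1) * pairNum (s + 1) x y = x * y * pairNum s (x - 1) (y - 1) := by
  unfold pairNum
  rcases x with _ | x
  · simp
  rcases y with _ | y
  · simp
  have hx := Nat.add_one_mul_choose_eq x s
  have hy := Nat.add_one_mul_choose_eq y s
  rw [Nat.factorial_succ]
  simp only [Nat.add_sub_cancel]
  calc _ = s.factorial * ((x + 1).choose (s + 1) * (s + 1)) *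
      ((y + 1).choose (s + 1) * (s + 1)) := by
        ring
    _ = _ := by rw [← hx, ← hy]; ring

theorem succ_mul_elemKernel (b n11 n10 n01 n00 : ℕ) :
    ((b : ℤ) + 1) * elemKernel (b + 1) n11 n10 n01 n00 =
      n11 * n00 * elemKernel b (n11 - 1) n10 n01 (n00 - 1) -
        n10 * n01 * elemKernel b n11 (n10 - 1) (n01 - 1) n00 := by
  have key : ((b : ℤ) + 1) * elemKernel (b + 1) n11 n10 n01 n00 =
      ∑ t ∈ Finset.HasAntidiagonal.antidiagonal (b + 1), (((t.1 * pairNum t.1 n11 n00 : ℕ) : ℤ) *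
        ((-1) ^ t.2 * pairNum t.2 n10 n01)) +
      ∑ t ∈ Finset.HasAntidiagonal.antidiagonal (b + 1), ((pairNum t.1 n11 n00 : ℤ) *
        ((-1) ^ t.2 * ((t.2 * pairNum t.2 n10 n01 : ℕ) : ℤ))) := by
    rw [elemKernel, Finset.mul_sum, ← Finset.sum_add_distrib]
    refine Finset.sum_congr rfl fun t ht => ?_
    have h : (t.1 : ℤ) + t.2 = b + 1 := by
      exact_mod_cast Finset.HasAntidiagonal.mem_antidiagonal.mp ht
    rw [← h]
    push_cast
    ring
  rw [key, Finset.Nat.sum_antidiagonal_succ, Finset.Nat.sum_antidiagonal_succ']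
  simp only [succ_mul_pairNum, zero_mul, Nat.cast_zero, mul_zero, zero_add]
  rw [elemKernel, elemKernel, Finset.mul_sum, Finset.mul_sum, sub_eq_add_neg,
    ← Finset.sum_neg_distrib]
  congr 1 <;> refine Finset.sum_congr rfl fun t _ => ?_ <;> push_cast <;> ring

/-- The number of coordinates in `U` where `x` is `s` and `y` is `t`. -/
def count₂ {ι : Type} (U : Finset ι) (x y : ι → Bool) (s t : Bool) : ℕ :=
  (U.filter fun r => x r = s ∧ y r = t).card

theorem sum_indicator {ι : Type} (U : Finset ι) (x y : ι → Bool) (s t : Bool) :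
    ∑ r ∈ U, (if x r = s ∧ y r = t then (1 : ℤ) else 0) = count₂ U x y s t := by
  rw [count₂, Finset.card_filter]
  push_cast
  rfl

section count₂

variable {ι : Type} [DecidableEq ι]

theorem count₂_erase {U : Finset ι} {p : ι} (hp : p ∈ U) (x y : ι → Bool) (s t : Bool) :
    count₂ (U.erase p) x y s t = count₂ U x y s t - if x p = s ∧ y p = t then 1 else 0 := by
  unfold count₂
  rw [Finset.filter_erase]
  split_ifs with h
  · rw [Finset.card_erase_of_mem (by simp [hp, h])]
  · rw [Finset.erase_eq_of_notMem (by simp [h]), Nat.sub_zero]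

theorem pairPhi_eq (b : ℕ) (U : Finset ι) (x y : ι → Bool) :
    pairPhi b U x y = 2 ^ b * b.factorial * elemKernel b (count₂ U x y true true)
      (count₂ U x y true false) (count₂ U x y false true) (count₂ U x y false false) := by
  induction b generalizing U with
  | zero => simp [pairPhi, elemKernel, pairNum]
  | succ b ih =>
    have key : ∀ p ∈ U, ∀ q ∈ U,
        ((x p).toInt - (x q).toInt) * ((y p).toInt - (y q).toInt) *
          pairPhi b ((U.erase p).erase q) x y =
        2 ^ b * b.factorial * (
        ((if x p = true ∧ y p = true then 1 else 0) * (if x q = false ∧ y q = false then 1 else 0) +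
          (if x p = false ∧ y p = false then 1 else 0) *
            (if x q = true ∧ y q = true then 1 else 0)) *
          elemKernel b (count₂ U x y true true - 1) (count₂ U x y true false)
            (count₂ U x y false true) (count₂ U x y false false - 1) -
        ((if x p = true ∧ y p = false then 1 else 0) * (if x q = false ∧ y q = true then 1 else 0) +
          (if x p = false ∧ y p = true then 1 else 0) *
            (if x q = true ∧ y q = false then 1 else 0)) *
          elemKernel b (count₂ U x y true true) (count₂ U x y true false - 1)
            (count₂ U x y false true - 1) (count₂ U x y false false)) := by
      intro p hp q hq
      by_cases hpq : q = p
      · subst hpq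
        cases x q <;> cases y q <;> simp
      · rw [ih, count₂_erase (Finset.mem_erase.mpr ⟨hpq, hq⟩),
          count₂_erase (Finset.mem_erase.mpr ⟨hpq, hq⟩),
          count₂_erase (Finset.mem_erase.mpr ⟨hpq, hq⟩),
          count₂_erase (Finset.mem_erase.mpr ⟨hpq, hq⟩), count₂_erase hp, count₂_erase hp,
          count₂_erase hp, count₂_erase hp]
        cases x p <;> cases y p <;> cases x q <;> cases y q <;> simp
    rw [pairPhi, Finset.sum_congr rfl fun p hp => Finset.sum_congr rfl (key p hp)]
    simp_rw [← Finset.mul_sum, Finset.sum_sub_distrib, ← Finset.sum_mul, Finset.sum_add_distrib,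
      ← Finset.mul_sum, ← Finset.sum_mul, sum_indicator]
    have h := succ_mul_elemKernel b (count₂ U x y true true) (count₂ U x y true false)
      (count₂ U x y false true) (count₂ U x y false false)
    rw [Nat.factorial_succ, pow_succ]
    push_cast
    linear_combination (-2 * 2 ^ b * (b.factorial : ℤ)) * h

/-- The elementary kernel is a nonnegative combination of rank one kernels. -/
theorem isGram_elemKernel (b : ℕ) (U : Finset ι) :
    IsGram fun x y : ι → Bool => elemKernel b (count₂ U x y true true) (count₂ U x y true false)
      (count₂ U x y false true) (count₂ U x y false false) := by
  refine IsGram.of_natCast_mul (c := 2 ^ b * b.factorial) (by positivity)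
    ((isGram_pairPhi b U).congr fun x y => ?_)
  rw [pairPhi_eq]
  push_cast
  ring

end count₂

/-! ### The computed values of the elementary kernels -/

theorem pairNum_step (s x y : ℕ) :
    pairNum s x y * ((x - s) * (y - s)) / (s + 1) = pairNum (s + 1) x y := by
  have hx := Nat.choose_succ_right_eq x s
  have hy := Nat.choose_succ_right_eq y s
  refine Nat.div_eq_of_eq_mul_left s.succ_pos ?_
  unfold pairNum
  rw [Nat.factorial_succ]
  calc _ = s.factorial * (x.choose s * (x - s)) * (y.choose s * (y - s)) := by ring
    _ = _ := by rw [← hx, ← hy]; ring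

theorem pairGo_eq (x y len s : ℕ) :
    pairGo x y len s (pairNum s x y) =
      (List.range' s len).map fun i => (pairNum i x y : ℤ) := by
  induction len generalizing s with
  | zero => rfl
  | succ len ih =>
    change Int.ofNat _ :: forceNat (pairNum s x y * ((x - s) * (y - s)) / (s + 1))
      (pairGo x y len (s + 1)) = _
    rw [forceNat_eq, pairNum_step, ih]
    rfl

theorem pairList_eq (len x y : ℕ) :
    pairList len x y = (List.range' 0 len).map fun i => (pairNum i x y : ℤ) := by
  unfold pairList
  rw [forceList_eq, ← pairGo_eq]
  simp [pairNum]

theorem altList_eq (f : ℕ → ℤ) (len s : ℕ) (b : Bool) (hb : (bif b then -1 else 1 : ℤ) = (-1) ^ s) :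
    altList ((List.range' s len).map f) b = (List.range' s len).map fun i => (-1) ^ i * f i := by
  induction len generalizing s b with
  | zero => rfl
  | succ len ih =>
    rw [List.range'_succ, List.map_cons, List.map_cons]
    change (Bool.rec (f s) (imul (Int.negSucc 0) (f s)) b : ℤ) ::
      altList ((List.range' (s + 1) len).map f) (Bool.rec true false b) = _
    rw [ih, ← hb]
    · cases b <;> simp
    · rw [pow_succ, ← hb]
      cases b <;> simp

theorem conv_eq (f : ℕ → ℤ) (B : List ℤ) (len s : ℕ) :
    conv ((List.range' s len).map f) B ((List.range s).reverse.map f) =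
      (List.range' s len).map fun i => dot ((List.range (i + 1)).reverse.map f) B := by
  induction len generalizing s with
  | zero => rfl
  | succ len ih =>
    have h : f s :: (List.range s).reverse.map f = (List.range (s + 1)).reverse.map f := by
      rw [List.range_succ]
      simp
    rw [List.range'_succ, List.map_cons, List.map_cons, ← ih, ← h]
    rfl

theorem dot_reverse (f g : ℕ → ℤ) {i len : ℕ} (hi : i < len) :
    dot ((List.range (i + 1)).reverse.map f) ((List.range' 0 len).map g) =
      ∑ t ∈ Finset.HasAntidiagonal.antidiagonal i, f t.1 * g t.2 := by
  rw [dot_eq (N := i + 1) _ _ (by simp), ← Finset.Nat.sum_antidiagonal_swap,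
    Finset.Nat.sum_antidiagonal_eq_sum_range_succ_mk]
  refine Finset.sum_congr rfl fun j hj => ?_
  have hj' : j < i + 1 := Finset.mem_range.mp hj
  have h1 : j < len := by omega
  have h2 : i + 1 - 1 - j = i - j := by omega
  simp [List.getD_eq_getElem?_getD, hj', h1]

theorem kernelList_eq (len n11 n10 n01 n00 : ℕ) :
    kernelList len n11 n10 n01 n00 =
      (List.range' 0 len).map fun b => elemKernel b n11 n10 n01 n00 := by
  unfold kernelList
  rw [forceList_eq, pairList_eq, pairList_eq, altList_eq _ _ 0 false (by simp)]
  refine (conv_eq (fun i => (pairNum i n11 n00 : ℤ)) _ len 0).trans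
    (List.map_congr_left fun b hb => ?_)
  rw [dot_reverse _ _ (by simpa using hb)]
  rfl

theorem getD_kernelList {len b : ℕ} (hb : b < len) (n11 n10 n01 n00 : ℕ) :
    (kernelList len n11 n10 n01 n00).getD b 0 = elemKernel b n11 n10 n01 n00 := by
  rw [kernelList_eq]
  simp [List.getD_eq_getElem?_getD, hb]

/-- A dot product with a list of values of elementary kernels. -/
theorem dot_kernelList (u : List ℤ) (len n11 n10 n01 n00 : ℕ) :
    dot u (kernelList len n11 n10 n01 n00) =
      ∑ b ∈ Finset.range len, u.getD b 0 * elemKernel b n11 n10 n01 n00 := by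
  rw [dot_comm, dot_eq (N := len) _ _ (by simp [kernelList_eq])]
  refine Finset.sum_congr rfl fun b hb => ?_
  rw [getD_kernelList (Finset.mem_range.mp hb), mul_comm]

/-! ### Krawtchouk coefficients -/

/-- The coefficient of `X ^ a` in `(1 + X) ^ p * (1 - X) ^ q`. -/
noncomputable def krawtchouk (a p q : ℕ) : ℤ :=
  ((1 + Polynomial.X) ^ p * (1 - Polynomial.X) ^ q : Polynomial ℤ).coeff a

theorem krawtchouk_swap (a p q : ℕ) : krawtchouk a q p = (-1) ^ a * krawtchouk a p q := by
  unfold krawtchouk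
  rw [mul_comm ((-1) ^ a), ← Polynomial.comp_C_mul_X_coeff]
  simp [mul_comm, sub_eq_add_neg]

theorem mulLinear_coeff (σ : ℤ) (P : Polynomial ℤ) :
    mulLinear σ ((List.range' 0 5).map P.coeff) 0 =
      (List.range' 0 5).map (P * (1 + Polynomial.C σ * Polynomial.X)).coeff := by
  have h : ∀ n, (P * (1 + Polynomial.C σ * Polynomial.X)).coeff (n + 1) =
      P.coeff (n + 1) + σ * P.coeff n := fun n => by
    rw [mul_add, mul_one, Polynomial.coeff_add, mul_comm (Polynomial.C σ), ← mul_assoc,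
      Polynomial.coeff_mul_C, Polynomial.coeff_mul_X]
    ring
  have h0 : (P * (1 + Polynomial.C σ * Polynomial.X)).coeff 0 = P.coeff 0 := by
    simp [Polynomial.mul_coeff_zero]
  have h1 := h 0
  have h2 := h 1
  have h3 := h 2
  have h4 := h 3
  clear h
  generalize P * (1 + Polynomial.C σ * Polynomial.X) = Q at *
  simp only [zero_add, Nat.reduceAdd] at h1 h2 h3 h4
  simp [List.range'_succ, mulLinear, h0, h1, h2, h3, h4]

theorem krawtchoukList_eq (p q : ℕ) :
    krawtchoukList p q = (List.range' 0 5).map fun a => krawtchouk a p q := by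
  have h1 : (Nat.rec [1, 0, 0, 0, 0]
      (fun _ l => forceList (mulLinear 1 l 0) fun l => l) p : List ℤ) =
      (List.range' 0 5).map ((1 + Polynomial.X) ^ p : Polynomial ℤ).coeff := by
    induction p with
    | zero => simp [List.range'_succ, Polynomial.coeff_one]
    | succ p ih =>
      change forceList (mulLinear 1 (Nat.rec _ _ p) 0) _ = _
      rw [ih, forceList_eq, mulLinear_coeff, pow_succ]
      simp
  unfold krawtchoukList
  rw [forceList_eq, h1]
  induction q with
  | zero => simp [krawtchouk]
  | succ q ih =>
    change forceList (mulLinear (-1) (Nat.rec _ _ q) 0) _ = _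
    rw [ih, forceList_eq]
    unfold krawtchouk
    refine (mulLinear_coeff (-1) ((1 + Polynomial.X) ^ p * (1 - Polynomial.X) ^ q)).trans ?_
    rw [pow_succ, ← mul_assoc]
    simp [sub_eq_add_neg]

theorem getD_krawtchoukList {a : ℕ} (ha : a < 5) (p q : ℕ) :
    (krawtchoukList p q).getD a 0 = krawtchouk a p q := by
  rw [krawtchoukList_eq]
  simp [List.getD_eq_getElem?_getD, ha]

/-- Summation of a function of the size over the subsets of `A`, weighted by signs. -/
theorem sum_powerset_sign {ι : Type} (A : Finset ι) (σ : ι → Bool) (f : ℕ → ℤ)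
    (hf : ∀ a, 5 ≤ a → f a = 0) :
    ∑ w ∈ A.powerset, (∏ r ∈ w, if σ r then -1 else 1) * f w.card =
      ∑ a ∈ Finset.range 5, krawtchouk a (A.filter fun r => σ r = false).card
        (A.filter fun r => σ r = true).card * f a := by
  classical
  have h1 : ∑ w ∈ A.powerset, Polynomial.C (∏ r ∈ w, if σ r then (-1 : ℤ) else 1) *
      Polynomial.X ^ w.card = (1 + Polynomial.X) ^ (A.filter fun r => σ r = false).card *
        (1 - Polynomial.X) ^ (A.filter fun r => σ r = true).card := by
    have h2 : ∀ r, (1 + Polynomial.C (if σ r then (-1 : ℤ) else 1) * Polynomial.X) =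
        (if σ r = false then 1 + Polynomial.X else 1) *
          (if σ r = true then 1 - Polynomial.X else 1) := fun r => by
      cases σ r <;> simp [sub_eq_add_neg]
    rw [← Finset.prod_const, ← Finset.prod_const, Finset.prod_filter, Finset.prod_filter,
      ← Finset.prod_mul_distrib, ← Finset.prod_congr rfl fun r _ => h2 r, Finset.prod_one_add]
    refine Finset.sum_congr rfl fun w _ => ?_
    rw [Finset.prod_mul_distrib, Finset.prod_const, map_prod]
  have h3 : ∀ a, krawtchouk a (A.filter fun r => σ r = false).card
      (A.filter fun r => σ r = true).card =
      ∑ w ∈ A.powerset, if a = w.card then ∏ r ∈ w, (if σ r then (-1 : ℤ) else 1) else 0 :=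
    fun a => by
    rw [krawtchouk, ← h1, Polynomial.finsetSum_coeff]
    exact Finset.sum_congr rfl fun w _ => Polynomial.coeff_C_mul_X_pow _ _ _
  simp_rw [h3, Finset.sum_mul]
  rw [Finset.sum_comm]
  refine Finset.sum_congr rfl fun w _ => ?_
  simp_rw [ite_mul, zero_mul]
  rw [Finset.sum_ite_eq']
  split_ifs with h
  · rfl
  · rw [hf _ (by simpa using h), mul_zero]

/-- Splitting the subsets of `U` along a predicate. -/
theorem sum_powerset_split {ι : Type} [DecidableEq ι] (U : Finset ι) (p : ι → Prop)
    [DecidablePred p] (G : Finset ι → ℤ) :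
    ∑ w ∈ U.powerset, G w = ∑ u ∈ (U.filter p).powerset,
      ∑ v ∈ (U.filter fun r => ¬ p r).powerset, G (u ∪ v) := by
  rw [← Finset.sum_product']
  refine Finset.sum_bij' (fun w _ => (w.filter p, w.filter fun r => ¬ p r))
    (fun q _ => q.1 ∪ q.2) ?_ ?_ ?_ ?_ ?_
  · intro w hw
    simp only [Finset.mem_product, Finset.mem_powerset] at hw ⊢
    exact ⟨Finset.filter_subset_filter _ hw, Finset.filter_subset_filter _ hw⟩
  · intro q hq
    simp only [Finset.mem_product, Finset.mem_powerset] at hq ⊢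
    exact Finset.union_subset (hq.1.trans (Finset.filter_subset _ _))
      (hq.2.trans (Finset.filter_subset _ _))
  · intro w _
    exact Finset.filter_union_filter_not_eq _ _
  · intro q hq
    simp only [Finset.mem_product, Finset.mem_powerset] at hq
    have h1 : ∀ r ∈ q.1, p r := fun r hr => (Finset.mem_filter.mp (hq.1 hr)).2
    have h2 : ∀ r ∈ q.2, ¬ p r := fun r hr => (Finset.mem_filter.mp (hq.2 hr)).2
    ext r
    · simp only [Finset.mem_filter, Finset.mem_union]
      exact ⟨fun h => h.1.resolve_right fun h' => h2 r h' h.2, fun h => ⟨Or.inl h, h1 r h⟩⟩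
    · simp only [Finset.mem_filter, Finset.mem_union]
      exact ⟨fun h => h.1.resolve_left fun h' => h.2 (h1 r h'), fun h => ⟨Or.inr h, h2 r h⟩⟩
  · intro w _
    rw [Finset.filter_union_filter_not_eq]

/-! ### The kernels in terms of sums -/

theorem Block.entry_eq (B : Block) (h j h' j' : ℕ) :
    B.entry h j h' j' = ((4 ^ B.1 : ℕ) : ℤ) * dot (B.row h j) (B.row h' j') := by
  unfold Block.entry
  rw [imul_eq]
  rfl

theorem Block.entry_comm (B : Block) (h j h' j' : ℕ) :
    B.entry h j h' j' = B.entry h' j' h j := by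
  rw [B.entry_eq, B.entry_eq, dot_comm]

/-- The empty block. -/
def Block.nil : Block := (0, [])

@[simp] theorem Block.entry_nil (h j h' j' : ℕ) : Block.nil.entry h j h' j' = 0 := by
  have : Block.nil.row h j = [] := by simp [Block.row, Block.nil, nth_eq]
  rw [Block.entry_eq, this]
  simp [dot]

/-- A pair of blocks attached to a pair of words at distance `i`. -/
noncomputable def pairBlock (i k l : ℕ) : Block × Block :=
  ((pairBlocks.getD (i / 2 - 3) []).getD k []).getD l (Block.nil, Block.nil)

/-- A coefficient of the pair kernel. -/
noncomputable def pairCoeff (i k l p q p' q' : ℕ) : ℤ :=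
  (pairBlock i k l).1.entry (halfFold i p) ((halfFold i p + q) / 2 - 3)
    (halfFold i p') ((halfFold i p' + q') / 2 - 3) +
  halfSign i p * halfSign i p' * (pairBlock i k l).2.entry (halfFold i p)
    ((halfFold i p + q) / 2 - 3) (halfFold i p') ((halfFold i p' + q') / 2 - 3)

theorem natDiv_eq (m n : ℕ) : Nat.div m n = m / n := rfl

theorem pairKernel_eq (c0 c1 c2 c3 c4 c5 c6 c7 : ℕ) :
    pairKernel c0 c1 c2 c3 c4 c5 c6 c7 = ∑ k ∈ Finset.range 3, ∑ l ∈ Finset.range 3,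
      elemKernel k c7 c6 c5 c4 * elemKernel l c3 c2 c1 c0 *
        pairCoeff (c4 + c5 + (c6 + c7)) k l (c6 + c7) (c2 + c3) (c5 + c7) (c1 + c3) := by
  have h : ∀ k < 3, ∀ p a p' a' t : ℕ, ∀ s : ℤ, zmul (nth 0 (kernelList 3 c7 c6 c5 c4) k)
      (dot (pairEntries t k p a p' a' s) (kernelList 3 c3 c2 c1 c0)) =
      ∑ l ∈ Finset.range 3, elemKernel k c7 c6 c5 c4 * elemKernel l c3 c2 c1 c0 *
        ((((pairBlocks.getD t []).getD k []).getD l (Block.nil, Block.nil)).1.entry p a p' a' +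
          s * (((pairBlocks.getD t []).getD k []).getD l (Block.nil, Block.nil)).2.entry
            p a p' a') := by
    intro k hk p a p' a' t s
    rw [zmul_eq, nth_eq, getD_kernelList hk, dot_kernelList, Finset.mul_sum]
    refine Finset.sum_congr rfl fun l _ => ?_
    rw [pairEntries, forceList_eq, nth_eq, nth_eq, mul_assoc, mul_comm (elemKernel l _ _ _ _)]
    congr 2
    simp only [List.getD_eq_getElem?_getD, List.getElem?_map]
    cases (((pairBlocks[t]?.getD [])[k]?.getD [])[l]? : Option (Block × Block)) <;> simp
  unfold pairKernel
  simp only [forceNat_eq, forceInt_eq, sumList_eq, List.map_cons, List.map_nil, List.sum_cons,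
    List.sum_nil]
  rw [h 0 (by decide), h 1 (by decide), h 2 (by decide)]
  have h' : ∀ f : ℕ → ℤ, ∑ k ∈ Finset.range 3, f k = f 0 + (f 1 + (f 2 + 0)) := fun f => by
    simp [Finset.sum_range_succ, add_assoc]
  refine Eq.trans ?_ (h' _).symm
  simp only [imul_eq, Nat.add_eq, Nat.sub_eq, natDiv_eq, pairCoeff, pairBlock]

/-- A coefficient of the base kernel. -/
noncomputable def baseCoeff (m h j h' j' β : ℕ) : ℤ :=
  ((baseBlocks.getD m []).getD β Block.nil).entry h j h' j'

theorem baseCoeff_comm (m h j h' j' β : ℕ) :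
    baseCoeff m h j h' j' β = baseCoeff m h' j' h j β := Block.entry_comm _ _ _ _ _

/-- The part of the base kernel attached to index sets whose intersections with the four classes
have sizes `a`, `b`, `c`, `e`. -/
noncomputable def basePart (n0 n1 n2 n3 a b c e : ℕ) : ℤ :=
  if a + b + c + e ≤ 4 ∧ Even (a + b) ∧ Even (a + c) then
    ∑ β ∈ Finset.range 10, baseCoeff (a + b + c + e) ((n0 + n1) / 2 - 3) ((a + b) / 2)
      ((n0 + n2) / 2 - 3) ((a + c) / 2) β * elemKernel β (n0 - a) (n1 - b) (n2 - c) (n3 - e)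
  else 0

theorem baseTerm_eq (m h j h' j' n11 n10 n01 n00 : ℕ) :
    baseTerm m h j h' j' n11 n10 n01 n00 =
      ∑ β ∈ Finset.range 10, baseCoeff m h j h' j' β * elemKernel β n11 n10 n01 n00 := by
  rw [baseTerm, forceInt_eq, dot_kernelList]
  refine Finset.sum_congr rfl fun β _ => ?_
  rw [baseEntries, forceList_eq, nth_eq, baseCoeff]
  congr 1
  simp only [List.getD_eq_getElem?_getD, List.getElem?_map]
  cases ((baseBlocks[m]?.getD [])[β]? : Option Block) <;> simp

theorem toFinset_classSizes : classSizes.toFinset =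
    (Finset.range 5 ×ˢ Finset.range 5 ×ˢ Finset.range 5 ×ˢ Finset.range 5).filter
      fun t => t.1 + t.2.1 + t.2.2.1 + t.2.2.2 ≤ 4 ∧ Even (t.1 + t.2.1) ∧ Even (t.1 + t.2.2.1) := by
  decide +kernel

theorem nodup_classSizes : classSizes.Nodup := by decide +kernel

theorem baseKernel_eq (c0 c1 c2 c3 c4 c5 c6 c7 : ℕ) :
    baseKernel c0 c1 c2 c3 c4 c5 c6 c7 = ∑ a ∈ Finset.range 5, ∑ b ∈ Finset.range 5,
      ∑ c ∈ Finset.range 5, ∑ e ∈ Finset.range 5,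
        krawtchouk a c5 c6 * krawtchouk b c4 c7 * krawtchouk c c1 c2 * krawtchouk e c0 c3 *
          basePart (c5 + c6) (c4 + c7) (c1 + c2) (c0 + c3) a b c e := by
  simp_rw [← Finset.sum_product']
  unfold baseKernel
  simp only [forceNat_eq, sumList_eq, Nat.add_eq, Nat.sub_eq, natDiv_eq]
  rw [← List.sum_toFinset _ nodup_classSizes, toFinset_classSizes, Finset.sum_filter]
  refine Finset.sum_congr rfl fun t ht => ?_
  simp only [Finset.mem_product, Finset.mem_range] at ht
  obtain ⟨ha, hb, hc, he⟩ := ht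
  unfold basePart
  split_ifs with h
  · unfold baseSummand
    simp only [forceNat_eq, zmul_eq, nth_eq, getD_krawtchoukList, ha, hb, hc, he, baseTerm_eq,
      Nat.add_eq, Nat.sub_eq, natDiv_eq, mul_assoc]
  · simp

/-! ### Symmetries of the kernels -/

theorem pairCoeff_comm (i k l p q p' q' : ℕ) :
    pairCoeff i k l p q p' q' = pairCoeff i k l p' q' p q := by
  unfold pairCoeff
  rw [Block.entry_comm, Block.entry_comm (pairBlock i k l).2, mul_comm (halfSign i p)]

theorem pairCoeff_flip (k l p r q p' r' q' : ℕ) (h : p + r = p' + r') :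
    pairCoeff (p + r) k l p q p' q' = pairCoeff (p + r) k l r q r' q' := by
  have h1 : halfFold (p + r) p = halfFold (p + r) r := by
    rw [halfFold_eq _ _ (by omega), halfFold_eq _ _ (by omega)]
    omega
  have h2 : halfFold (p + r) p' = halfFold (p + r) r' := by
    rw [halfFold_eq _ _ (by omega), halfFold_eq _ _ (by omega)]
    omega
  have h3 : halfSign (p + r) p = - halfSign (p + r) r := by
    rw [halfSign_eq, halfSign_eq, ← Int.sign_neg]
    congr 1
    push_cast
    ring
  have h4 : halfSign (p + r) p' = - halfSign (p + r) r' := by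
    rw [halfSign_eq, halfSign_eq, ← Int.sign_neg, h]
    congr 1
    push_cast
    ring
  rw [pairCoeff, pairCoeff, h1, h2, h3, h4, neg_mul_neg]

theorem pairKernel_swap_right (c0 c1 c2 c3 c4 c5 c6 c7 : ℕ) :
    pairKernel c0 c2 c1 c3 c4 c6 c5 c7 = pairKernel c0 c1 c2 c3 c4 c5 c6 c7 := by
  rw [pairKernel_eq, pairKernel_eq]
  refine Finset.sum_congr rfl fun k _ => Finset.sum_congr rfl fun l _ => ?_
  rw [pairCoeff_comm, elemKernel_swap k, elemKernel_swap l,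
    show c4 + c6 + (c5 + c7) = c4 + c5 + (c6 + c7) by omega]

theorem pairKernel_swap_left (c0 c1 c2 c3 c4 c5 c6 c7 : ℕ) :
    pairKernel c0 c1 c2 c3 c7 c6 c5 c4 = pairKernel c0 c1 c2 c3 c4 c5 c6 c7 := by
  rw [pairKernel_eq, pairKernel_eq]
  refine Finset.sum_congr rfl fun k _ => Finset.sum_congr rfl fun l _ => ?_
  rw [elemKernel_flip k, show c7 + c6 + (c5 + c4) = c5 + c4 + (c7 + c6) by omega,
    pairCoeff_flip _ _ _ _ _ _ (c5 + c7) _ (by omega),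
    show c5 + c4 + (c7 + c6) = c4 + c5 + (c6 + c7) by omega, show c7 + c6 = c6 + c7 by omega]

theorem basePart_eq_zero {n0 n1 n2 n3 a b c e : ℕ} (h : ¬ (Even (a + b) ∧ Even (a + c))) :
    basePart n0 n1 n2 n3 a b c e = 0 := if_neg fun h' => h h'.2

theorem baseKernel_swap_right (c0 c1 c2 c3 c4 c5 c6 c7 : ℕ) :
    baseKernel c0 c2 c1 c3 c4 c6 c5 c7 = baseKernel c0 c1 c2 c3 c4 c5 c6 c7 := by
  rw [baseKernel_eq, baseKernel_eq, add_comm c6, add_comm c2]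
  refine Finset.sum_congr rfl fun a _ => Finset.sum_congr rfl fun b _ =>
    Finset.sum_congr rfl fun c _ => Finset.sum_congr rfl fun e _ => ?_
  by_cases h : Even (a + b) ∧ Even (a + c)
  · rw [krawtchouk_swap a, krawtchouk_swap c]
    linear_combination (krawtchouk a c5 c6 * krawtchouk b c4 c7 * krawtchouk c c1 c2 *
      krawtchouk e c0 c3 * basePart (c5 + c6) (c4 + c7) (c1 + c2) (c0 + c3) a b c e) *
      (h.2.neg_one_pow : (-1 : ℤ) ^ (a + c) = 1)
  · rw [basePart_eq_zero h]
    simp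

theorem baseKernel_swap_left (c0 c1 c2 c3 c4 c5 c6 c7 : ℕ) :
    baseKernel c0 c1 c2 c3 c7 c6 c5 c4 = baseKernel c0 c1 c2 c3 c4 c5 c6 c7 := by
  rw [baseKernel_eq, baseKernel_eq, add_comm c6, add_comm c7]
  refine Finset.sum_congr rfl fun a _ => Finset.sum_congr rfl fun b _ =>
    Finset.sum_congr rfl fun c _ => Finset.sum_congr rfl fun e _ => ?_
  by_cases h : Even (a + b) ∧ Even (a + c)
  · rw [krawtchouk_swap a, krawtchouk_swap b]
    linear_combination (krawtchouk a c5 c6 * krawtchouk b c4 c7 * krawtchouk c c1 c2 *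
      krawtchouk e c0 c3 * basePart (c5 + c6) (c4 + c7) (c1 + c2) (c0 + c3) a b c e) *
      (h.1.neg_one_pow : (-1 : ℤ) ^ (a + b) = 1)
  · rw [basePart_eq_zero h]
    simp

theorem basePart_swap (n0 n1 n2 n3 a b c e : ℕ) :
    basePart n0 n2 n1 n3 a c b e = basePart n0 n1 n2 n3 a b c e := by
  unfold basePart
  refine if_congr ⟨fun h => ⟨by omega, h.2.2, h.2.1⟩, fun h => ⟨by omega, h.2.2, h.2.1⟩⟩ ?_ rfl
  refine Finset.sum_congr rfl fun β _ => ?_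
  rw [baseCoeff_comm, elemKernel_swap, show a + c + b + e = a + b + c + e by omega]

theorem baseKernel_swap_pairs (c0 c1 c2 c3 c4 c5 c6 c7 : ℕ) :
    baseKernel c0 c4 c7 c3 c1 c5 c6 c2 = baseKernel c0 c1 c2 c3 c4 c5 c6 c7 := by
  rw [baseKernel_eq, baseKernel_eq]
  refine Finset.sum_congr rfl fun a _ => ?_
  rw [Finset.sum_comm]
  refine Finset.sum_congr rfl fun b _ => Finset.sum_congr rfl fun c _ =>
    Finset.sum_congr rfl fun e _ => ?_
  rw [basePart_swap]
  ring

theorem totalKernel_eq (c0 c1 c2 c3 c4 c5 c6 c7 : ℕ) : totalKernel c0 c1 c2 c3 c4 c5 c6 c7 =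
    pairKernel c0 c1 c2 c3 c4 c5 c6 c7 + pairKernel c0 c1 c4 c5 c2 c3 c6 c7 +
    pairKernel c0 c2 c4 c6 c1 c3 c5 c7 + pairKernel c0 c1 c7 c6 c2 c3 c5 c4 +
    pairKernel c0 c2 c7 c5 c1 c3 c6 c4 + pairKernel c0 c4 c7 c3 c1 c5 c6 c2 +
    (baseKernel c0 c1 c2 c3 c4 c5 c6 c7 + baseKernel c0 c1 c4 c5 c2 c3 c6 c7 +
    baseKernel c0 c2 c4 c6 c1 c3 c5 c7) := by
  simp only [totalKernel, iadd_eq]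
  ring

theorem totalKernel_swap_zero_one (c0 c1 c2 c3 c4 c5 c6 c7 : ℕ) :
    totalKernel c0 c1 c2 c3 c7 c6 c5 c4 = totalKernel c0 c1 c2 c3 c4 c5 c6 c7 := by
  rw [totalKernel_eq, totalKernel_eq]
  linarith only [pairKernel_swap_left c0 c1 c2 c3 c7 c6 c5 c4,
    pairKernel_swap_right c0 c7 c4 c3 c1 c6 c5 c2,
    baseKernel_swap_left c0 c1 c2 c3 c7 c6 c5 c4,
    baseKernel_swap_pairs c0 c1 c7 c6 c2 c3 c5 c4,
    baseKernel_swap_pairs c0 c2 c7 c5 c1 c3 c6 c4]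

theorem totalKernel_swap_one_two (c0 c1 c2 c3 c4 c5 c6 c7 : ℕ) :
    totalKernel c0 c1 c4 c5 c2 c3 c6 c7 = totalKernel c0 c1 c2 c3 c4 c5 c6 c7 := by
  rw [totalKernel_eq, totalKernel_eq]
  linarith only [pairKernel_swap_right c0 c4 c2 c6 c1 c5 c3 c7,
    pairKernel_swap_left c0 c1 c7 c6 c4 c5 c3 c2,
    baseKernel_swap_right c0 c4 c2 c6 c1 c5 c3 c7]

theorem totalKernel_swap_two_three (c0 c1 c2 c3 c4 c5 c6 c7 : ℕ) :
    totalKernel c0 c2 c1 c3 c4 c6 c5 c7 = totalKernel c0 c1 c2 c3 c4 c5 c6 c7 := by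
  rw [totalKernel_eq, totalKernel_eq]
  linarith only [pairKernel_swap_right c0 c2 c1 c3 c4 c6 c5 c7,
    pairKernel_swap_left c0 c4 c7 c3 c2 c6 c5 c1,
    baseKernel_swap_right c0 c2 c1 c3 c4 c6 c5 c7]

/-! ### The kernels as functions of words -/

section words

variable {ι : Type}

/-- The pointwise sum of two words. -/
def bxor₂ (x y : ι → Bool) : ι → Bool := fun r => x r ^^ y r

/-- The number of coordinates where the sums of `x` with `y`, `z`, `w` take given values. -/
def cell [Fintype ι] (x y z w : ι → Bool) (b₁ b₂ b₃ : Bool) : ℕ :=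
  (Finset.univ.filter fun r => (x r ^^ y r) = b₁ ∧ (x r ^^ z r) = b₂ ∧ (x r ^^ w r) = b₃).card

/-- A function of eight cell sizes, evaluated at four words. -/
def onCells [Fintype ι] (K : ℕ → ℕ → ℕ → ℕ → ℕ → ℕ → ℕ → ℕ → ℤ) (x y z w : ι → Bool) : ℤ :=
  K (cell x y z w false false false) (cell x y z w false false true)
    (cell x y z w false true false) (cell x y z w false true true)
    (cell x y z w true false false) (cell x y z w true false true)
    (cell x y z w true true false) (cell x y z w true true true)

theorem isGram_block [Fintype ι] [DecidableEq ι] (B : Block) (f g : (ι → Bool) → ℕ) :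
    IsGram fun x y => B.entry (f x) (g x) (f y) (g y) :=
  ((IsGram.dot fun x => B.row (f x) (g x)).natCast_mul (4 ^ B.1)).congr fun _ _ =>
    B.entry_eq _ _ _ _

theorem isGram_pairCoeff [Fintype ι] [DecidableEq ι] (i k l : ℕ) (p q : (ι → Bool) → ℕ) :
    IsGram fun x y => pairCoeff i k l (p x) (q x) (p y) (q y) := by
  unfold pairCoeff
  exact (isGram_block _ (fun x => halfFold i (p x))
    fun x => (halfFold i (p x) + q x) / 2 - 3).add
    ((IsGram.rankOne fun x => halfSign i (p x)).mul (isGram_block _ (fun x => halfFold i (p x))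
      fun x => (halfFold i (p x) + q x) / 2 - 3))

theorem count₂_add_left [DecidableEq ι] (U : Finset ι) (x y : ι → Bool) (s : Bool) :
    count₂ U x y s false + count₂ U x y s true = (U.filter fun r => x r = s).card := by
  unfold count₂
  rw [← Finset.card_union_of_disjoint, ← Finset.filter_or]
  · congr 1
    refine Finset.filter_congr fun r _ => ?_
    cases y r <;> simp
  · exact Finset.disjoint_filter.mpr fun r _ h h' => by simp_all

theorem count₂_comm (U : Finset ι) (x y : ι → Bool) (s t : Bool) :
    count₂ U x y s t = count₂ U y x t s := by
  unfold count₂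
  simp_rw [and_comm]

theorem count₂_add_right [DecidableEq ι] (U : Finset ι) (x y : ι → Bool) (t : Bool) :
    count₂ U x y false t + count₂ U x y true t = (U.filter fun r => y r = t).card := by
  rw [count₂_comm, count₂_comm U x, count₂_add_left]

theorem cell_eq_count₂ [Fintype ι] (x y z w : ι → Bool) (b₁ b₂ b₃ : Bool) :
    cell x y z w b₁ b₂ b₃ =
      count₂ (Finset.univ.filter fun r => (x r ^^ y r) = b₁) (bxor₂ x z) (bxor₂ x w) b₂ b₃ := by
  unfold cell count₂ bxor₂
  rw [Finset.filter_filter]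

theorem isGram_pairKernel [Fintype ι] [DecidableEq ι] (x y : ι → Bool) :
    IsGram fun z w => onCells pairKernel x y z w := by
  let f (b : Bool) : (ι → Bool) → ℕ := fun z =>
    ((Finset.univ.filter fun r => (x r ^^ y r) = b).filter fun r => bxor₂ x z r = true).card
  refine IsGram.congr (K := fun z w => ∑ k ∈ Finset.range 3, ∑ l ∈ Finset.range 3,
      elemKernel k (cell x y z w true true true) (cell x y z w true true false)
        (cell x y z w true false true) (cell x y z w true false false) *
      elemKernel l (cell x y z w false true true) (cell x y z w false true false)
        (cell x y z w false false true) (cell x y z w false false false) *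
        pairCoeff (Finset.univ.filter fun r => (x r ^^ y r) = true).card k l
          (f true z) (f false z) (f true w) (f false w)) ?_ fun z w => ?_
  · refine IsGram.sum _ fun k _ => IsGram.sum _ fun l _ =>
      (IsGram.mul ?_ ?_).mul (isGram_pairCoeff _ _ _ _ _)
    · simp only [cell_eq_count₂]
      exact (isGram_elemKernel k _).comp (bxor₂ x)
    · simp only [cell_eq_count₂]
      exact (isGram_elemKernel l _).comp (bxor₂ x)
  · unfold onCells
    rw [pairKernel_eq]
    have hi : cell x y z w true false false + cell x y z w true false true +
        (cell x y z w true true false + cell x y z w true true true) =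
        (Finset.univ.filter fun r => (x r ^^ y r) = true).card := by
      simp only [cell_eq_count₂]
      rw [count₂_add_left, count₂_add_left, ← Finset.card_union_of_disjoint, ← Finset.filter_or]
      · congr 1
        refine Finset.filter_true_of_mem fun r _ => ?_
        cases bxor₂ x z r <;> simp
      · exact Finset.disjoint_filter.mpr fun r _ h h' => by simp_all
    have hp : ∀ b, cell x y z w b true false + cell x y z w b true true = f b z := fun b => by
      simp only [cell_eq_count₂]
      exact count₂_add_left _ _ _ _
    have hq : ∀ b, cell x y z w b false true + cell x y z w b true true = f b w := fun b => by
      simp only [cell_eq_count₂]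
      exact count₂_add_right _ _ _ _
    rw [hi, hp, hp, hq, hq]

/-- The character of `w` at `x`. -/
def character (w : Finset ι) (x : ι → Bool) : ℤ := ∏ r ∈ w, if x r then -1 else 1

theorem character_bxor₂ (w : Finset ι) (x y : ι → Bool) :
    character w (bxor₂ x y) = character w x * character w y := by
  unfold character bxor₂
  rw [← Finset.prod_mul_distrib]
  refine Finset.prod_congr rfl fun r _ => ?_
  cases x r <;> cases y r <;> rfl

theorem sum_character_split [DecidableEq ι] (U : Finset ι) (p σ : ι → Bool)
    (H : Finset ι → Finset ι → ℤ) :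
    ∑ w ∈ U.powerset, character w σ *
      H (w.filter fun r => p r = true) (w.filter fun r => p r = false) =
    ∑ u ∈ (U.filter fun r => p r = true).powerset, character u σ *
      ∑ v ∈ (U.filter fun r => p r = false).powerset, character v σ * H u v := by
  rw [sum_powerset_split U fun r => p r = true]
  simp only [Bool.not_eq_true, Finset.mul_sum]
  refine Finset.sum_congr rfl fun u hu => Finset.sum_congr rfl fun v hv => ?_
  have h1 : ∀ r ∈ u, p r = true := fun r hr =>
    (Finset.mem_filter.mp (Finset.mem_powerset.mp hu hr)).2
  have h2 : ∀ r ∈ v, p r = false := fun r hr =>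
    (Finset.mem_filter.mp (Finset.mem_powerset.mp hv hr)).2
  have h3 : Disjoint u v := Finset.disjoint_left.mpr fun r hr hr' => by
    simpa [h1 r hr] using h2 r hr'
  rw [Finset.filter_union, Finset.filter_union, Finset.filter_true_of_mem h1,
    Finset.filter_true_of_mem h2,
    Finset.filter_false_of_mem fun r hr => by simp [h2 r hr],
    Finset.filter_false_of_mem fun r hr => by simp [h1 r hr],
    Finset.union_empty, Finset.empty_union, character, Finset.prod_union h3, mul_assoc]
  rfl

/-- Summation over index sets of a function of the sizes of the intersections with four
classes. -/
theorem sum_character_four [DecidableEq ι] (U : Finset ι) (p q σ : ι → Bool) (F : ℕ → ℕ → ℕ → ℕ → ℤ)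
    (hF : ∀ a b c e, 5 ≤ a ∨ 5 ≤ b ∨ 5 ≤ c ∨ 5 ≤ e → F a b c e = 0) :
    ∑ w ∈ U.powerset, character w σ * F (count₂ w p q true true) (count₂ w p q true false)
      (count₂ w p q false true) (count₂ w p q false false) =
    ∑ a ∈ Finset.range 5, ∑ b ∈ Finset.range 5, ∑ c ∈ Finset.range 5, ∑ e ∈ Finset.range 5,
      krawtchouk a
        (count₂ (U.filter fun r => σ r = false) p q true true)
        (count₂ (U.filter fun r => σ r = true) p q true true) *
      krawtchouk b
        (count₂ (U.filter fun r => σ r = false) p q true false)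
        (count₂ (U.filter fun r => σ r = true) p q true false) *
      krawtchouk c
        (count₂ (U.filter fun r => σ r = false) p q false true)
        (count₂ (U.filter fun r => σ r = true) p q false true) *
      krawtchouk e
        (count₂ (U.filter fun r => σ r = false) p q false false)
        (count₂ (U.filter fun r => σ r = true) p q false false) * F a b c e := by
  have hc : ∀ (w : Finset ι) (s t : Bool), count₂ w p q s t =
      ((w.filter fun r => p r = s).filter fun r => q r = t).card := fun w s t => by
    rw [count₂, Finset.filter_filter]
  have hs : ∀ s t b, count₂ (U.filter fun r => σ r = b) p q s t =
      (((U.filter fun r => p r = s).filter fun r => q r = t).filter fun r => σ r = b).card :=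
    fun s t b => by
    rw [count₂, Finset.filter_filter, Finset.filter_filter, Finset.filter_filter]
    congr 1
    exact Finset.filter_congr fun r _ => by tauto
  simp only [hs]
  simp only [hc]
  rw [sum_character_split U p σ fun u v => F (u.filter fun r => q r = true).card
    (u.filter fun r => q r = false).card (v.filter fun r => q r = true).card
    (v.filter fun r => q r = false).card]
  rw [sum_character_split _ q σ fun u₁ u₂ => ∑ v ∈ (U.filter fun r => p r = false).powerset,
    character v σ * F u₁.card u₂.card (v.filter fun r => q r = true).card
    (v.filter fun r => q r = false).card]
  simp_rw [fun a b => sum_character_split (U.filter fun r => p r = false) q σ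
    fun v₁ v₂ => F a b v₁.card v₂.card]
  let k (A : Finset ι) (a : ℕ) : ℤ := krawtchouk a (A.filter fun r => σ r = false).card
    (A.filter fun r => σ r = true).card
  have key : ∀ (A : Finset ι) (f : ℕ → ℤ), (∀ a, 5 ≤ a → f a = 0) →
      ∑ w ∈ A.powerset, character w σ * f w.card = ∑ a ∈ Finset.range 5, k A a * f a :=
    fun A f hf => sum_powerset_sign A σ f hf
  have h1 : ∀ A a b c, ∑ w ∈ A.powerset, character w σ * F a b c w.card =
      ∑ e ∈ Finset.range 5, k A e * F a b c e :=
    fun A a b c => key A (F a b c) fun e he => hF _ _ _ _ (by tauto)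
  have h2 : ∀ A B a b, ∑ w ∈ A.powerset, character w σ *
      ∑ e ∈ Finset.range 5, k B e * F a b w.card e =
      ∑ c ∈ Finset.range 5, k A c * ∑ e ∈ Finset.range 5, k B e * F a b c e :=
    fun A B a b => key A (fun c => ∑ e ∈ Finset.range 5, k B e * F a b c e) fun c hc => by
      simp [fun e => hF a b c e (by tauto)]
  have h3 : ∀ A B D a, ∑ w ∈ A.powerset, character w σ *
      ∑ c ∈ Finset.range 5, k B c * ∑ e ∈ Finset.range 5, k D e * F a w.card c e =
      ∑ b ∈ Finset.range 5, k A b *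
        ∑ c ∈ Finset.range 5, k B c * ∑ e ∈ Finset.range 5, k D e * F a b c e :=
    fun A B D a => key A (fun b => ∑ c ∈ Finset.range 5, k B c *
      ∑ e ∈ Finset.range 5, k D e * F a b c e) fun b hb => by
      simp [fun c e => hF a b c e (by tauto)]
  have h4 : ∀ A B D E, ∑ w ∈ A.powerset, character w σ * ∑ b ∈ Finset.range 5, k B b *
      ∑ c ∈ Finset.range 5, k D c * ∑ e ∈ Finset.range 5, k E e * F w.card b c e =
      ∑ a ∈ Finset.range 5, k A a * ∑ b ∈ Finset.range 5, k B b *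
        ∑ c ∈ Finset.range 5, k D c * ∑ e ∈ Finset.range 5, k E e * F a b c e :=
    fun A B D E => key A (fun a => ∑ b ∈ Finset.range 5, k B b * ∑ c ∈ Finset.range 5, k D c *
      ∑ e ∈ Finset.range 5, k E e * F a b c e) fun a ha => by
      simp [fun b c e => hF a b c e (by tauto)]
  simp_rw [h1, h2, h3, h4, Finset.mul_sum, mul_assoc]
  rfl

end words

section baseKernel

variable {ι : Type}

theorem cell_eq_count₂_bxor₂ [Fintype ι] (x y z w : ι → Bool) (b₁ b₂ b₃ : Bool) :
    cell x y z w b₁ b₂ b₃ = count₂ (Finset.univ.filter fun r => bxor₂ x z r = b₂)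
      (bxor₂ x y) (bxor₂ z w) b₁ (b₂ ^^ b₃) := by
  unfold cell count₂ bxor₂
  rw [Finset.filter_filter]
  congr 1
  refine Finset.filter_congr fun r _ => ?_
  cases x r <;> cases y r <;> cases z r <;> cases w r <;> cases b₁ <;> cases b₂ <;> cases b₃ <;>
    simp

theorem count₂_filter_add [Fintype ι] [DecidableEq ι] (σ p q : ι → Bool) (s t : Bool) :
    count₂ (Finset.univ.filter fun r => σ r = false) p q s t +
      count₂ (Finset.univ.filter fun r => σ r = true) p q s t =
      count₂ Finset.univ p q s t := by
  unfold count₂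
  rw [← Finset.card_union_of_disjoint, Finset.filter_filter, Finset.filter_filter,
    ← Finset.filter_or]
  · congr 1
    refine Finset.filter_congr fun r _ => ?_
    cases σ r <;> simp
  · refine Finset.disjoint_filter_filter (Finset.disjoint_filter.mpr fun r _ h h' => by simp_all)

theorem count₂_sub [Fintype ι] [DecidableEq ι] (w : Finset ι) (p q : ι → Bool) (s t : Bool) :
    count₂ Finset.univ p q s t - count₂ w p q s t = count₂ wᶜ p q s t := by
  unfold count₂
  rw [← Finset.card_sdiff_of_subset (Finset.filter_subset_filter _ (Finset.subset_univ _))]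
  congr 1
  ext r
  simp
  tauto

/-- The number of elements of `w` where the two words differ. -/
def diffCount (w : Finset ι) (X : (ι → Bool) × (ι → Bool)) : ℕ :=
  (w.filter fun r => bxor₂ X.1 X.2 r = true).card

theorem count₂_add_eq_diffCount_left [DecidableEq ι] (w : Finset ι)
    (X Y : (ι → Bool) × (ι → Bool)) :
    count₂ w (bxor₂ X.1 X.2) (bxor₂ Y.1 Y.2) true true +
      count₂ w (bxor₂ X.1 X.2) (bxor₂ Y.1 Y.2) true false = diffCount w X := by
  rw [add_comm]
  exact count₂_add_left _ _ _ _

theorem count₂_add_eq_diffCount_right [DecidableEq ι] (w : Finset ι)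
    (X Y : (ι → Bool) × (ι → Bool)) :
    count₂ w (bxor₂ X.1 X.2) (bxor₂ Y.1 Y.2) true true +
      count₂ w (bxor₂ X.1 X.2) (bxor₂ Y.1 Y.2) false true = diffCount w Y := by
  rw [add_comm]
  exact count₂_add_right _ _ _ _

theorem count₂_total [DecidableEq ι] (w : Finset ι) (p q : ι → Bool) :
    count₂ w p q true true + count₂ w p q true false + count₂ w p q false true +
      count₂ w p q false false = w.card := by
  have h := Finset.card_filter_add_card_filter_not (s := w) fun r => p r = true
  simp only [Bool.not_eq_true] at h
  rw [← count₂_add_left w p q, ← count₂_add_left w p q] at h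
  omega

/-- The part of the base kernel attached to an index set and the order of an elementary
kernel, as a function of two pairs of words. -/
noncomputable def baseWordPart [Fintype ι] [DecidableEq ι] (t : Finset ι × ℕ)
    (X Y : (ι → Bool) × (ι → Bool)) : ℤ :=
  ((if t.1.card ≤ 4 then 1 else 0 : ℕ) : ℤ) *
  (((if Even (diffCount t.1 X) then character t.1 X.1 else 0) *
    (if Even (diffCount t.1 Y) then character t.1 Y.1 else 0)) *
  (baseCoeff t.1.card (diffCount Finset.univ X / 2 - 3) (diffCount t.1 X / 2)
    (diffCount Finset.univ Y / 2 - 3) (diffCount t.1 Y / 2) t.2 *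
  elemKernel t.2 (count₂ t.1ᶜ (bxor₂ X.1 X.2) (bxor₂ Y.1 Y.2) true true)
    (count₂ t.1ᶜ (bxor₂ X.1 X.2) (bxor₂ Y.1 Y.2) true false)
    (count₂ t.1ᶜ (bxor₂ X.1 X.2) (bxor₂ Y.1 Y.2) false true)
    (count₂ t.1ᶜ (bxor₂ X.1 X.2) (bxor₂ Y.1 Y.2) false false)))

theorem isGram_baseWordPart [Fintype ι] [DecidableEq ι] (t : Finset ι × ℕ) :
    IsGram (baseWordPart t) := by
  refine IsGram.natCast_mul (IsGram.mul (IsGram.rankOne _) (IsGram.mul ?_ ?_)) _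
  · refine ((IsGram.dot fun X : (ι → Bool) × (ι → Bool) =>
      ((baseBlocks.getD t.1.card []).getD t.2 Block.nil).row (diffCount Finset.univ X / 2 - 3)
        (diffCount t.1 X / 2)).natCast_mul
        (4 ^ ((baseBlocks.getD t.1.card []).getD t.2 Block.nil).1)).congr fun X Y => ?_
    exact Block.entry_eq _ _ _ _ _
  · exact (isGram_elemKernel t.2 t.1ᶜ).comp fun X : (ι → Bool) × (ι → Bool) => bxor₂ X.1 X.2

theorem onCells_baseKernel [Fintype ι] [DecidableEq ι] (x y z w : ι → Bool) :
    onCells baseKernel x y z w =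
      ∑ t ∈ Finset.univ ×ˢ Finset.range 10, baseWordPart t (x, y) (z, w) := by
  have h := sum_character_four Finset.univ (bxor₂ x y) (bxor₂ z w) (bxor₂ x z)
    (basePart (count₂ Finset.univ (bxor₂ x y) (bxor₂ z w) true true)
      (count₂ Finset.univ (bxor₂ x y) (bxor₂ z w) true false)
      (count₂ Finset.univ (bxor₂ x y) (bxor₂ z w) false true)
      (count₂ Finset.univ (bxor₂ x y) (bxor₂ z w) false false))
    fun a b c e h => if_neg (by omega)
  unfold onCells
  rw [baseKernel_eq]
  simp only [cell_eq_count₂_bxor₂, Bool.xor_false, Bool.not_true,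
    Bool.not_false, count₂_filter_add, Bool.xor_true]
  rw [← h, Finset.sum_product, Finset.powerset_univ]
  refine Finset.sum_congr rfl fun u _ => ?_
  unfold basePart
  have h1 := count₂_add_eq_diffCount_left u (x, y) (z, w)
  have h2 := count₂_add_eq_diffCount_right u (x, y) (z, w)
  have h3 := count₂_add_eq_diffCount_left Finset.univ (x, y) (z, w)
  have h4 := count₂_add_eq_diffCount_right Finset.univ (x, y) (z, w)
  dsimp only at h1 h2 h3 h4
  rw [count₂_total, h1, h2, h3, h4]
  simp only [count₂_sub, baseWordPart, character_bxor₂]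
  by_cases hc : u.card ≤ 4 <;> by_cases hx : Even (diffCount u (x, y)) <;>
    by_cases hy : Even (diffCount u (z, w)) <;> simp [hc, hx, hy, Finset.mul_sum]

end baseKernel

theorem baseWordPart_zero {ι : Type} [Fintype ι] [DecidableEq ι] (X Y : (ι → Bool) × (ι → Bool)) :
    baseWordPart (∅, 0) X Y = 4 ^ 19 *
      dot (((baseBlocks.getD 0 []).getD 0 Block.nil).row (diffCount Finset.univ X / 2 - 3) 0)
        (((baseBlocks.getD 0 []).getD 0 Block.nil).row (diffCount Finset.univ Y / 2 - 3) 0) := by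
  have h : ((baseBlocks.getD 0 []).getD 0 Block.nil).1 = 19 := rfl
  unfold baseWordPart baseCoeff
  rw [Finset.card_empty]
  generalize (baseBlocks.getD 0 []).getD 0 Block.nil = B at h
  simp [Block.entry_eq, diffCount, character, h, elemKernel, pairNum]

theorem linearTerm_eq (d : ℕ) : linearTerm d = 4 ^ 19 *
    dot constRow (((baseBlocks.getD 0 []).getD 0 Block.nil).row (d / 2 - 3) 0) := by
  rw [linearTerm, imul_eq, nth_eq, nth_eq]
  rfl

theorem diffCount_univ {ι : Type} [Fintype ι] (x y : ι → Bool) :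
    diffCount Finset.univ (x, y) = hammingDist x y := by
  unfold diffCount hammingDist bxor₂
  congr 1
  exact Finset.filter_congr fun r _ => by simp

/-- The inequality coming from the base kernel. -/
theorem sum_baseKernel {ι : Type} [Fintype ι] [DecidableEq ι] (C : Finset (ι → Bool)) :
    0 ≤ ∑ x ∈ C, ∑ y ∈ C, ∑ z ∈ C, ∑ w ∈ C, onCells baseKernel x y z w +
      2 * ∑ x ∈ C, ∑ y ∈ C, linearTerm (hammingDist x y) + 4 ^ 19 * dot constRow constRow := by
  let r (X : (ι → Bool) × (ι → Bool)) : List ℤ :=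
    ((baseBlocks.getD 0 []).getD 0 Block.nil).row (diffCount Finset.univ X / 2 - 3) 0
  have h1 : 0 ≤ ∑ X ∈ C ×ˢ C, ∑ Y ∈ C ×ˢ C,
      ∑ t ∈ (Finset.univ ×ˢ Finset.range 10).erase (∅, 0), baseWordPart t X Y :=
    (IsGram.sum _ fun t _ => isGram_baseWordPart t).sum_nonneg (C ×ˢ C)
  have h2 := (IsGram.dot fun o : Option ((ι → Bool) × (ι → Bool)) =>
    o.elim constRow r).sum_nonneg (Finset.insertNone (C ×ˢ C))
  simp only [Finset.sum_insertNone, Option.elim_none, Option.elim_some,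
    Finset.sum_add_distrib] at h2
  have h3 : ∑ x ∈ C, ∑ y ∈ C, ∑ z ∈ C, ∑ w ∈ C, onCells baseKernel x y z w =
      4 ^ 19 * ∑ X ∈ C ×ˢ C, ∑ Y ∈ C ×ˢ C, dot (r X) (r Y) + ∑ X ∈ C ×ˢ C, ∑ Y ∈ C ×ˢ C,
      ∑ t ∈ (Finset.univ ×ˢ Finset.range 10).erase (∅, 0), baseWordPart t X Y := by
    simp_rw [Finset.mul_sum]
    rw [← Finset.sum_add_distrib, Finset.sum_product]
    refine Finset.sum_congr rfl fun x _ => Finset.sum_congr rfl fun y _ => ?_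
    rw [← Finset.sum_add_distrib, Finset.sum_product]
    refine Finset.sum_congr rfl fun z _ => Finset.sum_congr rfl fun w _ => ?_
    rw [onCells_baseKernel, ← baseWordPart_zero]
    exact (Finset.add_sum_erase _ (fun t => baseWordPart t (x, y) (z, w)) (by simp)).symm
  have h4 : ∑ x ∈ C, ∑ y ∈ C, linearTerm (hammingDist x y) =
      4 ^ 19 * ∑ X ∈ C ×ˢ C, dot constRow (r X) := by
    rw [Finset.mul_sum, Finset.sum_product]
    refine Finset.sum_congr rfl fun x _ => Finset.sum_congr rfl fun y _ => ?_
    rw [linearTerm_eq, ← diffCount_univ]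
  have h5 : ∑ X ∈ C ×ˢ C, dot (r X) constRow = ∑ X ∈ C ×ˢ C, dot constRow (r X) :=
    Finset.sum_congr rfl fun X _ => dot_comm _ _
  rw [h5] at h2
  rw [h3, h4]
  linarith

/-- The inequality coming from the pair kernel. -/
theorem sum_pairKernel {ι : Type} [Fintype ι] [DecidableEq ι] (C : Finset (ι → Bool)) :
    0 ≤ ∑ x ∈ C, ∑ y ∈ C, ∑ z ∈ C, ∑ w ∈ C, onCells pairKernel x y z w :=
  Finset.sum_nonneg fun x _ => Finset.sum_nonneg fun y _ => (isGram_pairKernel x y).sum_nonneg C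

/-! ### The symmetrized kernel -/

section onCells

variable {ι : Type} [Fintype ι] (K : ℕ → ℕ → ℕ → ℕ → ℕ → ℕ → ℕ → ℕ → ℤ) (x y z w : ι → Bool)

theorem cell_swap_zero_one (b₁ b₂ b₃ : Bool) :
    cell y x z w b₁ b₂ b₃ = cell x y z w b₁ (b₁ ^^ b₂) (b₁ ^^ b₃) := by
  unfold cell
  congr 1
  refine Finset.filter_congr fun r _ => ?_
  cases x r <;> cases y r <;> cases z r <;> cases w r <;> cases b₁ <;> cases b₂ <;> cases b₃ <;>
    simp

theorem cell_swap_one_two (b₁ b₂ b₃ : Bool) :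
    cell x z y w b₁ b₂ b₃ = cell x y z w b₂ b₁ b₃ := by
  unfold cell
  congr 1
  exact Finset.filter_congr fun r _ => by tauto

theorem cell_swap_two_three (b₁ b₂ b₃ : Bool) :
    cell x y w z b₁ b₂ b₃ = cell x y z w b₁ b₃ b₂ := by
  unfold cell
  congr 1
  exact Finset.filter_congr fun r _ => by tauto

theorem onCells_swap_zero_one : onCells K y x z w =
    onCells (fun c0 c1 c2 c3 c4 c5 c6 c7 => K c0 c1 c2 c3 c7 c6 c5 c4) x y z w := by
  simp [onCells, cell_swap_zero_one x y z w]

theorem onCells_swap_one_two : onCells K x z y w =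
    onCells (fun c0 c1 c2 c3 c4 c5 c6 c7 => K c0 c1 c4 c5 c2 c3 c6 c7) x y z w := by
  simp only [onCells, cell_swap_one_two x y z w]

theorem onCells_swap_two_three : onCells K x y w z =
    onCells (fun c0 c1 c2 c3 c4 c5 c6 c7 => K c0 c2 c1 c3 c4 c6 c5 c7) x y z w := by
  simp only [onCells, cell_swap_two_three x y z w]

theorem onCells_totalKernel : onCells totalKernel x y z w =
    onCells pairKernel x y z w + onCells pairKernel x z y w + onCells pairKernel x w y z +
    onCells pairKernel y z x w + onCells pairKernel y w x z + onCells pairKernel z w x y +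
    (onCells baseKernel x y z w + onCells baseKernel x z y w + onCells baseKernel x w y z) := by
  have h1 : ∀ K, onCells K x z y w = _ := fun K => onCells_swap_one_two K x y z w
  have h2 : ∀ K, onCells K x w y z = _ := fun K =>
    (onCells_swap_one_two K x y w z).trans (onCells_swap_two_three _ x y z w)
  have h3 : ∀ K, onCells K y z x w = _ := fun K =>
    (onCells_swap_one_two K y x z w).trans (onCells_swap_zero_one _ x y z w)
  have h4 : ∀ K, onCells K y w x z = _ := fun K =>
    ((onCells_swap_one_two K y x w z).trans (onCells_swap_zero_one _ x y w z)).trans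
      (onCells_swap_two_three _ x y z w)
  have h5 : ∀ K, onCells K z w x y = _ := fun K =>
    (((onCells_swap_one_two K z x w y).trans (onCells_swap_zero_one _ x z w y)).trans
      (onCells_swap_two_three _ x z y w)).trans (onCells_swap_one_two _ x y z w)
  rw [h1, h1, h2, h2, h3, h4, h5]
  exact totalKernel_eq _ _ _ _ _ _ _ _

theorem onCells_totalKernel_swap_zero_one :
    onCells totalKernel y x z w = onCells totalKernel x y z w := by
  rw [onCells_swap_zero_one]
  exact totalKernel_swap_zero_one _ _ _ _ _ _ _ _

theorem onCells_totalKernel_swap_one_two :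
    onCells totalKernel x z y w = onCells totalKernel x y z w := by
  rw [onCells_swap_one_two]
  exact totalKernel_swap_one_two _ _ _ _ _ _ _ _

theorem onCells_totalKernel_swap_two_three :
    onCells totalKernel x y w z = onCells totalKernel x y z w := by
  rw [onCells_swap_two_three]
  exact totalKernel_swap_two_three _ _ _ _ _ _ _ _

end onCells

section quadruples

variable {α : Type} (C : Finset α) (f : α → α → α → α → ℤ)

theorem sum_swap_one_two : ∑ x ∈ C, ∑ y ∈ C, ∑ z ∈ C, ∑ w ∈ C, f x z y w =
    ∑ x ∈ C, ∑ y ∈ C, ∑ z ∈ C, ∑ w ∈ C, f x y z w :=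
  Finset.sum_congr rfl fun _ _ => Finset.sum_comm

theorem sum_swap_zero_one : ∑ x ∈ C, ∑ y ∈ C, ∑ z ∈ C, ∑ w ∈ C, f y x z w =
    ∑ x ∈ C, ∑ y ∈ C, ∑ z ∈ C, ∑ w ∈ C, f x y z w := Finset.sum_comm

theorem sum_swap_two_three : ∑ x ∈ C, ∑ y ∈ C, ∑ z ∈ C, ∑ w ∈ C, f x y w z =
    ∑ x ∈ C, ∑ y ∈ C, ∑ z ∈ C, ∑ w ∈ C, f x y z w :=
  Finset.sum_congr rfl fun _ _ => Finset.sum_congr rfl fun _ _ => Finset.sum_comm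

end quadruples

/-- The inequality coming from the symmetrized kernel. -/
theorem sum_totalKernel {ι : Type} [Fintype ι] [DecidableEq ι] (C : Finset (ι → Bool)) :
    0 ≤ ∑ x ∈ C, ∑ y ∈ C, ∑ z ∈ C, ∑ w ∈ C, onCells totalKernel x y z w +
      3 * (2 * ∑ x ∈ C, ∑ y ∈ C, linearTerm (hammingDist x y) +
        4 ^ 19 * dot constRow constRow) := by
  simp_rw [onCells_totalKernel, Finset.sum_add_distrib]
  have h1 := fun K : (ι → Bool) → (ι → Bool) → (ι → Bool) → (ι → Bool) → ℤ =>
    sum_swap_one_two C K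
  have h2 := fun K : (ι → Bool) → (ι → Bool) → (ι → Bool) → (ι → Bool) → ℤ =>
    (sum_swap_two_three C fun x y z w => K x z y w).trans (sum_swap_one_two C K)
  have h3 := fun K : (ι → Bool) → (ι → Bool) → (ι → Bool) → (ι → Bool) → ℤ =>
    (sum_swap_zero_one C fun x y z w => K x z y w).trans (sum_swap_one_two C K)
  have h4 := fun K : (ι → Bool) → (ι → Bool) → (ι → Bool) → (ι → Bool) → ℤ =>
    (sum_swap_two_three C fun x y z w => K y z x w).trans (h3 K)
  have h5 := fun K : (ι → Bool) → (ι → Bool) → (ι → Bool) → (ι → Bool) → ℤ =>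
    (sum_swap_one_two C fun x y z w => K y w x z).trans (h4 K)
  linarith only [sum_pairKernel C, sum_baseKernel C, h1 (onCells pairKernel),
    h1 (onCells baseKernel), h2 (onCells pairKernel), h2 (onCells baseKernel),
    h3 (onCells pairKernel), h4 (onCells pairKernel), h5 (onCells pairKernel)]

/-! ### Splitting sums over quadruples -/

section split

variable {α : Type} [DecidableEq α]

theorem sum_erase_comm (E : Finset α) (h : α → α → ℤ) :
    ∑ x ∈ E, ∑ y ∈ E.erase x, h y x = ∑ x ∈ E, ∑ y ∈ E.erase x, h x y :=
  Finset.sum_comm' fun x y => by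
    simp only [Finset.mem_erase]
    tauto

/-- A sum over pairs of distinct elements. -/
def pairSum (C : Finset α) (f : α → α → ℤ) : ℤ := ∑ x ∈ C, ∑ y ∈ C.erase x, f x y

/-- A sum over triples of distinct elements. -/
def tripleSum (C : Finset α) (f : α → α → α → ℤ) : ℤ :=
  ∑ x ∈ C, ∑ y ∈ C.erase x, ∑ z ∈ (C.erase x).erase y, f x y z

/-- A sum over quadruples of distinct elements. -/
def quadSum (C : Finset α) (f : α → α → α → α → ℤ) : ℤ :=
  ∑ x ∈ C, ∑ y ∈ C.erase x, ∑ z ∈ (C.erase x).erase y,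
    ∑ w ∈ ((C.erase x).erase y).erase z, f x y z w

theorem tripleSum_swap_zero_one (C : Finset α) (f : α → α → α → ℤ) :
    tripleSum C (fun x y z => f y x z) = tripleSum C f := by
  unfold tripleSum
  rw [← sum_erase_comm C fun x y => ∑ z ∈ (C.erase x).erase y, f x y z]
  refine Finset.sum_congr rfl fun x _ => Finset.sum_congr rfl fun y _ => ?_
  rw [Finset.erase_right_comm]

theorem tripleSum_swap_one_two (C : Finset α) (f : α → α → α → ℤ) :
    tripleSum C (fun x y z => f x z y) = tripleSum C f :=
  Finset.sum_congr rfl fun x _ => sum_erase_comm (C.erase x) fun y z => f x y z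

theorem sum_quadruples (C : Finset α) (f : α → α → α → α → ℤ)
    (h01 : ∀ x y z w, f y x z w = f x y z w)
    (h12 : ∀ x y z w, f x z y w = f x y z w) (h23 : ∀ x y z w, f x y w z = f x y z w) :
    ∑ x ∈ C, ∑ y ∈ C, ∑ z ∈ C, ∑ w ∈ C, f x y z w = ∑ x ∈ C, f x x x x +
      pairSum C (fun x y => 4 * f x x x y + 3 * f x x y y) +
      2 * tripleSum C (fun x y z => f x x y z + f y y x z + f z z x y) + quadSum C f := by
  have s1 : ∀ {x}, x ∈ C → ∀ h : α → ℤ, ∑ y ∈ C, h y = h x + ∑ y ∈ C.erase x, h y :=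
    fun hx h => (Finset.add_sum_erase C h hx).symm
  have s2 : ∀ {x}, x ∈ C → ∀ {y}, y ∈ C.erase x → ∀ h : α → ℤ,
      ∑ z ∈ C, h z = h x + h y + ∑ z ∈ (C.erase x).erase y, h z := fun hx y hy h => by
    rw [s1 hx, ← Finset.add_sum_erase _ h hy, add_assoc]
  have s3 : ∀ {x}, x ∈ C → ∀ {y}, y ∈ C.erase x → ∀ {z}, z ∈ (C.erase x).erase y → ∀ h : α → ℤ,
      ∑ w ∈ C, h w = h x + h y + h z + ∑ w ∈ ((C.erase x).erase y).erase z, h w :=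
    fun hx y hy z hz h => by
    rw [s2 hx hy, ← Finset.add_sum_erase _ h hz, ← add_assoc]
  have hx : ∀ x ∈ C, ∑ y ∈ C, ∑ z ∈ C, ∑ w ∈ C, f x y z w = f x x x x +
      ∑ y ∈ C.erase x, (3 * f x x x y + 3 * f x x y y + f y y y x +
        ∑ z ∈ (C.erase x).erase y, (3 * f x x y z + 2 * f y y x z + f z z x y +
          ∑ w ∈ ((C.erase x).erase y).erase z, f x y z w)) := by
    intro x hx
    have e1 : ∀ y ∈ C.erase x, ∑ z ∈ C, ∑ w ∈ C, f x y z w = f x x x y + 2 * f x x y y +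
        f y y y x + ∑ z ∈ (C.erase x).erase y, (2 * f x x y z + 2 * f y y x z +
          f z z x y + ∑ w ∈ ((C.erase x).erase y).erase z, f x y z w) := by
      intro y hy
      have e2 : ∑ z ∈ (C.erase x).erase y, ∑ w ∈ C, f x y z w = ∑ z ∈ (C.erase x).erase y,
          (f x x y z + f y y x z + f z z x y +
            ∑ w ∈ ((C.erase x).erase y).erase z, f x y z w) := by
        refine Finset.sum_congr rfl fun z hz => ?_
        rw [s3 hx hy hz, h23 x y x z, h12 x x y z, h23 x y y z, h01 y x y z, h12 y y x z,
          h12 x z y z, h01 z x y z, h23 z x z y, h12 z z x y]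
      rw [s2 hx hy, s2 hx hy (f x y x), s2 hx hy (f x y y), e2,
        Finset.sum_congr rfl fun z _ => h12 x x y z,
        Finset.sum_congr rfl fun z _ => (h01 y x y z).trans (h12 y y x z),
        h12 x x y x, h23 x x x y, h23 x y x y, h12 x x y y, h01 y x y y, h12 y y x y, h23 y y y x]
      simp only [Finset.sum_add_distrib, ← Finset.mul_sum]
      ring
    have e3 : ∑ z ∈ C, ∑ w ∈ C, f x x z w = ∑ w ∈ C, f x x x w + ∑ y ∈ C.erase x,
        (f x x x y + f x x y y + ∑ z ∈ (C.erase x).erase y, f x x y z) := by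
      rw [s1 hx]
      refine congrArg _ (Finset.sum_congr rfl fun y hy => ?_)
      rw [s2 hx hy, h23 x x x y]
    rw [s1 hx, e3, s1 hx, Finset.sum_congr rfl e1]
    simp only [Finset.sum_add_distrib, ← Finset.mul_sum]
    ring
  rw [Finset.sum_congr rfl hx, Finset.sum_add_distrib]
  have e1 := sum_erase_comm C fun x y => f x x x y
  have e2 : tripleSum C (fun x y z => f y y x z) = tripleSum C fun x y z => f x x y z :=
    tripleSum_swap_zero_one C fun x y z => f x x y z
  have e3 : tripleSum C (fun x y z => f z z x y) = tripleSum C fun x y z => f x x y z := by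
    rw [← e2, ← tripleSum_swap_one_two]
  simp only [pairSum, tripleSum, quadSum, Finset.sum_add_distrib, ← Finset.mul_sum] at *
  linarith

end split

/-! ### Distances and cells -/

section distances

variable {ι : Type} [Fintype ι] (x y z w : ι → Bool)

theorem card_filter_eq_sum_cell (φ : Bool → Bool → Bool → Bool) :
    (Finset.univ.filter fun r => φ (x r ^^ y r) (x r ^^ z r) (x r ^^ w r) = true).card =
      ∑ b : Bool × Bool × Bool, bif φ b.1 b.2.1 b.2.2 then cell x y z w b.1 b.2.1 b.2.2 else 0 := by
  rw [Finset.card_eq_sum_card_fiberwise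
    (f := fun r => ((x r ^^ y r), (x r ^^ z r), (x r ^^ w r))) (t := Finset.univ) (by simp)]
  refine Finset.sum_congr rfl fun b _ => ?_
  rw [Finset.filter_filter]
  obtain ⟨b₁, b₂, b₃⟩ := b
  unfold cell
  cases h : φ b₁ b₂ b₃
  · simp only [Prod.mk.injEq, cond_false, Finset.card_eq_zero, Finset.filter_eq_empty_iff]
    rintro r _ ⟨h', rfl, rfl, rfl⟩
    simp [h] at h'
  · rw [cond_true]
    congr 1
    refine Finset.filter_congr fun r _ => ?_
    constructor
    · rintro ⟨_, h'⟩
      simpa using h'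
    · rintro ⟨rfl, rfl, rfl⟩
      exact ⟨h, rfl⟩

theorem exists_cells : ∃ c0 c1 c2 c3 c4 c5 c6 c7 : ℕ,
    (∀ K, onCells K x y z w = K c0 c1 c2 c3 c4 c5 c6 c7) ∧
    c0 + c1 + c2 + c3 + c4 + c5 + c6 + c7 = Fintype.card ι ∧
    hammingDist x y = c4 + c5 + c6 + c7 ∧ hammingDist x z = c2 + c3 + c6 + c7 ∧
    hammingDist x w = c1 + c3 + c5 + c7 ∧ hammingDist y z = c2 + c3 + c4 + c5 ∧
    hammingDist y w = c1 + c3 + c4 + c6 ∧ hammingDist z w = c1 + c2 + c5 + c6 := by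
  have key (φ : Bool → Bool → Bool → Bool) {p : ι → Prop} [DecidablePred p]
      (h : ∀ r, p r ↔ φ (x r ^^ y r) (x r ^^ z r) (x r ^^ w r) = true) :
      (Finset.univ.filter p).card =
      ∑ b : Bool × Bool × Bool, bif φ b.1 b.2.1 b.2.2 then cell x y z w b.1 b.2.1 b.2.2 else 0 := by
    rw [← card_filter_eq_sum_cell]
    exact congrArg _ (Finset.filter_congr fun r _ => h r)
  refine ⟨_, _, _, _, _, _, _, _, fun _ => rfl, ?_, ?_, ?_, ?_, ?_, ?_, ?_⟩
  · have h := key (fun _ _ _ => true) (p := fun _ => True) fun _ => by simp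
    simp only [Finset.filter_true, Finset.card_univ, Fintype.sum_prod_type, Fintype.sum_bool,
      cond_true] at h
    omega
  · have h := key (fun a _ _ => a) (p := fun r => x r ≠ y r) fun r => by simp
    simp only [Fintype.sum_prod_type, Fintype.sum_bool, cond_true, cond_false] at h
    unfold hammingDist
    omega
  · have h := key (fun _ a _ => a) (p := fun r => x r ≠ z r) fun r => by simp
    simp only [Fintype.sum_prod_type, Fintype.sum_bool, cond_true, cond_false] at h
    unfold hammingDist
    omega
  · have h := key (fun _ _ a => a) (p := fun r => x r ≠ w r) fun r => by simp
    simp only [Fintype.sum_prod_type, Fintype.sum_bool, cond_true, cond_false] at h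
    unfold hammingDist
    omega
  · have h := key (fun a b _ => a ^^ b) (p := fun r => y r ≠ z r) fun r => by
      cases x r <;> cases y r <;> cases z r <;> decide
    simp only [Fintype.sum_prod_type, Fintype.sum_bool, Bool.xor_false,
      Bool.xor_true, Bool.not_true, Bool.not_false, cond_true, cond_false] at h
    unfold hammingDist
    omega
  · have h := key (fun a _ b => a ^^ b) (p := fun r => y r ≠ w r) fun r => by
      cases x r <;> cases y r <;> cases w r <;> decide
    simp only [Fintype.sum_prod_type, Fintype.sum_bool, Bool.xor_false,
      Bool.xor_true, Bool.not_true, Bool.not_false, cond_true, cond_false] at h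
    unfold hammingDist
    omega
  · have h := key (fun _ a b => a ^^ b) (p := fun r => z r ≠ w r) fun r => by
      cases x r <;> cases z r <;> cases w r <;> decide
    simp only [Fintype.sum_prod_type, Fintype.sum_bool, Bool.xor_false,
      Bool.xor_true, Bool.not_true, Bool.not_false, cond_true, cond_false] at h
    unfold hammingDist
    omega

end distances

/-! ### Nonpositivity of the kernel -/

theorem lexB_eq (a b c d : ℕ) : lexB a b c d = true ↔ a < b ∨ a ≤ b ∧ c ≤ d := by
  have h1 : Nat.ble (Nat.succ a) b = true ↔ a < b := Nat.ble_eq.to_iff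
  have h2 : Nat.ble a b = true ↔ a ≤ b := Nat.ble_eq.to_iff
  have h3 : Nat.ble c d = true ↔ c ≤ d := Nat.ble_eq.to_iff
  rw [← h1, ← h2, ← h3]
  unfold lexB
  cases Nat.ble (Nat.succ a) b <;> cases Nat.ble a b <;> cases Nat.ble c d <;> decide

theorem triB_eq (a b c : ℕ) :
    triB a b c = true ↔ a ≤ b + c ∧ b ≤ a + c ∧ c ≤ a + b ∧ a + (b + c) ≤ 38 := by
  have h1 : Nat.ble a (Nat.add b c) = true ↔ a ≤ b + c := Nat.ble_eq.to_iff
  have h2 : Nat.ble b (Nat.add a c) = true ↔ b ≤ a + c := Nat.ble_eq.to_iff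
  have h3 : Nat.ble c (Nat.add a b) = true ↔ c ≤ a + b := Nat.ble_eq.to_iff
  have h4 : Nat.ble (Nat.add a (Nat.add b c)) 38 = true ↔ a + (b + c) ≤ 38 := Nat.ble_eq.to_iff
  rw [← h1, ← h2, ← h3, ← h4]
  unfold triB
  cases Nat.ble a (Nat.add b c) <;> cases Nat.ble b (Nat.add a c) <;>
    cases Nat.ble c (Nat.add a b) <;> cases Nat.ble (Nat.add a (Nat.add b c)) 38 <;> decide

theorem le_of_mem_dists {d : ℕ} (h : d ∈ dists) : d ≤ 18 := by
  revert d
  decide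

section nonpos

variable (x y z w : Fin 19 → Bool)

theorem totalKernel_nonpos_congr {a0 a1 a2 a3 a4 a5 a6 a7 b0 b1 b2 b3 b4 b5 b6 b7 : ℕ}
    (h0 : a0 = b0) (h1 : a1 = b1) (h2 : a2 = b2) (h3 : a3 = b3) (h4 : a4 = b4)
    (h5 : a5 = b5) (h6 : a6 = b6) (h7 : a7 = b7)
    (h : totalKernel a0 a1 a2 a3 a4 a5 a6 a7 ≤ 0) : totalKernel b0 b1 b2 b3 b4 b5 b6 b7 ≤ 0 := by
  subst h0 h1 h2 h3 h4 h5 h6 h7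
  exact h

theorem totalKernel_of_quadCheck (h : quadCheck (hammingDist x y) (hammingDist x z)
    (hammingDist y z) (hammingDist x w) (hammingDist y w) (hammingDist z w) = true) :
    onCells totalKernel x y z w ≤ 0 := by
  obtain ⟨c0, c1, c2, c3, c4, c5, c6, c7, hK, h0, h1, h2, h3, h4, h5, h6⟩ := exists_cells x y z w
  rw [Fintype.card_fin] at h0
  have e1 : (hammingDist x y + hammingDist x z - hammingDist y z) / 2 = c6 + c7 := by omega
  have e2 : (hammingDist x y + hammingDist x w - hammingDist y w) / 2 = c5 + c7 := by omega
  have e3 : (hammingDist x z + hammingDist x w - hammingDist z w) / 2 = c3 + c7 := by omega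
  simp only [quadCheck, forceNat_eq, Nat.add_eq, Nat.sub_eq, natDiv_eq, e1, e2, e3, allB_eq,
    impB_eq, Nat.ble_eq, nonposB_eq] at h
  have h7 : c7 ∈ [0, 1, 2, 3, 4, 5, 6, 7, 8, 9, 10, 11, 12, 13, 14, 15, 16, 17, 18, 19] := by
    have : c7 < 20 := by omega
    revert this
    generalize c7 = n
    revert n
    decide
  have h := h c7 h7 (by omega) (by omega) (by omega) (by omega) (by omega) (by omega) (by omega)
  rw [hK]
  exact totalKernel_nonpos_congr (by omega) (by omega) (by omega) (by omega) (by omega)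
    (by omega) (by omega) rfl h

theorem triB_hammingDist : triB (hammingDist x y) (hammingDist x z) (hammingDist y z) = true := by
  obtain ⟨c0, c1, c2, c3, c4, c5, c6, c7, -, h0, h1, h2, -, h4, -, -⟩ := exists_cells x y z z
  rw [Fintype.card_fin] at h0
  rw [triB_eq]
  omega

theorem totalKernel_quadruple (hc : quadCheckAll = true) (h01 : hammingDist x y ∈ dists)
    (h02 : hammingDist x z ∈ dists) (h03 : hammingDist x w ∈ dists) (h12 : hammingDist y z ∈ dists)
    (h13 : hammingDist y w ∈ dists) (h23 : hammingDist z w ∈ dists) :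
    onCells totalKernel x y z w ≤ 0 := by
  simp only [quadCheckAll, allB_eq, impB_eq, Nat.ble_eq, lexB_eq] at hc
  obtain ⟨n, hn⟩ : ∃ n, ((((hammingDist x y * 32 + hammingDist x z) * 32 + hammingDist y z) * 32 +
    hammingDist x w) * 32 + hammingDist y w) * 32 + hammingDist z w = n := ⟨_, rfl⟩
  induction n using Nat.strong_induction_on generalizing x y z w with
  | _ n ih =>
    have b01 := le_of_mem_dists h01
    have b02 := le_of_mem_dists h02
    have b03 := le_of_mem_dists h03
    have b12 := le_of_mem_dists h12
    have b13 := le_of_mem_dists h13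
    have b23 := le_of_mem_dists h23
    have c10 := hammingDist_comm y x
    have c21 := hammingDist_comm z y
    have c32 := hammingDist_comm w z
    rcases lt_or_ge (((((hammingDist x y * 32 + hammingDist y z) * 32 + hammingDist x z) * 32 +
      hammingDist y w) * 32 + hammingDist x w) * 32 + hammingDist z w) n with h | g01
    · rw [← onCells_totalKernel_swap_zero_one]
      exact ih _ h y x z w (c10 ▸ h01) h12 h13 h02 h03 h23 (by rw [c10])
    rcases lt_or_ge (((((hammingDist x z * 32 + hammingDist x y) * 32 + hammingDist y z) * 32 +
      hammingDist x w) * 32 + hammingDist z w) * 32 + hammingDist y w) n with h | g12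
    · rw [← onCells_totalKernel_swap_one_two]
      exact ih _ h x z y w h02 h01 h03 (c21 ▸ h12) h23 h13 (by rw [c21])
    rcases lt_or_ge (((((hammingDist x y * 32 + hammingDist x w) * 32 + hammingDist y w) * 32 +
      hammingDist x z) * 32 + hammingDist y z) * 32 + hammingDist z w) n with h | g23
    · rw [← onCells_totalKernel_swap_two_three]
      exact ih _ h x y w z h01 h03 h02 h13 h12 (c32 ▸ h23) (by rw [c32])
    exact totalKernel_of_quadCheck x y z w (hc _ h01 _ h02 (by omega) _ h12 (by omega)
      (triB_hammingDist x y z) _ h03 _ h13 (by omega) (by omega) (triB_hammingDist x y w) _ h23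
      (by omega) (triB_hammingDist x z w) (triB_hammingDist y z w))

theorem totalKernel_diagonal (hc : nonposB (totalKernel 19 0 0 0 0 0 0 0) = true) :
    onCells totalKernel x x x x ≤ 0 := by
  obtain ⟨c0, c1, c2, c3, c4, c5, c6, c7, hK, h0, h1, h2, h3, h4, h5, h6⟩ := exists_cells x x x x
  rw [Fintype.card_fin] at h0
  rw [hammingDist_self] at h1 h2 h3 h4 h5 h6
  rw [hK]
  convert (nonposB_eq _).mp hc using 1
  congr 1 <;> omega

theorem totalKernel_pair (hc : allB pairCheck dists = true) (h : hammingDist x y ∈ dists) :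
    4 * onCells totalKernel x x x y + 3 * onCells totalKernel x x y y +
      (6 * linearTerm (hammingDist x y) + 4 ^ 45) ≤ 0 := by
  simp only [allB_eq, pairCheck, forceNat_eq, nonposB_eq, iadd_eq, imul_eq] at hc
  have h' := hc _ h
  have e1 : onCells totalKernel x x x y =
      totalKernel (19 - hammingDist x y) (hammingDist x y) 0 0 0 0 0 0 := by
    obtain ⟨c0, c1, c2, c3, c4, c5, c6, c7, hK, h0, h1, h2, h3, h4, h5, h6⟩ := exists_cells x x x y
    rw [Fintype.card_fin] at h0
    rw [hammingDist_self] at h1 h2 h4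
    rw [hK]
    congr 1 <;> omega
  have e2 : onCells totalKernel x x y y =
      totalKernel (19 - hammingDist x y) 0 0 (hammingDist x y) 0 0 0 0 := by
    obtain ⟨c0, c1, c2, c3, c4, c5, c6, c7, hK, h0, h1, h2, h3, h4, h5, h6⟩ := exists_cells x x y y
    rw [Fintype.card_fin] at h0
    rw [hammingDist_self] at h1 h6
    rw [hK]
    congr 1 <;> omega
  rw [e1, e2]
  exact h'

theorem onCells_eq_tripleKernel : onCells totalKernel x x y z =
    tripleKernel (hammingDist x y) (hammingDist x z) (hammingDist y z) := by
  obtain ⟨c0, c1, c2, c3, c4, c5, c6, c7, hK, h0, h1, h2, h3, h4, h5, h6⟩ := exists_cells x x y z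
  rw [Fintype.card_fin] at h0
  rw [hammingDist_self] at h1
  have e1 : (hammingDist x y + hammingDist x z - hammingDist y z) / 2 = c3 := by omega
  simp only [tripleKernel, forceNat_eq, Nat.add_eq, Nat.sub_eq, natDiv_eq, e1]
  rw [hK]
  congr 1 <;> omega

theorem totalKernel_triple (hc : tripleCheckAll = true) (h01 : hammingDist x y ∈ dists)
    (h02 : hammingDist x z ∈ dists) (h12 : hammingDist y z ∈ dists) :
    onCells totalKernel x x y z + onCells totalKernel y y x z +
      onCells totalKernel z z x y ≤ 0 := by
  simp only [tripleCheckAll, allB_eq, impB_eq, Nat.ble_eq, nonposB_eq, iadd_eq] at hc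
  have sorted (x y z : Fin 19 → Bool) (h01 : hammingDist x y ∈ dists)
      (h02 : hammingDist x z ∈ dists) (h12 : hammingDist y z ∈ dists)
      (h : hammingDist x y ≤ hammingDist x z ∧ hammingDist x z ≤ hammingDist y z) :
      onCells totalKernel x x y z + onCells totalKernel y y x z +
        onCells totalKernel z z x y ≤ 0 := by
    rw [onCells_eq_tripleKernel, onCells_eq_tripleKernel y, onCells_eq_tripleKernel z,
      hammingDist_comm y x, hammingDist_comm z x, hammingDist_comm z y, add_assoc]
    exact hc _ h01 _ h02 h.1 _ h12 h.2 (triB_hammingDist x y z)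
  have c10 := hammingDist_comm y x
  have c20 := hammingDist_comm z x
  have c21 := hammingDist_comm z y
  have s0 := onCells_totalKernel_swap_two_three x x y z
  have s1 := onCells_totalKernel_swap_two_three y y x z
  have s2 := onCells_totalKernel_swap_two_three z z x y
  have h10 := c10 ▸ h01
  have h20 := c20 ▸ h02
  have h21 := c21 ▸ h12
  have p1 := sorted x y z h01 h02 h12
  have p2 := sorted x z y h02 h01 h21
  have p3 := sorted y x z h10 h12 h02
  have p4 := sorted y z x h12 h10 h20
  have p5 := sorted z x y h20 h21 h01
  have p6 := sorted z y x h21 h20 h10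
  omega

end nonpos

/-! ### Codes with even distances -/

theorem linearTerm_zero : linearTerm 0 = 0 := by decide +kernel

theorem sum_linearTerm (C : Finset (Fin 19 → Bool)) :
    ∑ x ∈ C, ∑ y ∈ C, linearTerm (hammingDist x y) =
      ∑ x ∈ C, ∑ y ∈ C.erase x, linearTerm (hammingDist x y) :=
  Finset.sum_congr rfl fun x hx => by
    rw [← Finset.add_sum_erase C _ hx, hammingDist_self, linearTerm_zero, zero_add]

theorem card_ne_of_dists (h4 : quadCheckAll = true) (h3 : tripleCheckAll = true)
    (h2 : allB pairCheck dists = true) (h1 : nonposB (totalKernel 19 0 0 0 0 0 0 0) = true)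
    (h0 : constCheck = true) (C : Finset (Fin 19 → Bool))
    (hC : ∀ u ∈ C, ∀ v ∈ C, u ≠ v → hammingDist u v ∈ dists) : C.card ≠ 136 := by
  intro hcard
  have s := sum_totalKernel C
  rw [sum_quadruples C (onCells totalKernel) onCells_totalKernel_swap_zero_one
    onCells_totalKernel_swap_one_two onCells_totalKernel_swap_two_three, sum_linearTerm] at s
  have s1 : ∑ x ∈ C, onCells totalKernel x x x x ≤ 0 :=
    Finset.sum_nonpos fun x _ => totalKernel_diagonal x h1
  have s3 : tripleSum C (fun x y z => onCells totalKernel x x y z + onCells totalKernel y y x z +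
      onCells totalKernel z z x y) ≤ 0 := by
    refine Finset.sum_nonpos fun x hx => Finset.sum_nonpos fun y hy =>
      Finset.sum_nonpos fun z hz => ?_
    simp only [Finset.mem_erase] at hy hz
    exact totalKernel_triple x y z h3 (hC x hx y hy.2 hy.1.symm) (hC x hx z hz.2.2 hz.2.1.symm)
      (hC y hy.2 z hz.2.2 hz.1.symm)
  have s4 : quadSum C (onCells totalKernel) ≤ 0 := by
    refine Finset.sum_nonpos fun x hx => Finset.sum_nonpos fun y hy =>
      Finset.sum_nonpos fun z hz => Finset.sum_nonpos fun w hw => ?_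
    simp only [Finset.mem_erase] at hy hz hw
    exact totalKernel_quadruple x y z w h4 (hC x hx y hy.2 hy.1.symm)
      (hC x hx z hz.2.2 hz.2.1.symm) (hC x hx w hw.2.2.2 hw.2.2.1.symm)
      (hC y hy.2 z hz.2.2 hz.1.symm) (hC y hy.2 w hw.2.2.2 hw.2.1.symm)
      (hC z hz.2.2 w hw.2.2.2 hw.1.symm)
  have s2 : ∑ x ∈ C, ∑ y ∈ C.erase x, (4 * onCells totalKernel x x x y +
      3 * onCells totalKernel x x y y + (6 * linearTerm (hammingDist x y) + 4 ^ 45)) ≤ 0 := by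
    refine Finset.sum_nonpos fun x hx => Finset.sum_nonpos fun y hy => ?_
    simp only [Finset.mem_erase] at hy
    exact totalKernel_pair x y h2 (hC x hx y hy.2 hy.1.symm)
  have e : ∑ x ∈ C, ∑ y ∈ C.erase x, (4 : ℤ) ^ 45 = 18360 * 4 ^ 45 := by
    rw [Finset.sum_congr rfl fun x hx => by
      rw [Finset.sum_const, Finset.card_erase_of_mem hx, hcard], Finset.sum_const, hcard]
    norm_num
  simp only [Finset.sum_add_distrib, e, ← Finset.mul_sum] at s2
  simp only [constCheck, nonposB_eq, iadd_eq, imul_eq] at h0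
  have h0' : 1 + (3 * (4 ^ 19 * dot constRow constRow) + -18360 * 4 ^ 45) ≤ 0 := h0
  simp only [pairSum, Finset.sum_add_distrib, ← Finset.mul_sum] at s
  linarith

/-! ### Reduction to even distances -/

section parity

/-- The number of letters `true`. -/
def weight {n : ℕ} (u : Fin n → Bool) : ℕ := ∑ i, (u i).toNat

theorem hammingDist_eq_sum {n : ℕ} (u v : Fin n → Bool) :
    hammingDist u v = ∑ i, (u i ^^ v i).toNat := by
  unfold hammingDist
  rw [Finset.card_filter]
  refine Finset.sum_congr rfl fun i _ => ?_
  cases u i <;> cases v i <;> simp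

theorem weight_add_weight {n : ℕ} (u v : Fin n → Bool) :
    weight u + weight v = hammingDist u v + 2 * ∑ i, (u i && v i).toNat := by
  rw [hammingDist_eq_sum, Finset.mul_sum, ← Finset.sum_add_distrib, weight, weight,
    ← Finset.sum_add_distrib]
  refine Finset.sum_congr rfl fun i _ => ?_
  cases u i <;> cases v i <;> decide

/-- Replace the last letter by the parity of the other ones. -/
def evenWord {n : ℕ} (u : Fin (n + 1) → Bool) : Fin (n + 1) → Bool :=
  Fin.snoc (α := fun _ => Bool) (Fin.init u) (decide (weight (Fin.init u) % 2 = 1))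

theorem hammingDist_eq_init {n : ℕ} (u v : Fin (n + 1) → Bool) :
    hammingDist u v = hammingDist (Fin.init u) (Fin.init v) +
      (u (Fin.last n) ^^ v (Fin.last n)).toNat := by
  rw [hammingDist_eq_sum, hammingDist_eq_sum, Fin.sum_univ_castSucc]
  rfl

theorem hammingDist_evenWord {n : ℕ} (u v : Fin (n + 1) → Bool) :
    hammingDist (evenWord u) (evenWord v) % 2 = 0 ∧
      hammingDist u v ≤ hammingDist (evenWord u) (evenWord v) + 1 := by
  have h := weight_add_weight (Fin.init u) (Fin.init v)
  have hx (b c : Bool) : (b ^^ c).toNat ≤ 1 := by cases b <;> cases c <;> decide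
  rw [hammingDist_eq_init u, hammingDist_eq_init (evenWord u)]
  have := hx (u (Fin.last n)) (v (Fin.last n))
  simp only [evenWord, Fin.init_snoc, Fin.snoc_last]
  refine ⟨?_, by omega⟩
  rcases Nat.mod_two_eq_zero_or_one (weight (Fin.init u)) with hu | hu <;>
  rcases Nat.mod_two_eq_zero_or_one (weight (Fin.init v)) with hv | hv <;>
  simp [hu, hv] <;> omega

theorem evenWord_dists {u v : Fin 19 → Bool} (h : 8 ≤ hammingDist u v) :
    hammingDist (evenWord u) (evenWord v) ∈ dists := by
  obtain ⟨h1, h2⟩ := hammingDist_evenWord u v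
  have h3 : hammingDist (evenWord u) (evenWord v) ≤ 19 := hammingDist_le_card_fintype
  simp only [dists, List.mem_cons, List.not_mem_nil, or_false]
  omega

end parity

theorem card_le_of_checks (h4 : quadCheckAll = true) (h3 : tripleCheckAll = true)
    (h2 : allB pairCheck dists = true) (h1 : nonposB (totalKernel 19 0 0 0 0 0 0 0) = true)
    (h0 : constCheck = true) (C : Finset (Fin 19 → Bool))
    (hC : ∀ u ∈ C, ∀ v ∈ C, u ≠ v → 8 ≤ hammingDist u v) : C.card ≤ 135 := by
  by_contra! h
  have inj : Set.InjOn evenWord (C : Set (Fin 19 → Bool)) := fun u hu v hv huv => by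
    by_contra hne
    have h := evenWord_dists (hC u hu v hv hne)
    rw [huv, hammingDist_self] at h
    revert h
    decide
  obtain ⟨D, hD, hcard⟩ := Finset.exists_subset_card_eq (s := C.image evenWord) (n := 136)
    (by rw [Finset.card_image_of_injOn inj]; exact h)
  refine card_ne_of_dists h4 h3 h2 h1 h0 D (fun u hu v hv huv => ?_) hcard
  obtain ⟨u, hu', rfl⟩ := Finset.mem_image.mp (hD hu)
  obtain ⟨v, hv', rfl⟩ := Finset.mem_image.mp (hD hv)
  exact evenWord_dists (hC u hu' v hv' fun h => huv (h ▸ rfl))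

/-! ### Evaluation of the certificate -/

theorem diagonalCheck_eq : nonposB (totalKernel 19 0 0 0 0 0 0 0) = true := by decide +kernel

theorem constCheck_eq : constCheck = true := by decide +kernel

theorem pairCheckAll_eq : allB pairCheck dists = true := by decide +kernel

theorem tripleCheckAll_eq : tripleCheckAll = true := by decide +kernel

theorem quadCheckAll_eq : quadCheckAll = true := by decide +kernel

end CodeBound

/-- `A(19,8) ≤ 135`: every binary code of length 19 in which any two distinct
codewords have Hamming distance at least 8 has at most 135 codewords. -/
theorem A_19_8_le_135 (C : Finset (Fin 19 → Bool))
    (hC : ∀ u ∈ C, ∀ v ∈ C, u ≠ v → 8 ≤ hammingDist u v) :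
    C.card ≤ 135 := by
  exact CodeBound.card_le_of_checks CodeBound.quadCheckAll_eq CodeBound.tripleCheckAll_eq
    CodeBound.pairCheckAll_eq CodeBound.diagonalCheck_eq CodeBound.constCheck_eq C hC
end

section
/- Let d ≥ 2 be even and n a positive integer. Then the supremum defining A_4(n,d) does not change if the functions x are additionally required to satisfy x(S) = 0 whenever S contains a word of odd weight. That is, the supremum of ∑_{v∈N} x({v}) over feasible x : 𝒩_4 → ℝ equals the supremum of ∑_{v∈N} x({v}) over feasible x that vanish on every S ∈ 𝒩_4 not contained in the set E of even-weight words. -/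
open scoped Classical

noncomputable section

/-- `S` is a code of minimum distance at least `d`. -/
def IsCode (n d : ℕ) (S : Finset (Fin n → Bool)) : Prop :=
  ∀ u ∈ S, ∀ v ∈ S, u ≠ v → d ≤ hammingDist u v

/-- The collection `𝒩_4` of codes of minimum distance at least `d` and size at most `4`. -/
def NN4 (n d : ℕ) : Set (Finset (Fin n → Bool)) :=
  {S | IsCode n d S ∧ S.card ≤ 4}

/-- The index set `𝒩(S)` of the matrix `M_S(x)` (for `k = 4`). -/
abbrev NSet (n d : ℕ) (S : Finset (Fin n → Bool)) :=
  {S' : Finset (Fin n → Bool) //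
    IsCode n d S' ∧ S ⊆ S' ∧ S.card + 2 * (S' \ S).card ≤ 4}

/-- The matrix `M_S(x)`. -/
def MS (n d : ℕ) (S : Finset (Fin n → Bool)) (x : Finset (Fin n → Bool) → ℝ) :
    Matrix (NSet n d S) (NSet n d S) ℝ :=
  fun S' S'' => if IsCode n d (S'.1 ∪ S''.1) then x (S'.1 ∪ S''.1) else 0

/-- Feasibility for the semidefinite program defining `A_4(n,d)`. -/
def Feasible (n d : ℕ) (x : Finset (Fin n → Bool) → ℝ) : Prop :=
  x ∅ = 1 ∧ ∀ S ∈ NN4 n d, (MS n d S x).PosSemidef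

/-- The objective value `∑_{v ∈ N} x({v})`. -/
def Obj (n : ℕ) (x : Finset (Fin n → Bool) → ℝ) : ℝ :=
  ∑ v : Fin n → Bool, x {v}

/-- A word has even weight if its number of `1`s is even. -/
def EvenWeight {n : ℕ} (v : Fin n → Bool) : Prop :=
  Even (Finset.univ.filter (fun i => v i = true)).card

/-- The sum of `x` over the codes that `f` maps onto `S`. -/
def pushforward (n d : ℕ) (f : (Fin n → Bool) → (Fin n → Bool))
    (x : Finset (Fin n → Bool) → ℝ) (S : Finset (Fin n → Bool)) : ℝ :=
  ∑ T with IsCode n d T ∧ T.image f = S, x T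

/-- `f` maps words at distance at least `d` to words at distance at least `d`. -/
def PreservesFar (n d : ℕ) (f : (Fin n → Bool) → (Fin n → Bool)) : Prop :=
  ∀ u v, d ≤ hammingDist u v → d ≤ hammingDist (f u) (f v)

section Pushforward

variable {n d : ℕ} {f : (Fin n → Bool) → (Fin n → Bool)}

theorem IsCode.mono {S T : Finset (Fin n → Bool)} (hT : IsCode n d T) (h : S ⊆ T) :
    IsCode n d S :=
  fun u hu v hv => hT u (h hu) v (h hv)

theorem IsCode.singleton (w : Fin n → Bool) : IsCode n d {w} := by
  intro u hu v hv huv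
  rw [Finset.mem_singleton] at hu hv
  exact absurd (hu.trans hv.symm) huv

theorem IsCode.injOn {T : Finset (Fin n → Bool)} (hT : IsCode n d T) (hd : 0 < d)
    (hf : PreservesFar n d f) : Set.InjOn f T := by
  intro u hu v hv huv
  by_contra hne
  have h := hf u v (hT u hu v hv hne)
  rw [huv, hammingDist_self] at h
  omega

theorem IsCode.image {T : Finset (Fin n → Bool)} (hT : IsCode n d T)
    (hf : PreservesFar n d f) : IsCode n d (T.image f) := by
  intro a ha b hb hab
  obtain ⟨u, hu, rfl⟩ := Finset.mem_image.1 ha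
  obtain ⟨v, hv, rfl⟩ := Finset.mem_image.1 hb
  exact hf u v (hT u hu v hv fun h => hab (h ▸ rfl))

theorem image_filter_mem_eq {T S : Finset (Fin n → Bool)} (h : S ⊆ T.image f) :
    (T.filter (f · ∈ S)).image f = S := by
  ext a
  simp only [Finset.mem_image, Finset.mem_filter]
  constructor
  · rintro ⟨u, ⟨-, hu⟩, rfl⟩
    exact hu
  · intro ha
    obtain ⟨u, hu, rfl⟩ := Finset.mem_image.1 (h ha)
    exact ⟨u, ⟨hu, ha⟩, rfl⟩

theorem eq_filter_mem_of_injOn {T R : Finset (Fin n → Bool)} (hT : Set.InjOn f T)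
    (h : R ⊆ T) : R = T.filter (f · ∈ R.image f) := by
  ext u
  simp only [Finset.mem_filter, Finset.mem_image]
  constructor
  · exact fun hu => ⟨h hu, u, hu, rfl⟩
  · rintro ⟨hu, v, hv, hvu⟩
    exact hT (h hv) hu hvu ▸ hv

theorem card_add_two_mul_card_sdiff {R T S S' : Finset (Fin n → Bool)} (hT : Set.InjOn f T)
    (hRT : R ⊆ T) (hR : R.image f = S) (hS' : T.image f = S') :
    R.card + 2 * (T \ R).card = S.card + 2 * (S' \ S).card := by
  subst hR hS'
  rw [Finset.card_sdiff_of_subset hRT,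
    Finset.card_sdiff_of_subset (Finset.image_subset_image hRT),
    Finset.card_image_of_injOn hT, Finset.card_image_of_injOn (hT.mono (mod_cast hRT))]

/-- The incidence matrix between `𝒩(R)` and `𝒩(S)` induced by `f`. -/
def incidence (n d : ℕ) (f : (Fin n → Bool) → (Fin n → Bool)) (R S : Finset (Fin n → Bool)) :
    Matrix (NSet n d R) (NSet n d S) ℝ :=
  fun T S' => if T.1.image f = S'.1 then 1 else 0

theorem incidence_conj_apply (x : Finset (Fin n → Bool) → ℝ) (R S : Finset (Fin n → Bool))
    (S' S'' : NSet n d S) :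
    ((incidence n d f R S).conjTranspose * MS n d R x * incidence n d f R S) S' S'' =
      ∑ p : NSet n d R × NSet n d R with
        IsCode n d (p.1.1 ∪ p.2.1) ∧ p.1.1.image f = S'.1 ∧ p.2.1.image f = S''.1,
        x (p.1.1 ∪ p.2.1) := by
  rw [Finset.sum_filter, Fintype.sum_prod_type, Finset.sum_comm, Matrix.mul_apply]
  refine Finset.sum_congr rfl fun T'' _ => ?_
  rw [Matrix.mul_apply, Finset.sum_mul]
  refine Finset.sum_congr rfl fun T' _ => ?_
  simp only [Matrix.conjTranspose_apply, incidence, MS, star_trivial]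
  split_ifs <;> simp_all

theorem MS_pushforward (hd : 0 < d) (hf : PreservesFar n d f)
    (x : Finset (Fin n → Bool) → ℝ) (S : Finset (Fin n → Bool)) :
    MS n d S (pushforward n d f x) =
      ∑ R with IsCode n d R ∧ R.image f = S,
        (incidence n d f R S).conjTranspose * MS n d R x * incidence n d f R S := by
  ext S' S''
  have hcode : MS n d S (pushforward n d f x) S' S'' = pushforward n d f x (S'.1 ∪ S''.1) := by
    rw [MS]
    split_ifs with h
    · rfl
    · refine (Finset.sum_eq_zero fun T hT => ?_).symm
      obtain ⟨hT, hTS⟩ := (Finset.mem_filter.1 hT).2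
      exact absurd (hTS ▸ hT.image hf) h
  rw [hcode, Matrix.sum_apply, Finset.sum_congr rfl fun R _ => incidence_conj_apply x R S S' S'',
    Finset.sum_sigma', pushforward]
  symm
  refine Finset.sum_bij (fun q _ => q.2.1.1 ∪ q.2.2.1) ?_ ?_ ?_ ?_
  · rintro ⟨R, T', T''⟩ h
    simp only [Finset.mem_sigma, Finset.mem_filter, Finset.mem_univ, true_and] at h ⊢
    exact ⟨h.2.1, by rw [Finset.image_union, h.2.2.1, h.2.2.2]⟩
  · rintro ⟨R₁, ⟨T₁', h₁'⟩, ⟨T₁'', h₁''⟩⟩ h₁ ⟨R₂, ⟨T₂', h₂'⟩, ⟨T₂'', h₂''⟩⟩ h₂ heq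
    simp only [Finset.mem_sigma, Finset.mem_filter, Finset.mem_univ, true_and] at h₁ h₂ heq
    have hinj := h₁.2.1.injOn hd hf
    have hR : R₁ = R₂ := by
      rw [eq_filter_mem_of_injOn hinj (h₁'.2.1.trans Finset.subset_union_left), h₁.1.2, ← h₂.1.2]
      exact (eq_filter_mem_of_injOn hinj
        (heq ▸ h₂'.2.1.trans Finset.subset_union_left)).symm
    have hT' : T₁' = T₂' := by
      rw [eq_filter_mem_of_injOn hinj Finset.subset_union_left, h₁.2.2.1, ← h₂.2.2.1]
      exact (eq_filter_mem_of_injOn hinj (heq ▸ Finset.subset_union_left)).symm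
    have hT'' : T₁'' = T₂'' := by
      rw [eq_filter_mem_of_injOn hinj Finset.subset_union_right, h₁.2.2.2, ← h₂.2.2.2]
      exact (eq_filter_mem_of_injOn hinj (heq ▸ Finset.subset_union_right)).symm
    subst hR hT' hT''
    rfl
  · intro T hT
    obtain ⟨hT, hTS⟩ := (Finset.mem_filter.1 hT).2
    have hinj := hT.injOn hd hf
    have hS' : S'.1 ⊆ T.image f := hTS ▸ Finset.subset_union_left
    have hS'' : S''.1 ⊆ T.image f := hTS ▸ Finset.subset_union_right
    have hmono {A B : Finset (Fin n → Bool)} (h : A ⊆ B) :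
        T.filter (f · ∈ A) ⊆ T.filter (f · ∈ B) :=
      Finset.monotone_filter_right T fun u _ hu => h hu
    have himS := image_filter_mem_eq (S'.2.2.1.trans hS')
    have hmem (A : NSet n d S) (hA : A.1 ⊆ T.image f) :
        IsCode n d (T.filter (f · ∈ A.1)) ∧ T.filter (f · ∈ S) ⊆ T.filter (f · ∈ A.1) ∧
          (T.filter (f · ∈ S)).card +
            2 * (T.filter (f · ∈ A.1) \ T.filter (f · ∈ S)).card ≤ 4 := by
      refine ⟨hT.mono (Finset.filter_subset _ _), hmono A.2.2.1, ?_⟩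
      rw [card_add_two_mul_card_sdiff (hinj.mono (mod_cast Finset.filter_subset _ _))
        (hmono A.2.2.1) himS (image_filter_mem_eq hA)]
      exact A.2.2.2
    have hunion : T.filter (f · ∈ S'.1) ∪ T.filter (f · ∈ S''.1) = T := by
      rw [← Finset.filter_or]
      refine Finset.filter_true_of_mem fun u hu => ?_
      rw [← Finset.mem_union, ← hTS]
      exact Finset.mem_image_of_mem f hu
    refine ⟨⟨T.filter (f · ∈ S), ⟨_, hmem S' hS'⟩, ⟨_, hmem S'' hS''⟩⟩, ?_, hunion⟩
    simp only [Finset.mem_sigma, Finset.mem_filter, Finset.mem_univ, true_and]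
    refine ⟨⟨hT.mono (Finset.filter_subset _ _), himS⟩, ?_, image_filter_mem_eq hS',
      image_filter_mem_eq hS''⟩
    rw [hunion]
    exact hT
  · exact fun _ _ => rfl

theorem Feasible.pushforward (hd : 0 < d) (hf : PreservesFar n d f)
    {x : Finset (Fin n → Bool) → ℝ} (hx : Feasible n d x) :
    Feasible n d (pushforward n d f x) := by
  refine ⟨?_, fun S hS => ?_⟩
  · rw [← hx.1, _root_.pushforward]
    refine Finset.sum_eq_single_of_mem ∅ (by simp [IsCode]) fun T hT hne => ?_
    exact absurd (Finset.image_eq_empty.1 (Finset.mem_filter.1 hT).2.2) hne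
  · rw [MS_pushforward hd hf]
    refine Matrix.posSemidef_sum _ fun R hR => ?_
    obtain ⟨hR, hRS⟩ := (Finset.mem_filter.1 hR).2
    refine (hx.2 R ⟨hR, ?_⟩).conjTranspose_mul_mul_same _
    rw [← Finset.card_image_of_injOn (hR.injOn hd hf), hRS]
    exact hS.2

theorem Obj_pushforward (hd : 0 < d) (hf : PreservesFar n d f)
    (x : Finset (Fin n → Bool) → ℝ) : Obj n (pushforward n d f x) = Obj n x := by
  rw [Obj, Obj, ← Finset.sum_fiberwise Finset.univ f fun w => x {w}]
  refine Finset.sum_congr rfl fun v _ => ?_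
  symm
  refine Finset.sum_bij (fun w _ => ({w} : Finset (Fin n → Bool))) ?_ ?_ ?_ ?_
  · intro w hw
    simpa [IsCode.singleton] using hw
  · exact fun _ _ _ _ h => Finset.singleton_injective h
  · intro T hT
    obtain ⟨hT, hTv⟩ := (Finset.mem_filter.1 hT).2
    have hcard : T.card = 1 := by
      rw [← Finset.card_image_of_injOn (hT.injOn hd hf), hTv, Finset.card_singleton]
    obtain ⟨w, rfl⟩ := Finset.card_eq_one.1 hcard
    exact ⟨w, by simpa using hTv, rfl⟩
  · exact fun _ _ => rfl

end Pushforward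

section Parity

variable {n : ℕ}

theorem even_hammingDist_iff (u v : Fin n → Bool) :
    Even (hammingDist u v) ↔ (EvenWeight u ↔ EvenWeight v) := by
  have key : (hammingDist u v : ZMod 2) =
      ((Finset.univ.filter (fun i => u i = true)).card : ZMod 2) +
        ((Finset.univ.filter (fun i => v i = true)).card : ZMod 2) := by
    simp only [hammingDist, Finset.card_filter, Nat.cast_sum, ← Finset.sum_add_distrib]
    refine Finset.sum_congr rfl fun i _ => ?_
    cases u i <;> cases v i <;> (simp; try decide)
  rw [EvenWeight, EvenWeight, ← Nat.even_add, ← ZMod.natCast_eq_zero_iff_even,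
    ← ZMod.natCast_eq_zero_iff_even, key, Nat.cast_add]

/-- Flip the `i`-th letter of a word. -/
def flipAt (i : Fin n) (v : Fin n → Bool) : Fin n → Bool :=
  fun j => (if j = i then Bool.not else id) (v j)

theorem hammingDist_flipAt_flipAt (i : Fin n) (u v : Fin n → Bool) :
    hammingDist (flipAt i u) (flipAt i v) = hammingDist u v := by
  refine hammingDist_comp (fun j => if j = i then Bool.not else id) fun j => ?_
  split_ifs
  · exact Bool.not_injective
  · exact Function.injective_id

theorem hammingDist_flipAt_self (i : Fin n) (v : Fin n → Bool) :
    hammingDist v (flipAt i v) = 1 := by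
  rw [hammingDist, Finset.card_eq_one]
  refine ⟨i, ?_⟩
  ext j
  rw [Finset.mem_filter, Finset.mem_singleton]
  by_cases h : j = i <;> simp [flipAt, h]

/-- Flip the `i`-th letter of the words of odd weight. -/
def evenize (i : Fin n) (v : Fin n → Bool) : Fin n → Bool :=
  if EvenWeight v then v else flipAt i v

theorem evenWeight_evenize (i : Fin n) (v : Fin n → Bool) : EvenWeight (evenize i v) := by
  unfold evenize
  split_ifs with h
  · exact h
  · have := even_hammingDist_iff v (flipAt i v)
    rw [hammingDist_flipAt_self] at this
    simp only [Nat.not_even_one, false_iff] at this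
    tauto

theorem le_hammingDist_flipAt {d : ℕ} (hd : Even d) (i : Fin n) {u v : Fin n → Bool}
    (huv : d ≤ hammingDist u v) (hpar : ¬ (EvenWeight u ↔ EvenWeight v)) :
    d ≤ hammingDist u (flipAt i v) := by
  rw [← even_hammingDist_iff] at hpar
  have hne : d ≠ hammingDist u v := fun h => hpar (h ▸ hd)
  have htri := hammingDist_triangle u (flipAt i v) v
  rw [hammingDist_comm (flipAt i v), hammingDist_flipAt_self] at htri
  omega

theorem preservesFar_evenize {d : ℕ} (hd : Even d) (i : Fin n) :
    PreservesFar n d (evenize i) := by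
  intro u v huv
  unfold evenize
  split_ifs with hu hv hv
  · exact huv
  · exact le_hammingDist_flipAt hd i huv (by tauto)
  · rw [hammingDist_comm] at huv ⊢
    exact le_hammingDist_flipAt hd i huv (by tauto)
  · rwa [hammingDist_flipAt_flipAt]

end Parity

/-- For even `d ≥ 2`, the supremum defining `A_4(n,d)` does not change if the feasible
functions `x` are additionally required to vanish on every `S ∈ 𝒩_4` that contains a
word of odd weight (i.e. `S` is not contained in the set `E` of even-weight words). -/
theorem Abound_even_restriction (n d : ℕ) (hn : 0 < n) (hd : 2 ≤ d) (hdeven : Even d) :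
    sSup {y : ℝ | ∃ x : Finset (Fin n → Bool) → ℝ, Feasible n d x ∧ y = Obj n x} =
    sSup {y : ℝ | ∃ x : Finset (Fin n → Bool) → ℝ, Feasible n d x ∧
      (∀ S ∈ NN4 n d, ¬ (∀ v ∈ S, EvenWeight v) → x S = 0) ∧ y = Obj n x} := by
  congr 1
  ext y
  constructor
  · rintro ⟨x, hx, rfl⟩
    have hpos : 0 < d := by omega
    have hf := preservesFar_evenize hdeven (⟨0, hn⟩ : Fin n)
    refine ⟨_, hx.pushforward hpos hf, fun S _ hodd => ?_, (Obj_pushforward hpos hf x).symm⟩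
    refine Finset.sum_eq_zero fun T hT => ?_
    refine absurd (fun v hv => ?_) hodd
    rw [← (Finset.mem_filter.1 hT).2.2] at hv
    obtain ⟨w, -, rfl⟩ := Finset.mem_image.1 hv
    exact evenWeight_evenize _ w
  · rintro ⟨x, hx, -, rfl⟩
    exact ⟨x, hx, rfl⟩
end
end
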